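/- Let p, q ≥ 3 and r ≥ 1 be integers. If G is any simple graph whose Laplacian permanental polynomial equals that of d(p,q,r), i.e., per(xI − L(G)) = per(xI − L(d(p,q,r))) as polynomials in x, then G is isomorphic to d(p,q,r). -/

import Mathlib

open scoped Classical
open Polynomial

noncomputable section

/-- The Laplacian permanental polynomial `per(x·I − L(G))` of a graph `G`,
where `L(G) = D(G) − A(G)` is the Laplacian matrix. -/
def lapPermPoly {V : Type*} [Fintype V] (G : SimpleGraph V) : Polynomial ℚ :=
  Matrix.permanent
    (Matrix.diagonal (fun _ : V => (X : Polynomial ℚ)) - (G.lapMatrix ℚ).map Polynomial.C)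

/-- The bicyclic graph `d(p,q,r)` on `p + q + r` vertices: vertices `0, …, p-1` form the
cycle `C_p`, vertices `p, …, p+q-1` form the cycle `C_q`, and vertices `p+q, …, p+q+r-1`
form a path of `r` internal vertices whose ends are joined to vertex `0` of `C_p` and to
vertex `p` of `C_q` (i.e. a path on `r + 2` vertices has each end vertex identified with a
vertex of one of the two cycles). -/
def dGraph (p q r : ℕ) : SimpleGraph (Fin (p + q + r)) :=
  SimpleGraph.fromRel (fun i j =>
    (i.val + 1 = j.val ∧ j.val < p) ∨
    (i.val = p - 1 ∧ j.val = 0) ∨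
    (i.val + 1 = j.val ∧ p ≤ i.val ∧ j.val < p + q) ∨
    (i.val = p + q - 1 ∧ j.val = p) ∨
    (i.val + 1 = j.val ∧ p + q ≤ i.val) ∨
    (i.val = 0 ∧ j.val = p + q) ∨
    (i.val = p + q + r - 1 ∧ j.val = p))

/-! ### Arithmetic part -/

def fU {R : Type*} [CommRing R] (w : R) (p : ℕ) : R :=
  (1 - w + 2 * w ^ 2) + 2 * w ^ p * (1 + w ^ 2) + (-1) ^ p * w ^ (2 * p) * (1 + w)

def fT {R : Type*} [CommRing R] (w : R) (p : ℕ) : R :=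
  (w ^ 2 - w) + 2 * w ^ p * (1 + w ^ 2) + (-1) ^ p * w ^ (2 * p) * (2 + w + w ^ 2)

def fC {R : Type*} [CommRing R] (w : R) (k : ℕ) : R :=
  1 + 2 * w ^ k + (-1) ^ k * w ^ (2 * k)

def fTh {R : Type*} [CommRing R] (w : R) (a b c : ℕ) : R :=
  (1 - w + 2 * w ^ 2) ^ 2
  - w ^ 2 * (1 - w) ^ 2 * ((-1) ^ a * w ^ (2 * a) + (-1) ^ b * w ^ (2 * b) + (-1) ^ c * w ^ (2 * c))
  + (1 + w) ^ 2 * ((-1) ^ (a + b) * w ^ (2 * (a + b)) + (-1) ^ (a + c) * w ^ (2 * (a + c))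
      + (-1) ^ (b + c) * w ^ (2 * (b + c)))
  - (-1) ^ (a + b + c) * (2 + w + w ^ 2) ^ 2 * w ^ (2 * (a + b + c))
  + 2 * (1 + w ^ 2) ^ 2 * (w ^ (a + b) * (1 - (-1) ^ c * w ^ (2 * c))
      + w ^ (a + c) * (1 - (-1) ^ b * w ^ (2 * b)) + w ^ (b + c) * (1 - (-1) ^ a * w ^ (2 * a)))

lemma map_fU {R S : Type*} [CommRing R] [CommRing S] (f : R →+* S) (w : R) (p : ℕ) :
    f (fU w p) = fU (f w) p := by
  have h2 : f 2 = 2 := map_ofNat f 2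
  simp [fU, h2]

lemma map_fT {R S : Type*} [CommRing R] [CommRing S] (f : R →+* S) (w : R) (p : ℕ) :
    f (fT w p) = fT (f w) p := by
  have h2 : f 2 = 2 := map_ofNat f 2
  simp [fT, h2]

lemma map_fC {R S : Type*} [CommRing R] [CommRing S] (f : R →+* S) (w : R) (p : ℕ) :
    f (fC w p) = fC (f w) p := by
  have h2 : f 2 = 2 := map_ofNat f 2
  simp [fC, h2]

lemma map_fTh {R S : Type*} [CommRing R] [CommRing S] (f : R →+* S) (w : R) (a b c : ℕ) :
    f (fTh w a b c) = fTh (f w) a b c := by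
  have h2 : f 2 = 2 := map_ofNat f 2
  simp [fTh, h2]

/-- truncated polynomial ring -/
abbrev TR (k : Type) [CommRing k] (N : ℕ) : Type := AdjoinRoot (X ^ N : k[X])

abbrev tw (k : Type) [CommRing k] (N : ℕ) : TR k N := AdjoinRoot.root (X ^ N : k[X])

lemma tw_pow (k : Type) [CommRing k] (N : ℕ) {a : ℕ} (h : N ≤ a) : tw k N ^ a = 0 := by
  have : tw k N ^ a = AdjoinRoot.mk (X ^ N : k[X]) (X ^ a) := by
    rw [map_pow, AdjoinRoot.mk_X]
  rw [this, AdjoinRoot.mk_eq_zero]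
  exact pow_dvd_pow _ h

lemma tw_coeff {k : Type} [CommRing k] {N : ℕ} {P : k[X]}
    (h : AdjoinRoot.mk (X ^ N : k[X]) P = 0) {j : ℕ} (hj : j < N) : P.coeff j = 0 := by
  rw [AdjoinRoot.mk_eq_zero, X_pow_dvd_iff] at h
  exact h j hj

/-- the evaluation hom from ℤ[X] -/
def toTR (k : Type) [CommRing k] (N : ℕ) : ℤ[X] →+* TR k N :=
  (AdjoinRoot.mk (X ^ N : k[X])).comp (Polynomial.mapRingHom (Int.castRingHom k))

lemma toTR_X (k : Type) [CommRing k] (N : ℕ) : toTR k N X = tw k N := by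
  simp [toTR]

lemma tw_unit {k : Type} [CommRing k] {N : ℕ} (z : TR k N) : IsUnit (1 + tw k N * z) := by
  apply IsNilpotent.isUnit_one_add
  refine ⟨N, ?_⟩
  rw [mul_pow, tw_pow k N le_rfl, zero_mul]

lemma tw_indep {m : ℕ} {c0 c1 c2 c3 : ℤ}
    (h : tw ℤ (m+4) ^ m * (c0 + c1 * tw ℤ (m+4) + c2 * tw ℤ (m+4) ^ 2 + c3 * tw ℤ (m+4) ^ 3) = 0) :
    c0 = 0 ∧ c1 = 0 ∧ c2 = 0 ∧ c3 = 0 := by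
  have h' : AdjoinRoot.mk (X ^ (m+4) : ℤ[X]) (X ^ m * (C c0 + C c1 * X + C c2 * X ^ 2 + C c3 * X ^ 3)) = 0 := by
    simpa using h
  have e : ∀ j, j < 4 → (C c0 + C c1 * X + C c2 * X ^ 2 + C c3 * X ^ 3 : ℤ[X]).coeff j = 0 := by
    intro j hj
    have := tw_coeff h' (j := j + m) (by omega)
    rwa [Polynomial.coeff_X_pow_mul] at this
  refine ⟨?_, ?_, ?_, ?_⟩
  · have := e 0 (by norm_num)
    simp only [coeff_add, coeff_C_mul, coeff_X_pow, coeff_X, coeff_C] at this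
    simpa using this
  · have := e 1 (by norm_num)
    simp only [coeff_add, coeff_C_mul, coeff_X_pow, coeff_X, coeff_C] at this
    simpa using this
  · have := e 2 (by norm_num)
    simp only [coeff_add, coeff_C_mul, coeff_X_pow, coeff_X, coeff_C] at this
    simpa using this
  · have := e 3 (by norm_num)
    simp only [coeff_add, coeff_C_mul, coeff_X_pow, coeff_X, coeff_C] at this
    simpa using this

lemma tw_indep0 {m : ℕ} {c0 : ℤ}
    (h : tw ℤ (m+1) ^ m * c0 = 0) : c0 = 0 := by
  have h' : AdjoinRoot.mk (X ^ (m+1) : ℤ[X]) (X ^ m * C c0) = 0 := by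
    simpa using h
  have := tw_coeff h' (j := 0 + m) (by omega)
  rw [Polynomial.coeff_X_pow_mul] at this
  simpa using this

/-- mod 2 exponent comparison -/
lemma tw2 {N a b c d : ℕ}
    (h : tw (ZMod 2) N ^ a + tw (ZMod 2) N ^ b + tw (ZMod 2) N ^ c + tw (ZMod 2) N ^ d = 0) (j : ℕ) (hj : j < N) :
    ((if j = a then 1 else 0) + (if j = b then 1 else 0) + (if j = c then 1 else 0) + (if j = d then 1 else 0)) % 2 = 0 := by
  have h' : AdjoinRoot.mk (X ^ N : (ZMod 2)[X]) (X ^ a + X ^ b + X ^ c + X ^ d) = 0 := by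
    simpa using h
  have := tw_coeff h' hj
  simp only [coeff_add, coeff_X_pow] at this
  have h2 : (((if j = a then 1 else 0) + (if j = b then 1 else 0) + (if j = c then 1 else 0) + (if j = d then 1 else 0) : ℕ) : ZMod 2) = 0 := by
    push_cast
    exact this
  rw [ZMod.natCast_eq_zero_iff] at h2
  exact Nat.mod_eq_zero_of_dvd h2

lemma two_TR (N : ℕ) : (2 : TR (ZMod 2) N) = 0 := by
  have := congrArg (AdjoinRoot.of (X ^ N : (ZMod 2)[X])) (show (2 : ZMod 2) = 0 from rfl)
  rwa [map_zero, map_ofNat] at this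

lemma tw2_two {N a b : ℕ}
    (h : tw (ZMod 2) N ^ a = tw (ZMod 2) N ^ b) : a = b ∨ (N ≤ a ∧ N ≤ b) := by
  have h4 : tw (ZMod 2) N ^ a + tw (ZMod 2) N ^ b + tw (ZMod 2) N ^ N + tw (ZMod 2) N ^ N = 0 := by
    rw [tw_pow (ZMod 2) N le_rfl, h]
    have := two_TR N
    linear_combination (tw (ZMod 2) N ^ b) * this
  by_contra hc
  push Not at hc
  obtain ⟨h1, h2⟩ := hc
  by_cases ha : a < N
  · have := tw2 h4 a ha
    rw [if_pos rfl, if_neg h1, if_neg (by omega)] at this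
    omega
  · have := tw2 h4 b (by omega)
    rw [if_neg (Ne.symm h1), if_pos rfl, if_neg (by omega)] at this
    omega

def bet {S : Type*} [CommRing S] (w : S) (m : ℕ) (L : Multiset ℕ) : S :=
  (L.count m : S) + (L.count (m+1) : S) * w + (L.count (m+2) : S) * w ^ 2 + (L.count (m+3) : S) * w ^ 3

def nu (m : ℕ) : ℤ := if m = 3 then 1 else 0

lemma bet_cons {S : Type*} [CommRing S] (w : S) (m a : ℕ) (L : Multiset ℕ) :
    bet w m (a ::ₘ L) = bet w m L + bet w m {a} := by
  simp only [bet, Multiset.count_cons, Multiset.count_singleton]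
  push_cast
  ring

section trunc
variable {S : Type*} [CommRing S] {w : S} {m : ℕ}

lemma pow_bet (hw : ∀ a, m + 4 ≤ a → w ^ a = 0) {a : ℕ} (ha : m ≤ a) :
    w ^ a = w ^ m * bet w m {a} := by
  simp only [bet, Multiset.count_singleton]
  obtain ⟨j, rfl⟩ := Nat.exists_eq_add_of_le ha
  rcases j with _ | _ | _ | _ | j
  · simp
  · simp; ring
  · simp; ring
  · simp; ring
  · rw [hw _ (by omega)]
    simp

lemma Msq (hw : ∀ a, m + 4 ≤ a → w ^ a = 0) (hm : 3 ≤ m) :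
    w ^ m * w ^ m = (nu m : S) * w ^ m * w ^ 3 := by
  unfold nu
  split_ifs with h
  · subst h; simp
  · rw [← pow_add, hw _ (by omega)]; simp

lemma pow2_nu (hw : ∀ a, m + 4 ≤ a → w ^ a = 0) (hm : 3 ≤ m) {a : ℕ} (ha : m ≤ a) :
    (-1) ^ a * w ^ (2 * a) = - ((nu m : S) * (Multiset.count m {a} : ℕ) * w ^ m * w ^ 3) := by
  unfold nu
  rw [Multiset.count_singleton]
  split_ifs with h h' h'
  · subst h; subst h'; simp; ring
  · rw [hw _ (by omega)]; simp
  · rw [hw _ (by omega)]; simp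
  · rw [hw _ (by omega)]; simp

lemma M4 (hw : ∀ a, m + 4 ≤ a → w ^ a = 0) : w ^ m * w ^ 4 = 0 := by
  rw [← pow_add, hw _ (by omega)]

lemma prod_trunc (hw : ∀ a, m + 4 ≤ a → w ^ a = 0) (hm : 3 ≤ m) (f : ℕ → S) (α g' : S)
    (hf : ∀ a, m ≤ a → f a = α * (1 + 2 * w ^ m * (1 + w * g') * bet w m {a}
      - (nu m : S) * (Multiset.count m {a} : ℕ) * w ^ m * w ^ 3))
    (L : Multiset ℕ) (hL : ∀ a ∈ L, m ≤ a) :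
    (L.map f).prod = α ^ (Multiset.card L) * (1 + 2 * w ^ m * (1 + w * g') * bet w m L
      + (nu m : S) * (2 * (L.count m : S) ^ 2 - 3 * (L.count m : S)) * w ^ m * w ^ 3) := by
  induction L using Multiset.induction_on with
  | empty => simp [bet]
  | cons a L ih =>
    have ih := ih (fun b hb => hL b (Multiset.mem_cons_of_mem hb))
    rw [Multiset.map_cons, Multiset.prod_cons, ih, hf a (hL a (Multiset.mem_cons_self _ _)),
      Multiset.card_cons, pow_succ, bet_cons]
    have h4 := M4 hw
    have hsq := Msq hw hm
    have hc : ((a ::ₘ L).count m : S) = L.count m + (Multiset.count m {a} : ℕ) := by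
      rw [Multiset.count_cons, Multiset.count_singleton]; push_cast; rfl
    have hb : ((Multiset.count m {a} : ℕ) : S) ^ 2 = (Multiset.count m {a} : ℕ) := by
      rw [Multiset.count_singleton]; split_ifs <;> simp
    have e1 : ∀ K : Multiset ℕ, ∃ t : S, bet w m K = (K.count m : S) + w * t := fun K =>
      ⟨(K.count (m+1) : S) + (K.count (m+2) : S) * w + (K.count (m+3) : S) * w ^ 2, by
        unfold bet; ring⟩
    obtain ⟨t1, h1⟩ := e1 L
    obtain ⟨t2, h2⟩ := e1 {a}
    rw [hc, h1, h2]
    generalize ((Multiset.count m {a} : ℕ) : S) = b at *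
    generalize ((Multiset.count m L : ℕ) : S) = l at *
    generalize w ^ m = M at *
    generalize (nu m : S) = n at *
    have z3 : M * M * w = 0 := by linear_combination w * hsq + n * h4
    have key : (1 + 2 * M * (1 + w * g') * (b + w * t2) - n * b * M * w ^ 3) *
        (1 + 2 * M * (1 + w * g') * (l + w * t1) + n * (2 * l ^ 2 - 3 * l) * M * w ^ 3)
        = 1 + 2 * M * (1 + w * g') * (l + w * t1 + (b + w * t2)) +
          n * (2 * (l + b) ^ 2 - 3 * (l + b)) * M * w ^ 3 := by
      have x1 : ∀ x y : S, (M * (x + w * y)) = M * x + M * w * y := by intros; ring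
      have a1 : (1 + w * g') * (b + w * t2) = b + w * (g' * (b + w * t2) + t2) := by ring
      have a2 : (1 + w * g') * (l + w * t1) = l + w * (g' * (l + w * t1) + t1) := by ring
      have a3 : (1 + w * g') * (l + w * t1 + (b + w * t2)) = (1 + w * g') * (l + w * t1) + (1 + w * g') * (b + w * t2) := by ring
      rw [mul_assoc (2 * M) (1 + w * g'), mul_assoc (2 * M) (1 + w * g'), mul_assoc (2 * M) (1 + w * g'), a3, a1, a2]
      generalize (g' * (b + w * t2) + t2) = u
      generalize (g' * (l + w * t1) + t1) = v
      linear_combination 4 * b * l * hsq - 2 * n * M * w ^ 3 * hb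
        + (4 * b * v + 4 * u * l + 4 * u * v * w + 2 * (b + w * u) * n * (2 * l ^ 2 - 3 * l) * w ^ 2
            - 2 * n * b * (l + w * v) * w ^ 2 - n * b * n * (2 * l ^ 2 - 3 * l) * w ^ 5) * z3
    linear_combination α ^ Multiset.card L * α * key

lemma fC_trunc (hw : ∀ a, m + 4 ≤ a → w ^ a = 0) (hm : 3 ≤ m) {a : ℕ} (ha : m ≤ a) :
    fC w a = 1 * (1 + 2 * w ^ m * (1 + w * 0) * bet w m {a}
      - (nu m : S) * (Multiset.count m {a} : ℕ) * w ^ m * w ^ 3) := by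
  unfold fC
  rw [pow2_nu hw hm ha, pow_bet hw ha]
  ring

lemma fU_trunc (hw : ∀ a, m + 4 ≤ a → w ^ a = 0) (hm : 3 ≤ m) {a : ℕ} (ha : m ≤ a) :
    fU w a = (1 - w + 2 * w ^ 2) * (1 + 2 * w ^ m * (1 + w * (1 - 2 * w ^ 2)) * bet w m {a}
      - (nu m : S) * (Multiset.count m {a} : ℕ) * w ^ m * w ^ 3) := by
  unfold fU
  rw [pow2_nu hw hm ha, pow_bet hw ha]
  have h4 := M4 hw
  linear_combination ((-2 : S) * (2 - 4 * w) * bet w m {a} +  (nu m : S) * (Multiset.count m {a} : ℕ) * (2 * w - 2)) * h4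

lemma prod_fC (hw : ∀ a, m + 4 ≤ a → w ^ a = 0) (hm : 3 ≤ m) (L : Multiset ℕ) (hL : ∀ a ∈ L, m ≤ a) :
    (L.map (fC w)).prod = 1 + 2 * w ^ m * bet w m L
      + (nu m : S) * (2 * (L.count m : S) ^ 2 - 3 * (L.count m : S)) * w ^ m * w ^ 3 := by
  rw [prod_trunc hw hm (fC w) 1 0 (fun a ha => fC_trunc hw hm ha) L hL]
  ring

lemma prod_fU (hw : ∀ a, m + 4 ≤ a → w ^ a = 0) (hm : 3 ≤ m) (L : Multiset ℕ) (hL : ∀ a ∈ L, m ≤ a) :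
    (L.map (fU w)).prod = (1 - w + 2 * w ^ 2) ^ (Multiset.card L) *
     (1 + 2 * w ^ m * (1 + w * (1 - 2 * w ^ 2)) * bet w m L
      + (nu m : S) * (2 * (L.count m : S) ^ 2 - 3 * (L.count m : S)) * w ^ m * w ^ 3) :=
  prod_trunc hw hm (fU w) _ _ (fun a ha => fU_trunc hw hm ha) L hL

end trunc

section forms
variable {S : Type*} [CommRing S] {w : S}

lemma prod_fU_form (L : Multiset ℕ) (hL : ∀ a ∈ L, 1 ≤ a) : ∃ z, (L.map (fU w)).prod = 1 + w * z := by
  induction L using Multiset.induction_on with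
  | empty => exact ⟨0, by simp⟩
  | cons a L ih =>
    obtain ⟨z, hz⟩ := ih (fun b hb => hL b (Multiset.mem_cons_of_mem hb))
    obtain ⟨b, rfl⟩ := Nat.exists_eq_add_of_le' (hL a (Multiset.mem_cons_self _ _))
    rw [Multiset.map_cons, Multiset.prod_cons, hz]
    refine ⟨z + (- 1 + 2 * w + 2 * w ^ b * (1 + w ^ 2) + (-1) ^ (b+1) * w ^ (2 * b + 1) * (1 + w)) * (1 + w * z), ?_⟩
    unfold fU
    ring

lemma prod_fT_form (L : Multiset ℕ) (hL : ∀ a ∈ L, 2 ≤ a) :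
    ∃ z, (L.map (fT w)).prod = (-w) ^ (Multiset.card L) * (1 + w * z) := by
  induction L using Multiset.induction_on with
  | empty => exact ⟨0, by simp⟩
  | cons a L ih =>
    obtain ⟨z, hz⟩ := ih (fun b hb => hL b (Multiset.mem_cons_of_mem hb))
    obtain ⟨b, rfl⟩ := Nat.exists_eq_add_of_le' (hL a (Multiset.mem_cons_self _ _))
    rw [Multiset.map_cons, Multiset.prod_cons, hz, Multiset.card_cons]
    refine ⟨z - (1 + 2 * w ^ b * (1 + w ^ 2) + (-1) ^ (b+2) * w ^ (2 * b + 2) * (2 + w + w ^ 2)) * (1 + w * z), ?_⟩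
    unfold fT
    ring

lemma prod_fT_form2 (m : ℕ) (L : Multiset ℕ) (hL : ∀ a ∈ L, m ≤ a) :
    ∃ z, (L.map (fT w)).prod = (w ^ 2 - w) ^ (Multiset.card L) + w ^ m * z := by
  induction L using Multiset.induction_on with
  | empty => exact ⟨0, by simp⟩
  | cons a L ih =>
    obtain ⟨z, hz⟩ := ih (fun b hb => hL b (Multiset.mem_cons_of_mem hb))
    obtain ⟨b, rfl⟩ := Nat.exists_eq_add_of_le' (hL a (Multiset.mem_cons_self _ _))
    rw [Multiset.map_cons, Multiset.prod_cons, hz, Multiset.card_cons]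
    refine ⟨(w ^ 2 - w) * z + (2 * w ^ b * (1 + w ^ 2) + (-1) ^ (b+m) * w ^ (2 * b + m) * (2 + w + w ^ 2)) * ((w ^ 2 - w) ^ (Multiset.card L) + w ^ m * z), ?_⟩
    unfold fT
    ring

lemma prod_fC_form (m : ℕ) (L : Multiset ℕ) (hL : ∀ a ∈ L, m ≤ a) :
    ∃ z, (L.map (fC w)).prod = 1 + w ^ m * z := by
  induction L using Multiset.induction_on with
  | empty => exact ⟨0, by simp⟩
  | cons a L ih =>
    obtain ⟨z, hz⟩ := ih (fun b hb => hL b (Multiset.mem_cons_of_mem hb))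
    obtain ⟨b, rfl⟩ := Nat.exists_eq_add_of_le' (hL a (Multiset.mem_cons_self _ _))
    rw [Multiset.map_cons, Multiset.prod_cons, hz]
    refine ⟨z + (2 * w ^ b + (-1) ^ (b+m) * w ^ (2 * b + m)) * (1 + w ^ m * z), ?_⟩
    unfold fC
    ring

lemma neg_one_pow_ch2 (h2 : (2 : S) = 0) (p : ℕ) : (-1 : S) ^ p = 1 := by
  have : (-1 : S) = 1 := by linear_combination -h2
  rw [this, one_pow]

lemma fU_two (h2 : (2 : S) = 0) (p : ℕ) : fU w p = (1 + w) * (1 + w ^ (2 * p)) := by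
  unfold fU
  rw [neg_one_pow_ch2 h2]
  linear_combination (-w + w ^ 2 + w ^ p * (1 + w ^ 2)) * h2

lemma fT_two (h2 : (2 : S) = 0) (p : ℕ) : fT w p = w * fU w p := by
  rw [fU_two h2]
  unfold fT
  rw [neg_one_pow_ch2 h2]
  linear_combination (-w + w ^ p * (1 + w ^ 2) + w ^ (2 * p)) * h2

lemma fC_two (h2 : (2 : S) = 0) (p : ℕ) : fC w p = 1 + w ^ (2 * p) := by
  unfold fC
  rw [neg_one_pow_ch2 h2]
  linear_combination (w ^ p) * h2

lemma prod_fT_two (h2 : (2 : S) = 0) (L : Multiset ℕ) :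
    (L.map (fT w)).prod = w ^ (Multiset.card L) * (L.map (fU w)).prod := by
  induction L using Multiset.induction_on with
  | empty => simp
  | cons a L ih => rw [Multiset.map_cons, Multiset.prod_cons, Multiset.map_cons, Multiset.prod_cons, ih, fT_two h2, Multiset.card_cons]; ring

lemma prod_fU_two (h2 : (2 : S) = 0) {m : ℕ} (hw : ∀ a, 2 * m ≤ a → w ^ a = 0)
    (L : Multiset ℕ) (hL : ∀ a ∈ L, m ≤ a) :
    (L.map (fU w)).prod = (1 + w) ^ (Multiset.card L) := by
  induction L using Multiset.induction_on with
  | empty => simp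
  | cons a L ih =>
    have ih := ih (fun b hb => hL b (Multiset.mem_cons_of_mem hb))
    have := hL a (Multiset.mem_cons_self _ _)
    rw [Multiset.map_cons, Multiset.prod_cons, ih, fU_two h2, Multiset.card_cons, hw (2 * a) (by omega)]; ring

lemma prod_fC_two (h2 : (2 : S) = 0) {m : ℕ} (hw : ∀ a, 2 * m ≤ a → w ^ a = 0)
    (L : Multiset ℕ) (hL : ∀ a ∈ L, m ≤ a) :
    (L.map (fC w)).prod = 1 := by
  induction L using Multiset.induction_on with
  | empty => simp
  | cons a L ih =>
    have ih := ih (fun b hb => hL b (Multiset.mem_cons_of_mem hb))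
    have := hL a (Multiset.mem_cons_self _ _)
    rw [Multiset.map_cons, Multiset.prod_cons, ih, fC_two h2, hw (2 * a) (by omega)]; ring
end forms

lemma map_prod_f {R S : Type*} [CommRing R] [CommRing S] (φ : R →+* S) (f : ℕ → R) (g : ℕ → S)
    (h : ∀ a, φ (f a) = g a) (L : Multiset ℕ) : φ (L.map f).prod = (L.map g).prod := by
  rw [map_multiset_prod, Multiset.map_map]
  congr 1
  exact Multiset.map_congr rfl (fun a _ => h a)

def DumbId {R : Type*} [CommRing R] (w : R) (A A' B ks : Multiset ℕ) (r r' : ℕ) : Prop :=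
  (A.map (fU w)).prod * (B.map (fU w)).prod
      + (-1) ^ r * w ^ (2 * r + 2) * ((A.map (fT w)).prod * (B.map (fT w)).prod)
    = (ks.map (fC w)).prod * ((A'.map (fU w)).prod * (B.map (fU w)).prod
      + (-1) ^ r' * w ^ (2 * r' + 2) * ((A'.map (fT w)).prod * (B.map (fT w)).prod))

lemma DumbId.map {R S : Type*} [CommRing R] [CommRing S] {w : R} {A A' B ks : Multiset ℕ} {r r' : ℕ}
    (h : DumbId w A A' B ks r r') (φ : R →+* S) : DumbId (φ w) A A' B ks r r' := by
  unfold DumbId at *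
  have := congrArg φ h
  have hU : ∀ L : Multiset ℕ, φ (L.map (fU w)).prod = (L.map (fU (φ w))).prod :=
    map_prod_f φ _ _ (map_fU φ w)
  have hT : ∀ L : Multiset ℕ, φ (L.map (fT w)).prod = (L.map (fT (φ w))).prod :=
    map_prod_f φ _ _ (map_fT φ w)
  have hC : ∀ L : Multiset ℕ, φ (L.map (fC w)).prod = (L.map (fC (φ w))).prod :=
    map_prod_f φ _ _ (map_fC φ w)
  simpa only [map_add, map_mul, map_pow, map_neg, map_one, hU, hT, hC] using this

lemma dumb_r {A A' B ks : Multiset ℕ} {r r' m : ℕ} (h : DumbId (X : ℤ[X]) A A' B ks r r')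
    (hc : Multiset.card A = Multiset.card A') (hc2 : Multiset.card A + Multiset.card B = 2)
    (hA : ∀ a ∈ A, m ≤ a) (hA' : ∀ a ∈ A', m ≤ a) (hk : ∀ a ∈ ks, m ≤ a) (hB : ∀ a ∈ B, 3 ≤ a)
    (hm : 3 ≤ m) : r = r' ∨ (m ≤ r + 2 ∧ m ≤ r' + 2) := by
  have h := h.map (toTR (ZMod 2) (2 * m))
  rw [toTR_X] at h
  have h2 := two_TR (2 * m)
  have hw : ∀ a, 2 * m ≤ a → tw (ZMod 2) (2 * m) ^ a = 0 := fun a ha => tw_pow _ _ ha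
  unfold DumbId at h
  rw [prod_fT_two h2, prod_fT_two h2, prod_fT_two h2, prod_fC_two h2 hw _ hk, prod_fU_two h2 hw _ hA,
    prod_fU_two h2 hw _ hA', ← hc, neg_one_pow_ch2 h2, neg_one_pow_ch2 h2] at h
  obtain ⟨z, hz⟩ := prod_fU_form (w := tw (ZMod 2) (2 * m)) B (fun b hb => by have := hB b hb; omega)
  have u1 : IsUnit ((B.map (fU (tw (ZMod 2) (2 * m)))).prod) := by rw [hz]; exact tw_unit z
  have u2 : IsUnit (1 + tw (ZMod 2) (2 * m)) := by simpa using tw_unit (1 : TR (ZMod 2) (2 * m))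
  have u3 := (u2.pow (Multiset.card A)).mul u1
  have hp : tw (ZMod 2) (2 * m) ^ Multiset.card A * tw (ZMod 2) (2 * m) ^ Multiset.card B = tw (ZMod 2) (2 * m) ^ 2 := by
    rw [← pow_add, hc2]
  have : tw (ZMod 2) (2 * m) ^ (2 * r + 4) = tw (ZMod 2) (2 * m) ^ (2 * r' + 4) := by
    apply u3.mul_left_cancel
    generalize (B.map (fU (tw (ZMod 2) (2 * m)))).prod = b at *
    generalize tw (ZMod 2) (2 * m) ^ Multiset.card A = x at *
    generalize tw (ZMod 2) (2 * m) ^ Multiset.card B = y at *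
    generalize tw (ZMod 2) (2 * m) = w at *
    linear_combination h - (1 + w) ^ Multiset.card A * b * (w ^ (2 * r + 2) - w ^ (2 * r' + 2)) * hp
  rcases tw2_two this with h | h <;> omega

lemma path_small {S : Type*} [CommRing S] {w : S} {m r : ℕ} (hw : ∀ a, m + 4 ≤ a → w ^ a = 0) (hm : 3 ≤ m)
    (hr : m ≤ r + 2) (z : S) : ∃ ε : ℤ, (ε = 0 ∨ ε = -1) ∧
      (-1) ^ r * w ^ (2 * r + 2) * (w ^ 2 * (1 + w * z)) = ε * w ^ m * w ^ 3 := by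
  have e : (-1) ^ r * w ^ (2 * r + 2) * (w ^ 2 * (1 + w * z)) = (-1) ^ r * (w ^ (2 * r + 4) + w ^ (2 * r + 5) * z) := by ring
  rw [e, hw (2 * r + 5) (by omega)]
  by_cases hh : m = 3 ∧ r = 1
  · obtain ⟨rfl, rfl⟩ := hh
    exact ⟨-1, Or.inr rfl, by push_cast; ring⟩
  · refine ⟨0, Or.inl rfl, ?_⟩
    rw [hw _ (by omega)]; simp

lemma card_count4 (m : ℕ) (A : Multiset ℕ) :
    A.count m + A.count (m+1) + A.count (m+2) + A.count (m+3) ≤ Multiset.card A := by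
  induction A using Multiset.induction_on with
  | empty => simp
  | cons a A ih =>
    simp only [Multiset.count_cons, Multiset.card_cons]
    split_ifs <;> omega

lemma unit_inv {m : ℕ} (z : TR ℤ (m+4)) : ∃ v, v * (1 + tw ℤ (m+4) * z) = 1 ∧
    v * (tw ℤ (m+4) ^ m * tw ℤ (m+4) ^ 3) = tw ℤ (m+4) ^ m * tw ℤ (m+4) ^ 3 := by
  obtain ⟨v, hv⟩ := (tw_unit z).exists_left_inv
  refine ⟨v, hv, ?_⟩
  have h4 := M4 (w := tw ℤ (m+4)) (m := m) (fun a ha => tw_pow _ _ ha)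
  generalize tw ℤ (m+4) ^ m = M at *
  linear_combination M * tw ℤ (m + 4) ^ 3 * hv - v * z * h4

lemma dumb_step {A A' B ks : Multiset ℕ} {r r' m : ℕ} (h : DumbId (X : ℤ[X]) A A' B ks r r')
    (hc : Multiset.card A = Multiset.card A') (hc2 : Multiset.card A + Multiset.card B = 2)
    (hA : ∀ a ∈ A, m ≤ a) (hA' : ∀ a ∈ A', m ≤ a) (hk : ∀ a ∈ ks, m ≤ a) (hB : ∀ a ∈ B, 3 ≤ a)
    (hm : 3 ≤ m) (hr : 1 ≤ r) (hmin : m ∈ A ∨ m ∈ A' ∨ m ∈ ks) : m ∈ A ∧ m ∈ A' := by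
  have hrr := dumb_r h hc hc2 hA hA' hk hB hm
  have h := h.map (toTR ℤ (m + 4))
  rw [toTR_X] at h
  have hw : ∀ a, m + 4 ≤ a → tw ℤ (m+4) ^ a = 0 := fun a ha => tw_pow _ _ ha
  have hInd : ∀ c0 c1 c2 c3 : ℤ, _ := fun c0 c1 c2 c3 => tw_indep (m := m) (c0 := c0) (c1 := c1) (c2 := c2) (c3 := c3)
  have hInv := fun z => unit_inv (m := m) z
  generalize tw ℤ (m+4) = w at *
  have h4 := M4 hw
  have hsq := Msq hw hm
  unfold DumbId at h
  -- path terms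
  have hδ : ∃ δ : ℤ, (-1 ≤ δ ∧ δ ≤ 1) ∧
      (-1) ^ r * w ^ (2 * r + 2) * ((A.map (fT w)).prod * (B.map (fT w)).prod)
      - (ks.map (fC w)).prod * ((-1) ^ r' * w ^ (2 * r' + 2) * ((A'.map (fT w)).prod * (B.map (fT w)).prod))
      = δ * w ^ m * w ^ 3 := by
    obtain ⟨zc, hzc⟩ := prod_fC_form (w := w) m ks hk
    rcases hrr with rfl | ⟨h1, h2⟩
    · refine ⟨0, by norm_num, ?_⟩
      obtain ⟨z1, hz1⟩ := prod_fT_form2 (w := w) m A hA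
      obtain ⟨z2, hz2⟩ := prod_fT_form2 (w := w) m A' hA'
      rw [hzc, hz1, hz2, ← hc]
      have : w ^ (2 * r + 2) * w ^ m = 0 := by rw [← pow_add]; exact hw _ (by omega)
      generalize w ^ (2 * r + 2) = W at *
      generalize w ^ m = M at *
      generalize (w ^ 2 - w) ^ Multiset.card A = Q
      generalize (B.map (fT w)).prod = TB
      push_cast
      linear_combination ((-1) ^ r * TB * (z1 - z2 - zc * (Q + M * z2))) * this
    · obtain ⟨z1, hz1⟩ := prod_fT_form (w := w) (A + B) (by
        intro a ha
        rcases Multiset.mem_add.1 ha with ha | ha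
        · have := hA a ha; omega
        · have := hB a ha; omega)
      obtain ⟨z2, hz2⟩ := prod_fT_form (w := w) (A' + B) (by
        intro a ha
        rcases Multiset.mem_add.1 ha with ha | ha
        · have := hA' a ha; omega
        · have := hB a ha; omega)
      rw [Multiset.map_add, Multiset.prod_add, Multiset.card_add] at hz1 hz2
      rw [hc2, neg_sq] at hz1
      rw [← hc, hc2, neg_sq] at hz2
      rw [hz1, hz2, hzc]
      obtain ⟨e1, he1, q1⟩ := path_small hw hm h1 z1
      obtain ⟨e2, he2, q2⟩ := path_small hw hm h2 z2
      rw [q1, q2]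
      refine ⟨e1 - e2, by omega, ?_⟩
      have z6 : w ^ m * w ^ m * w ^ 3 = 0 := by
        rw [← pow_add, ← pow_add]; exact hw _ (by omega)
      push_cast
      linear_combination -zc * e2 * z6
  obtain ⟨δ, hδ, hP⟩ := hδ
  rw [prod_fU hw hm A hA, prod_fU hw hm A' hA', ← hc] at h
  obtain ⟨zB, hzB⟩ := prod_fU_form (w := w) B (fun b hb => by have := hB b hb; omega)
  have hα : ∃ z, (1 - w + 2 * w ^ 2) ^ (Multiset.card A) = 1 + w * z := by
    generalize Multiset.card A = n
    induction n with
    | zero => exact ⟨0, by simp⟩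
    | succ n ih =>
      obtain ⟨z, hz⟩ := ih
      exact ⟨z + (-1 + 2 * w) * (1 + w * z), by rw [pow_succ, hz]; ring⟩
  obtain ⟨zA, hzA⟩ := hα
  obtain ⟨v, hv1, hv2⟩ := hInv (zA + zB + w * zA * zB)
  have hmain : (1 + 2 * w ^ m * (1 + w * (1 - 2 * w ^ 2)) * bet w m A
      + (nu m : TR ℤ (m+4)) * (2 * (A.count m : TR ℤ (m+4)) ^ 2 - 3 * (A.count m : TR ℤ (m+4))) * w ^ m * w ^ 3)
      - (ks.map (fC w)).prod * (1 + 2 * w ^ m * (1 + w * (1 - 2 * w ^ 2)) * bet w m A'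
      + (nu m : TR ℤ (m+4)) * (2 * (A'.count m : TR ℤ (m+4)) ^ 2 - 3 * (A'.count m : TR ℤ (m+4))) * w ^ m * w ^ 3)
      + δ * w ^ m * w ^ 3 = 0 := by
    rw [hzA, hzB] at h
    generalize (1 + 2 * w ^ m * (1 + w * (1 - 2 * w ^ 2)) * bet w m A
      + (nu m : TR ℤ (m+4)) * (2 * (A.count m : TR ℤ (m+4)) ^ 2 - 3 * (A.count m : TR ℤ (m+4))) * w ^ m * w ^ 3) = P1 at *
    generalize (1 + 2 * w ^ m * (1 + w * (1 - 2 * w ^ 2)) * bet w m A'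
      + (nu m : TR ℤ (m+4)) * (2 * (A'.count m : TR ℤ (m+4)) ^ 2 - 3 * (A'.count m : TR ℤ (m+4))) * w ^ m * w ^ 3) = P2 at *
    generalize (-1) ^ r * w ^ (2 * r + 2) * ((A.map (fT w)).prod * (B.map (fT w)).prod) = T1 at *
    generalize ((-1) ^ r' * w ^ (2 * r' + 2) * ((A'.map (fT w)).prod * (B.map (fT w)).prod)) = T2 at *
    generalize (ks.map (fC w)).prod = Q at *
    linear_combination v * h - δ * hv2 - v * hP - (P1 - Q * P2) * hv1
  rw [prod_fC hw hm ks hk] at hmain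
  unfold bet at hmain
  have hlin := hInd (2 * (A.count m - A'.count m - ks.count m))
    (2 * (A.count (m+1) + A.count m - A'.count (m+1) - A'.count m - ks.count (m+1)))
    (2 * (A.count (m+2) + A.count (m+1) - A'.count (m+2) - A'.count (m+1) - ks.count (m+2)))
    (2 * (A.count (m+3) + A.count (m+2) - 2 * A.count m - A'.count (m+3) - A'.count (m+2) + 2 * A'.count m - ks.count (m+3))
      + nu m * ((2 * (A.count m) ^ 2 - 3 * (A.count m)) - (2 * (A'.count m) ^ 2 - 3 * (A'.count m))
        - (2 * (ks.count m) ^ 2 - 3 * (ks.count m)) - 4 * ks.count m * A'.count m) + δ)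
    (by
      push_cast
      generalize ((A.count m : ℕ) : TR ℤ (m+4)) = a0 at *
      generalize ((A.count (m+1) : ℕ) : TR ℤ (m+4)) = a1 at *
      generalize ((A.count (m+2) : ℕ) : TR ℤ (m+4)) = a2 at *
      generalize ((A.count (m+3) : ℕ) : TR ℤ (m+4)) = a3 at *
      generalize ((A'.count m : ℕ) : TR ℤ (m+4)) = b0 at *
      generalize ((A'.count (m+1) : ℕ) : TR ℤ (m+4)) = b1 at *
      generalize ((A'.count (m+2) : ℕ) : TR ℤ (m+4)) = b2 at *
      generalize ((A'.count (m+3) : ℕ) : TR ℤ (m+4)) = b3 at *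
      generalize ((ks.count m : ℕ) : TR ℤ (m+4)) = k0 at *
      generalize ((ks.count (m+1) : ℕ) : TR ℤ (m+4)) = k1 at *
      generalize ((ks.count (m+2) : ℕ) : TR ℤ (m+4)) = k2 at *
      generalize ((ks.count (m+3) : ℕ) : TR ℤ (m+4)) = k3 at *
      generalize ((nu m : ℤ) : TR ℤ (m+4)) = n at *
      generalize w ^ m = M at *
      linear_combination hmain
        + (2 * (k0 + k1 * w + k2 * w ^ 2 + k3 * w ^ 3) + n * (2 * k0 ^ 2 - 3 * k0) * w ^ 3)
          * (2 * (1 + w * (1 - 2 * w ^ 2)) * (b0 + b1 * w + b2 * w ^ 2 + b3 * w ^ 3) + n * (2 * b0 ^ 2 - 3 * b0) * w ^ 3) * hsq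
        + (n * (2 * k0 * (2 * ((b1 + b2 * w + b3 * w ^ 2) + (1 - 2 * w ^ 2) * (b0 + b1 * w + b2 * w ^ 2 + b3 * w ^ 3)) + n * (2 * b0 ^ 2 - 3 * b0) * w ^ 2)
            + (2 * (k1 + k2 * w + k3 * w ^ 2) + n * (2 * k0 ^ 2 - 3 * k0) * w ^ 2)
               * (2 * (1 + w * (1 - 2 * w ^ 2)) * (b0 + b1 * w + b2 * w ^ 2 + b3 * w ^ 3) + n * (2 * b0 ^ 2 - 3 * b0) * w ^ 3))
          - 2 * (((a3 - b3) - 2 * (a1 - b1)) - 2 * (a2 - b2) * w - 2 * (a3 - b3) * w ^ 2)) * h4)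
  have c1 := card_count4 m A
  have c2 := card_count4 m A'
  rw [← Multiset.count_pos, ← Multiset.count_pos, ← Multiset.count_pos] at hmin
  rw [← Multiset.count_pos, ← Multiset.count_pos]
  obtain ⟨e0, e1, e2, e3⟩ := hlin
  have hz : (2 * ((A.count m : ℕ) : ℤ) ^ 2 - 3 * (A.count m : ℕ)) - (2 * ((A'.count m : ℕ) : ℤ) ^ 2 - 3 * (A'.count m : ℕ))
        - (2 * ((ks.count m : ℕ) : ℤ) ^ 2 - 3 * (ks.count m : ℕ)) - 4 * (ks.count m : ℕ) * (A'.count m : ℕ) = 0 := by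
    have : ((A.count m : ℕ) : ℤ) = A'.count m + ks.count m := by omega
    rw [this]; ring
  rw [hz, mul_zero] at e3
  omega

lemma dumb_arith (n : ℕ) : ∀ {A A' B ks : Multiset ℕ} {r r' : ℕ} (_ : Multiset.card A = n)
    (_ : DumbId (X : ℤ[X]) A A' B ks r r')
    (_ : Multiset.card A = Multiset.card A') (_ : Multiset.card A + Multiset.card B = 2)
    (_ : ∀ a ∈ A, 3 ≤ a) (_ : ∀ a ∈ A', 3 ≤ a) (_ : ∀ a ∈ ks, 3 ≤ a) (_ : ∀ a ∈ B, 3 ≤ a)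
    (_ : 1 ≤ r), A = A' ∧ ks = 0 := by
  induction n with
  | zero =>
    intro A A' B ks r r' hn h hc hc2 hA hA' hk hB hr
    have e1 : A = 0 := Multiset.card_eq_zero.1 hn
    have e2 : A' = 0 := Multiset.card_eq_zero.1 (by omega)
    refine ⟨by rw [e1, e2], ?_⟩
    by_contra hne
    obtain ⟨k, hkk⟩ := Multiset.exists_mem_of_ne_zero hne
    have hex : ∃ m, m ∈ ks := ⟨k, hkk⟩
    have := dumb_step (m := Nat.find hex) h hc hc2 (by simp [e1]) (by simp [e2])
      (fun a ha => Nat.find_min' hex ha) hB (hk _ (Nat.find_spec hex)) hr (Or.inr (Or.inr (Nat.find_spec hex)))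
    simp [e1] at this
  | succ n ih =>
    intro A A' B ks r r' hn h hc hc2 hA hA' hk hB hr
    obtain ⟨x, hx⟩ := Multiset.exists_mem_of_ne_zero (s := A) (by rintro rfl; simp at hn)
    have hex : ∃ m, m ∈ A ∨ m ∈ A' ∨ m ∈ ks := ⟨x, Or.inl hx⟩
    have h3 : 3 ≤ Nat.find hex := by
      rcases Nat.find_spec hex with h | h | h
      · exact hA _ h
      · exact hA' _ h
      · exact hk _ h
    obtain ⟨m1, m2⟩ := dumb_step (m := Nat.find hex) h hc hc2 (fun a ha => Nat.find_min' hex (Or.inl ha))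
      (fun a ha => Nat.find_min' hex (Or.inr (Or.inl ha)))
      (fun a ha => Nat.find_min' hex (Or.inr (Or.inr ha))) hB h3 hr (Nat.find_spec hex)
    generalize Nat.find hex = m at *
    obtain ⟨A1, rfl⟩ := Multiset.exists_cons_of_mem m1
    obtain ⟨A2, rfl⟩ := Multiset.exists_cons_of_mem m2
    simp only [Multiset.card_cons] at *
    obtain ⟨e1, e2⟩ := ih (A := A1) (A' := A2) (B := m ::ₘ B) (ks := ks) (r := r) (r' := r') (by omega) (by
      unfold DumbId at *
      simp only [Multiset.map_cons, Multiset.prod_cons] at *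
      linear_combination h) (by omega) (by rw [Multiset.card_cons]; omega)
      (fun a ha => hA a (Multiset.mem_cons_of_mem ha)) (fun a ha => hA' a (Multiset.mem_cons_of_mem ha)) hk
      (by
        intro a ha
        rcases Multiset.mem_cons.1 ha with rfl | ha
        · exact h3
        · exact hB a ha) hr
    exact ⟨by rw [e1], e2⟩

def ThId {R : Type*} [CommRing R] (w : R) (p q r : ℕ) (ks : Multiset ℕ) (a b c : ℕ) : Prop :=
  fU w p * fU w q + (-1) ^ r * w ^ (2 * r + 2) * (fT w p * fT w q)
    = (ks.map (fC w)).prod * fTh w a b c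

lemma ThId.map {R S : Type*} [CommRing R] [CommRing S] {w : R} {p q r : ℕ} {ks : Multiset ℕ} {a b c : ℕ}
    (h : ThId w p q r ks a b c) (φ : R →+* S) : ThId (φ w) p q r ks a b c := by
  unfold ThId at *
  have := congrArg φ h
  have hC : ∀ L : Multiset ℕ, φ (L.map (fC w)).prod = (L.map (fC (φ w))).prod :=
    map_prod_f φ _ _ (map_fC φ w)
  simpa only [map_add, map_mul, map_pow, map_neg, map_one, map_fU, map_fT, map_fTh, hC] using this

lemma fTh_two {S : Type*} [CommRing S] {w : S} (h2 : (2 : S) = 0) (a b c : ℕ) :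
    fTh w a b c = (1 + w) ^ 2 * (1 + w ^ (2 * a + 2) + w ^ (2 * b + 2) + w ^ (2 * c + 2)
      + w ^ (2 * (a + b)) + w ^ (2 * (a + c)) + w ^ (2 * (b + c)) + w ^ (2 * (a + b + c) + 2)) := by
  unfold fTh
  have h4 : (4 : S) = 0 := by linear_combination 2 * h2
  simp only [neg_one_pow_ch2 h2]
  linear_combination ( (1 + w ^ 2) ^ 2 * (w ^ (a + b) * (1 - w ^ (2 * c))
      + w ^ (a + c) * (1 - w ^ (2 * b)) + w ^ (b + c) * (1 - w ^ (2 * a)))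
      + (-2 * w + 2 * w ^ 2 - 2 * w ^ 3 + 2 * w ^ 4)
      - w ^ 2 * (1 + w ^ 2) * (w ^ (2 * a) + w ^ (2 * b) + w ^ (2 * c))
      - (2 + 2 * w + 3 * w ^ 2 + 2 * w ^ 3 + w ^ 4) * w ^ (2 * (a + b + c))) * h2

lemma ThId.two {N p q r : ℕ} {ks : Multiset ℕ} {a b c : ℕ}
    (h : ThId (X : ℤ[X]) p q r ks a b c) :
    (1 + tw (ZMod 2) N ^ (2 * p)) * (1 + tw (ZMod 2) N ^ (2 * q)) * (1 + tw (ZMod 2) N ^ (2 * r + 4))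
    = (ks.map (fC (tw (ZMod 2) N))).prod * (1 + tw (ZMod 2) N ^ (2 * a + 2) + tw (ZMod 2) N ^ (2 * b + 2)
      + tw (ZMod 2) N ^ (2 * c + 2)
      + tw (ZMod 2) N ^ (2 * (a + b)) + tw (ZMod 2) N ^ (2 * (a + c)) + tw (ZMod 2) N ^ (2 * (b + c))
      + tw (ZMod 2) N ^ (2 * (a + b + c) + 2)) := by
  have h := h.map (toTR (ZMod 2) N)
  rw [toTR_X] at h
  have h2 := two_TR N
  unfold ThId at h
  rw [fT_two h2, fT_two h2, fU_two h2, fU_two h2, fTh_two h2, neg_one_pow_ch2 h2] at h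
  have u2 : IsUnit (1 + tw (ZMod 2) N) := by simpa using tw_unit (1 : TR (ZMod 2) N)
  apply (u2.pow 2).mul_left_cancel
  generalize tw (ZMod 2) N = w at *
  linear_combination h

lemma theta_a {p q r : ℕ} {ks : Multiset ℕ} {a b c : ℕ}
    (h : ThId (X : ℤ[X]) p q r ks a b c) (hp : 3 ≤ p) (hq : 3 ≤ q) (hr : 1 ≤ r) (hk : ∀ k ∈ ks, 3 ≤ k)
    (ha : 1 ≤ a) (hb : 2 ≤ b) (hab : a ≤ b) (hbc : b ≤ c) : 2 ≤ a := by
  by_contra hlt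
  obtain rfl : a = 1 := by omega
  have h := h.two (N := 6)
  have h2 := two_TR 6
  have hw : ∀ a, 2 * 3 ≤ a → tw (ZMod 2) 6 ^ a = 0 := fun a ha => tw_pow _ _ ha
  rw [prod_fC_two h2 hw ks hk] at h
  have : tw (ZMod 2) 6 ^ 4 = tw (ZMod 2) 6 ^ 6 := by
    rw [hw (2 * p) (by omega), hw (2 * q) (by omega), hw (2 * r + 4) (by omega), hw (2 * b + 2) (by omega),
      hw (2 * c + 2) (by omega), hw (2 * (1 + b)) (by omega), hw (2 * (1 + c)) (by omega),
      hw (2 * (b + c)) (by omega), hw (2 * (1 + b + c) + 2) (by omega)] at h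
    rw [hw 6 (by omega)]
    linear_combination -h
  rcases tw2_two this with h | h <;> omega

/-- mod 2 information below `2m` -/
lemma theta_par {p q r : ℕ} {ks : Multiset ℕ} {a b c m : ℕ}
    (h : ThId (X : ℤ[X]) p q r ks a b c) (hp : m ≤ p) (hq : m ≤ q) (hk : ∀ k ∈ ks, m ≤ k)
    (hab : a ≤ b) (hbc : b ≤ c) (hm : m ≤ a + b) (j : ℕ) (hj : j < 2 * m) :
    ((if j = 2 * r + 4 then 1 else 0) + (if j = 2 * a + 2 then 1 else 0) + (if j = 2 * b + 2 then 1 else 0)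
      + (if j = 2 * c + 2 then 1 else 0)) % 2 = 0 := by
  have h := h.two (N := 2 * m)
  have h2 := two_TR (2 * m)
  have hw : ∀ a, 2 * m ≤ a → tw (ZMod 2) (2 * m) ^ a = 0 := fun a ha => tw_pow _ _ ha
  rw [prod_fC_two h2 hw ks hk] at h
  refine tw2 ?_ j hj
  rw [hw (2 * p) (by omega), hw (2 * q) (by omega), hw (2 * (a + b)) (by omega), hw (2 * (a + c)) (by omega),
      hw (2 * (b + c)) (by omega), hw (2 * (a + b + c) + 2) (by omega)] at h
  linear_combination h + (tw (ZMod 2) (2 * m) ^ (2 * a + 2) + tw (ZMod 2) (2 * m) ^ (2 * b + 2) + tw (ZMod 2) (2 * m) ^ (2 * c + 2)) * h2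

def thR {S : Type*} [CommRing S] (w : S) (r a b c : ℕ) : S :=
  - ((-1) ^ a * w ^ (2 * a + 2) + (-1) ^ b * w ^ (2 * b + 2) + (-1) ^ c * w ^ (2 * c + 2)) - (-1) ^ r * w ^ (2 * r + 4)

lemma theta_eqs {p q r : ℕ} {ks : Multiset ℕ} {a b c m : ℕ}
    (h : ThId (X : ℤ[X]) p q r ks a b c) (hp : m ≤ p) (hq : m ≤ q) (hk : ∀ k ∈ ks, m ≤ k) (hr : 1 ≤ r)
    (ha : 2 ≤ a) (hab : a ≤ b) (hbc : b ≤ c) (hm : m ≤ a + b) (hm3 : 3 ≤ m) (ρ2 ρ3 : ℤ)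
    (hR : thR (tw ℤ (m+4)) r a b c = tw ℤ (m+4) ^ m * (ρ2 * tw ℤ (m+4) ^ 2 + ρ3 * tw ℤ (m+4) ^ 3))
    (A Θ : Multiset ℕ) (hA : A = {p, q}) (hΘ : Θ = {a + b, a + c, b + c}) :
    (A.count m : ℤ) = ks.count m + Θ.count m ∧
    (A.count (m+1) + A.count m : ℤ) = ks.count (m+1) + Θ.count (m+1) + 2 * Θ.count m ∧
    (2 * (A.count (m+2) + A.count (m+1)) : ℤ) = 2 * (ks.count (m+2) + Θ.count (m+2) + 2 * Θ.count (m+1) + Θ.count m) + ρ2 ∧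
    (2 * (A.count (m+3) + A.count (m+2) - 2 * A.count m) : ℤ) =
      2 * (ks.count (m+3) + Θ.count (m+3) + 2 * Θ.count (m+2) + Θ.count (m+1) - 4 * Θ.count m) + ρ3 := by
  have h := h.map (toTR ℤ (m + 4))
  rw [toTR_X] at h
  have hw : ∀ a, m + 4 ≤ a → tw ℤ (m+4) ^ a = 0 := fun a ha => tw_pow _ _ ha
  have hInd : ∀ c0 c1 c2 c3 : ℤ, _ := fun c0 c1 c2 c3 => tw_indep (m := m) (c0 := c0) (c1 := c1) (c2 := c2) (c3 := c3)
  have hU := fun z => tw_unit (k := ℤ) (N := m+4) z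
  generalize tw ℤ (m+4) = w at *
  have h4 := M4 hw
  have hsq := Msq hw hm3
  have hθ0 : m = 3 → Θ.count m = 0 := by
    intro h3
    rw [hΘ, Multiset.count_eq_zero]
    simp only [Multiset.insert_eq_cons, Multiset.mem_cons, Multiset.mem_singleton]
    omega
  have hMΘ : w ^ m * w ^ m * bet w m Θ = 0 := by
    rw [hsq]
    unfold nu
    split_ifs with h3
    · unfold bet
      rw [hθ0 h3]
      push_cast
      linear_combination ((Θ.count (m+1) : TR ℤ (m+4)) + (Θ.count (m+2) : TR ℤ (m+4)) * w + (Θ.count (m+3) : TR ℤ (m+4)) * w ^ 2) * h4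
    · simp
  unfold ThId at h
  have hUU : fU w p * fU w q = (A.map (fU w)).prod := by rw [hA]; simp
  have hTT : fT w p * fT w q = (A.map (fT w)).prod := by rw [hA]; simp
  have hAm : ∀ x ∈ A, m ≤ x := by
    rw [hA]; simp only [Multiset.insert_eq_cons, Multiset.mem_cons, Multiset.mem_singleton]; omega
  have hAc : Multiset.card A = 2 := by rw [hA]; rfl
  obtain ⟨zT, hzT⟩ := prod_fT_form2 (w := w) m A hAm
  rw [hUU, hTT, hzT, prod_fU hw hm3 A hAm, hAc, prod_fC hw hm3 ks hk] at h
  have hrM : w ^ (2 * r + 2) * w ^ m = 0 := by rw [← pow_add]; exact hw _ (by omega)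
  have hΘs : w ^ (a + b) + w ^ (a + c) + w ^ (b + c) = w ^ m * bet w m Θ := by
    rw [hΘ, Multiset.insert_eq_cons, bet_cons, Multiset.insert_eq_cons, bet_cons, pow_bet hw hm,
      pow_bet hw (show m ≤ a + c by omega), pow_bet hw (show m ≤ b + c by omega)]
    ring
  have hth : fTh w a b c = (1 - w + 2 * w ^ 2) ^ 2
      + (1 - w) ^ 2 * (thR w r a b c + (-1) ^ r * w ^ (2 * r + 4)) + 2 * (1 + w ^ 2) ^ 2 * (w ^ m * bet w m Θ) := by
    rw [← hΘs]
    unfold fTh thR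
    have e1 : w ^ (a + b) * (1 - (-1) ^ c * w ^ (2 * c)) = w ^ (a + b) - (-1) ^ c * w ^ (a + b + 2 * c) := by ring
    have e2 : w ^ (a + c) * (1 - (-1) ^ b * w ^ (2 * b)) = w ^ (a + c) - (-1) ^ b * w ^ (a + c + 2 * b) := by ring
    have e3 : w ^ (b + c) * (1 - (-1) ^ a * w ^ (2 * a)) = w ^ (b + c) - (-1) ^ a * w ^ (b + c + 2 * a) := by ring
    rw [e1, e2, e3, hw (2 * (a + b)) (by omega), hw (2 * (a + c)) (by omega), hw (2 * (b + c)) (by omega),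
      hw (2 * (a + b + c)) (by omega), hw (a + b + 2 * c) (by omega), hw (a + c + 2 * b) (by omega), hw (b + c + 2 * a) (by omega)]
    ring
  rw [hth] at h
  have hMR : w ^ m * (thR w r a b c + (-1) ^ r * w ^ (2 * r + 4)) = 0 := by
    unfold thR
    have e : w ^ m * (-((-1) ^ a * w ^ (2 * a + 2) + (-1) ^ b * w ^ (2 * b + 2) + (-1) ^ c * w ^ (2 * c + 2)) - (-1) ^ r * w ^ (2 * r + 4) +
      (-1) ^ r * w ^ (2 * r + 4)) = -((-1) ^ a * w ^ (m + (2 * a + 2)) + (-1) ^ b * w ^ (m + (2 * b + 2)) + (-1) ^ c * w ^ (m + (2 * c + 2))) := by ring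
    rw [e, hw (m + (2 * a + 2)) (by omega), hw (m + (2 * b + 2)) (by omega), hw (m + (2 * c + 2)) (by omega)]
    simp
  have uα : IsUnit ((1 - w + 2 * w ^ 2) ^ 2) := by
    have := (hU (-1 + 2 * w)).pow 2
    convert this using 2
    ring
  rw [hR] at h hMR
  have hmain : 2 * w ^ m * (1 + w * (1 - 2 * w ^ 2)) * bet w m A
      + (nu m : TR ℤ (m+4)) * (2 * (A.count m : TR ℤ (m+4)) ^ 2 - 3 * (A.count m : TR ℤ (m+4))) * w ^ m * w ^ 3
      - 2 * w ^ m * bet w m ks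
      - (nu m : TR ℤ (m+4)) * (2 * (ks.count m : TR ℤ (m+4)) ^ 2 - 3 * (ks.count m : TR ℤ (m+4))) * w ^ m * w ^ 3
      - 2 * w ^ m * (1 + 2 * w + w ^ 2 - 4 * w ^ 3) * bet w m Θ
      - w ^ m * (ρ2 * w ^ 2 + ρ3 * w ^ 3) = 0 := by
    apply uα.mul_left_cancel
    have hp4 : w ^ (2 * r + 4) = w ^ (2 * r + 2) * w ^ 2 := by ring
    rw [hp4] at h hMR
    generalize bet w m A = bA at *
    generalize bet w m ks = bK at *
    generalize bet w m Θ = bT at *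
    generalize (nu m : TR ℤ (m+4)) * (2 * (A.count m : TR ℤ (m+4)) ^ 2 - 3 * (A.count m : TR ℤ (m+4))) = sA at *
    generalize (nu m : TR ℤ (m+4)) * (2 * (ks.count m : TR ℤ (m+4)) ^ 2 - 3 * (ks.count m : TR ℤ (m+4))) = sK at *
    generalize w ^ (2 * r + 2) = W at *
    generalize w ^ m = M at *
    generalize (-1 : TR ℤ (m+4)) ^ r = sg at *
    generalize (ρ2 : TR ℤ (m+4)) = ρ2 at *
    generalize (ρ3 : TR ℤ (m+4)) = ρ3 at *
    linear_combination h - sg * zT * hrM + (2 * bK + sK * w ^ 3) * ((1 - w) ^ 2 * hMR + 2 * (1 + w ^ 2) ^ 2 * hMΘ)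
      + (-16 * bT - 4 * ρ2 + (32 * bT + 4 * ρ2 - 4 * ρ3) * w + (-40 * bT - 4 * ρ2 + 4 * ρ3) * w ^ 2 + (32 * bT - 4 * ρ3) * w ^ 3) * h4
  unfold bet at hmain
  obtain ⟨e0, e1, e2, e3⟩ := hInd (2 * (A.count m - Θ.count m - ks.count m))
    (2 * (A.count (m+1) + A.count m - Θ.count (m+1) - 2 * Θ.count m - ks.count (m+1)))
    (2 * (A.count (m+2) + A.count (m+1) - Θ.count (m+2) - 2 * Θ.count (m+1) - Θ.count m - ks.count (m+2)) - ρ2)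
    (2 * (A.count (m+3) + A.count (m+2) - 2 * A.count m - Θ.count (m+3) - 2 * Θ.count (m+2) - Θ.count (m+1) + 4 * Θ.count m - ks.count (m+3))
      + nu m * ((2 * (A.count m) ^ 2 - 3 * (A.count m))
        - (2 * (ks.count m) ^ 2 - 3 * (ks.count m))) - ρ3)
    (by
      push_cast
      generalize ((A.count m : ℕ) : TR ℤ (m+4)) = a0 at *
      generalize ((A.count (m+1) : ℕ) : TR ℤ (m+4)) = a1 at *
      generalize ((A.count (m+2) : ℕ) : TR ℤ (m+4)) = a2 at *
      generalize ((A.count (m+3) : ℕ) : TR ℤ (m+4)) = a3 at *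
      generalize ((Θ.count m : ℕ) : TR ℤ (m+4)) = t0 at *
      generalize ((Θ.count (m+1) : ℕ) : TR ℤ (m+4)) = t1 at *
      generalize ((Θ.count (m+2) : ℕ) : TR ℤ (m+4)) = t2 at *
      generalize ((Θ.count (m+3) : ℕ) : TR ℤ (m+4)) = t3 at *
      generalize w ^ m = M at *
      linear_combination hmain + (-2 * (a3 - 2 * a1 - 2 * a2 * w - 2 * a3 * w ^ 2)
        + 2 * (2 * t3 + t2 - 4 * t1 + (t3 - 4 * t2) * w - 4 * t3 * w ^ 2)) * h4)
  have hnu : nu m * ((2 * ((A.count m : ℕ) : ℤ) ^ 2 - 3 * (A.count m : ℕ))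
        - (2 * ((ks.count m : ℕ) : ℤ) ^ 2 - 3 * (ks.count m : ℕ))) = 0 := by
    unfold nu
    split_ifs with h3
    · have : ((A.count m : ℕ) : ℤ) = ks.count m := by have := hθ0 h3; omega
      rw [this]; ring
    · simp
  rw [hnu] at e3
  omega

/-- the value of `w^(2l+2)` -/
lemma pow_l {m l : ℕ} (h : m ≤ 2 * l) : tw ℤ (m+4) ^ (2 * l + 2) = tw ℤ (m+4) ^ m *
    (((if 2 * l = m then 1 else 0 : ℤ) : TR ℤ (m+4)) * tw ℤ (m+4) ^ 2 + ((if 2 * l = m + 1 then 1 else 0 : ℤ) : TR ℤ (m+4)) * tw ℤ (m+4) ^ 3) := by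
  have hw : ∀ a, m + 4 ≤ a → tw ℤ (m+4) ^ a = 0 := fun a ha => tw_pow _ _ ha
  generalize tw ℤ (m+4) = w at *
  by_cases h1 : 2 * l = m
  · rw [if_pos h1, if_neg (by omega), h1]; push_cast; ring
  · by_cases h2 : 2 * l = m + 1
    · rw [if_neg h1, if_pos h2, h2]; push_cast; ring
    · rw [if_neg h1, if_neg h2, hw _ (by omega)]; push_cast; ring

lemma count2 (k x y : ℕ) : ((({x, y} : Multiset ℕ).count k : ℕ) : ℤ) = (if k = x then 1 else 0) + (if k = y then 1 else 0) := by
  simp only [Multiset.insert_eq_cons, Multiset.count_cons, Multiset.count_singleton]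
  push_cast
  ring

lemma count3 (k x y z : ℕ) : ((({x, y, z} : Multiset ℕ).count k : ℕ) : ℤ) =
    (if k = x then 1 else 0) + (if k = y then 1 else 0) + (if k = z then 1 else 0) := by
  simp only [Multiset.insert_eq_cons, Multiset.count_cons, Multiset.count_singleton]
  push_cast
  ring

lemma thR_cases {r a b c m : ℕ} (hm4 : 4 ≤ m) (hab : a ≤ b) (hbc : b ≤ c)
    (par : ∀ j < 2 * m, ((if j = 2 * r + 4 then 1 else 0) + (if j = 2 * a + 2 then 1 else 0) + (if j = 2 * b + 2 then 1 else 0)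
      + (if j = 2 * c + 2 then 1 else 0)) % 2 = 0) :
    (thR (tw ℤ (m+4)) r a b c = 0 ∧ m ≤ b + 1) ∨
    (b = c ∧ thR (tw ℤ (m+4)) r a b c = -2 * (-1) ^ b * tw ℤ (m+4) ^ (2 * b + 2)) ∨
    (a = b ∧ thR (tw ℤ (m+4)) r a b c = -2 * (-1) ^ a * tw ℤ (m+4) ^ (2 * a + 2)) := by
  have hw : ∀ a, m + 4 ≤ a → tw ℤ (m+4) ^ a = 0 := fun a ha => tw_pow _ _ ha
  have C : (m ≤ a + 1 ∧ m ≤ b + 1 ∧ m ≤ c + 1 ∧ m ≤ r + 2) ∨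
      (a = b ∧ (c = r + 1 ∨ (m ≤ c + 1 ∧ m ≤ r + 2))) ∨ (a = r + 1 ∧ (b = c ∨ (m ≤ b + 1 ∧ m ≤ c + 1))) := by
    by_cases h1 : m ≤ a + 1
    · refine Or.inl ⟨h1, by omega, by omega, ?_⟩
      by_contra h2
      have := par (2 * r + 4) (by omega)
      rw [if_pos rfl, if_neg (by omega), if_neg (by omega), if_neg (by omega)] at this
      omega
    · right
      have p1 := par (2 * a + 2) (by omega)
      by_cases h2 : a = b
      · left
        refine ⟨h2, ?_⟩
        by_contra h3
        push Not at h3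
        obtain ⟨h3, h4⟩ := h3
        subst h2
        by_cases h5 : m ≤ c + 1
        · have := par (2 * r + 4) (by have := h4 h5; omega)
          have h6 := h4 h5
          split_ifs at this <;> omega
        · have := par (2 * c + 2) (by omega)
          split_ifs at this <;> omega
      · right
        have : a = r + 1 := by split_ifs at p1 <;> omega
        refine ⟨this, ?_⟩
        by_contra h3
        push Not at h3
        obtain ⟨h3, h4⟩ := h3
        have := par (2 * b + 2) (by omega)
        split_ifs at this <;> omega
  unfold thR
  generalize tw ℤ (m+4) = w at *
  rcases C with ⟨h1, h2, h3, h4⟩ | ⟨rfl, h⟩ | ⟨rfl, h⟩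
  · refine Or.inl ⟨?_, h2⟩
    rw [hw (2 * a + 2) (by omega), hw (2 * b + 2) (by omega), hw (2 * c + 2) (by omega), hw (2 * r + 4) (by omega)]
    ring
  · refine Or.inr (Or.inr ⟨rfl, ?_⟩)
    rcases h with rfl | ⟨h1, h2⟩
    · ring
    · rw [hw (2 * c + 2) (by omega), hw (2 * r + 4) (by omega)]
      ring
  · rcases h with rfl | ⟨h1, h2⟩
    · refine Or.inr (Or.inl ⟨rfl, ?_⟩)
      ring
    · refine Or.inl ⟨?_, h1⟩
      rw [hw (2 * b + 2) (by omega), hw (2 * c + 2) (by omega)]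
      ring

/-- the main case analysis: only `p,q ∈ {m, m+1}`, `a = b`, `m = 2a` remain -/
lemma theta_main {p q r : ℕ} {ks : Multiset ℕ} {a b c : ℕ}
    (h : ThId (X : ℤ[X]) p q r ks a b c) (hp : 3 ≤ p) (hpq : p ≤ q) (hr : 1 ≤ r) (hk : ∀ k ∈ ks, 3 ≤ k)
    (ha : 2 ≤ a) (hab : a ≤ b) (hbc : b ≤ c) :
    a = b ∧ Even a ∧ p = 2 * a ∧ (∀ k ∈ ks, p ≤ k) ∧
    ((q = p ∧ ks.count p = 1) ∨ (q = p + 1 ∧ ks.count p = 0 ∧ ks.count (p+1) = 0 ∧ ks.count (p+2) = 1 ∧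
       (ks.count (p+3) ≠ 0 ∨ a + c = p + 3))) := by
  have hex : ∃ m, m = p ∨ m ∈ ks ∨ m = a + b := ⟨p, Or.inl rfl⟩
  obtain ⟨m, hm⟩ : ∃ m, m = Nat.find hex := ⟨_, rfl⟩
  have hmin : ∀ x, (x = p ∨ x ∈ ks ∨ x = a + b) → m ≤ x := fun x hx => by rw [hm]; exact Nat.find_min' hex hx
  have hspec := Nat.find_spec hex
  rw [← hm] at hspec
  clear hm
  have hmp : m ≤ p := hmin p (Or.inl rfl)
  have hmk : ∀ k ∈ ks, m ≤ k := fun k hk => hmin k (Or.inr (Or.inl hk))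
  have hmab : m ≤ a + b := hmin _ (Or.inr (Or.inr rfl))
  have hm3 : 3 ≤ m := by
    rcases hspec with h | h | h
    · omega
    · exact hk _ h
    · omega
  have hK0 : m ∈ ks → 0 < ks.count m := fun h => Multiset.count_pos.2 h
  have E := theta_eqs h hmp (by omega) hmk hr ha hab hbc hmab hm3
  have par := theta_par (m := m) h hmp (by omega) hmk hab hbc hmab
  have hw : ∀ a, m + 4 ≤ a → tw ℤ (m+4) ^ a = 0 := fun a ha => tw_pow _ _ ha
  have cA := card_count4 m {p, q}
  have cA2 : Multiset.card ({p, q} : Multiset ℕ) = 2 := rfl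
  rw [cA2] at cA
  by_cases hm4 : m = 3
  · exfalso
    subst hm4
    have E := E 0 (- ((if a = 2 then 1 else 0) + (if b = 2 then 1 else 0) + (if c = 2 then 1 else 0)) + (if r = 1 then 1 else 0)) (by
      have g : ∀ l, 2 ≤ l → (-1 : TR ℤ (3+4)) ^ l * tw ℤ (3+4) ^ (2 * l + 2) = (((if l = 2 then 1 else 0) : ℤ) : TR ℤ (3+4)) * tw ℤ (3+4) ^ 6 := by
        intro l hl
        split_ifs with h2
        · subst h2; push_cast; ring
        · rw [hw _ (by omega)]; push_cast; ring
      have g2 : (-1 : TR ℤ (3+4)) ^ r * tw ℤ (3+4) ^ (2 * r + 4) = - ((((if r = 1 then 1 else 0) : ℤ) : TR ℤ (3+4)) * tw ℤ (3+4) ^ 6) := by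
        split_ifs with h2
        · subst h2; push_cast; ring
        · rw [hw _ (by omega)]; push_cast; ring
      unfold thR
      rw [g a ha, g b (by omega), g c (by omega), g2]
      push_cast
      ring) _ _ rfl rfl
    obtain ⟨e0, e1, e2, e3⟩ := E
    have t0 := count3 3 (a + b) (a + c) (b + c)
    have t1 := count3 (3 + 1) (a + b) (a + c) (b + c)
    rw [if_neg (by omega), if_neg (by omega), if_neg (by omega)] at t0
    have hpp : 3 = p → 1 ≤ (({p, q} : Multiset ℕ).count 3 : ℕ) := by
      intro h3; exact Multiset.count_pos.2 (by simp [h3])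
    have hA0 : 1 ≤ (({p, q} : Multiset ℕ).count 3 : ℕ) := by
      rcases hspec with h | h | h
      · exact hpp h
      · have := hK0 h; omega
      · omega
    by_cases hb2 : b = 2
    · by_cases hc2 : c = 2
      · rw [if_pos (by omega), if_pos (by omega), if_pos (by omega)] at t1
        split_ifs at e3 <;> omega
      · rw [if_pos (by omega)] at t1
        split_ifs at e3 <;> omega
    · rw [if_neg hb2, if_neg (show c ≠ 2 by omega)] at e3
      split_ifs at e3 <;> omega
  have hm4 : 4 ≤ m := by omega
  by_cases hlt : m < a + b
  · exfalso
    have t0 := count3 m (a + b) (a + c) (b + c)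
    rw [if_neg (by omega), if_neg (by omega), if_neg (by omega)] at t0
    have hpp : m = p → 1 ≤ (({p, q} : Multiset ℕ).count m : ℕ) := by
      intro h3; exact Multiset.count_pos.2 (by simp [h3])
    have t1 : a + b = m + 1 → 1 ≤ (({a + b, a + c, b + c} : Multiset ℕ).count (m+1) : ℕ) := by
      intro h3; exact Multiset.count_pos.2 (by simp [h3])
    rcases thR_cases hm4 hab hbc par with ⟨hR, hb1⟩ | ⟨rfl, hR⟩ | ⟨rfl, hR⟩
    · obtain ⟨e0, e1, e2, e3⟩ := E 0 0 (by rw [hR]; simp) _ _ rfl rfl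
      have hA0 : 1 ≤ (({p, q} : Multiset ℕ).count m : ℕ) := by
        rcases hspec with h | h | h
        · exact hpp h
        · have := hK0 h; omega
        · omega
      omega
    · obtain ⟨e0, e1, e2, e3⟩ := E (-2 * (-1) ^ b * (if 2 * b = m then 1 else 0)) (-2 * (-1) ^ b * (if 2 * b = m + 1 then 1 else 0)) (by
        rw [hR, pow_l (by omega)]; push_cast; ring) _ _ rfl rfl
      have hA0 : 1 ≤ (({p, q} : Multiset ℕ).count m : ℕ) := by
        rcases hspec with h | h | h
        · exact hpp h
        · have := hK0 h; omega
        · omega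
      rcases neg_one_pow_eq_or ℤ b with hb | hb <;> rw [hb] at e3 <;> split_ifs at e3 <;> omega
    · obtain ⟨e0, e1, e2, e3⟩ := E (-2 * (-1) ^ a * (if 2 * a = m then 1 else 0)) (-2 * (-1) ^ a * (if 2 * a = m + 1 then 1 else 0)) (by
        rw [hR, pow_l (by omega)]; push_cast; ring) _ _ rfl rfl
      have hA0 : 1 ≤ (({p, q} : Multiset ℕ).count m : ℕ) := by
        rcases hspec with h | h | h
        · exact hpp h
        · have := hK0 h; omega
        · omega
      rcases neg_one_pow_eq_or ℤ a with hb | hb <;> rw [hb] at e3 <;> split_ifs at e3 <;> omega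
  have hab' : a + b = m := by omega
  rcases thR_cases hm4 hab hbc par with ⟨hR, hb1⟩ | ⟨rfl, hR⟩ | ⟨rfl, hR⟩
  · omega
  · exfalso
    obtain ⟨e0, e1, e2, e3⟩ := E (-2 * (-1) ^ b * (if 2 * b = m then 1 else 0)) (-2 * (-1) ^ b * (if 2 * b = m + 1 then 1 else 0)) (by
        rw [hR, pow_l (by omega)]; push_cast; ring) _ _ rfl rfl
    have t0 := count3 m (a + b) (a + b) (b + b)
    rw [if_pos (by omega)] at t0
    split_ifs at t0 <;> omega
  · obtain ⟨e0, e1, e2, e3⟩ := E (-2 * (-1) ^ a) 0 (by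
        rw [hR, pow_l (by omega), if_pos (by omega), if_neg (by omega)]; push_cast; ring) _ _ rfl rfl
    have t0 := count3 m (a + a) (a + c) (a + c)
    have t1 := count3 (m+1) (a + a) (a + c) (a + c)
    have t2 := count3 (m+2) (a + a) (a + c) (a + c)
    have t3 := count3 (m+3) (a + a) (a + c) (a + c)
    have a0 := count2 m p q
    have a1 := count2 (m+1) p q
    rw [if_pos (by omega)] at t0
    rw [if_neg (by omega)] at t1 t2 t3
    have hev : (-1 : ℤ) ^ a = 1 := by
      rcases neg_one_pow_eq_or ℤ a with hb | hb
      · exact hb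
      · exfalso
        rw [hb] at e2
        split_ifs at t0 <;> omega
    rw [hev] at e2
    have hpm : m = p := by
      by_contra hne
      rw [if_neg hne, if_neg (by omega)] at a0
      omega
    subst hpm
    rw [if_pos rfl] at a0
    rw [if_neg (by omega)] at a1
    refine ⟨rfl, (neg_one_pow_eq_one_iff_even (by norm_num)).1 hev, by omega, hmk, ?_⟩
    by_cases hqm : m = q
    · left
      refine ⟨hqm.symm, ?_⟩
      rw [if_pos hqm] at a0
      split_ifs at t0 <;> omega
    · right
      rw [if_neg hqm] at a0
      have t0' : ¬ (m = a + c) := by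
        intro h; rw [if_pos h] at t0; omega
      rw [if_neg t0'] at t0
      have a1' : m + 1 = q := by
        by_contra hh; rw [if_neg hh] at a1; omega
      rw [if_pos a1'] at a1
      have t1' : ¬ (m + 1 = a + c) := by
        intro h; rw [if_pos h] at t1; omega
      rw [if_neg t1'] at t1
      have t2' : ¬ (m + 2 = a + c) := by
        intro h; rw [if_pos h] at t2; omega
      rw [if_neg t2'] at t2
      refine ⟨a1'.symm, by omega, by omega, by omega, ?_⟩
      by_cases t3' : m + 3 = a + c
      · right; omega
      · left; rw [if_neg t3'] at t3; omega

lemma sum_ge_of_mem {L : Multiset ℕ} {k : ℕ} (h : k ∈ L) : k ≤ L.sum := Multiset.le_sum_of_mem h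

lemma theta_case2 {q r : ℕ} {ks : Multiset ℕ} {a c m : ℕ}
    (h : ThId (X : ℤ[X]) m q r ks a a c) (hr : 1 ≤ r)
    (ha : 2 ≤ a) (hbc : a ≤ c) (hev : Even a) (hma : m = 2 * a)
    (hmk : ∀ k ∈ ks, m ≤ k) (hsum : a + a + c + ks.sum = m + q + r + 1)
    (hq : q = m + 1) (k0 : ks.count m = 0) (k1 : ks.count (m+1) = 0) (k2 : ks.count (m+2) = 1)
    (k3 : ks.count (m+3) ≠ 0 ∨ a + c = m + 3) : False := by
  have h := h.two (N := 2 * (m + 3))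
  have h2 := two_TR (2 * (m+3))
  have hw : ∀ a, 2 * (m+3) ≤ a → tw (ZMod 2) (2 * (m+3)) ^ a = 0 := fun a ha => tw_pow _ _ ha
  obtain ⟨ks', rfl⟩ := Multiset.exists_cons_of_mem (Multiset.count_pos.1 (show 0 < ks.count (m+2) by omega))
  simp only [Multiset.count_cons] at k0 k1 k2 k3
  rw [if_neg (by omega)] at k0 k1 k3
  rw [if_pos trivial] at k2
  have hk' : ∀ k ∈ ks', m + 3 ≤ k := by
    intro k hk
    have a1 := hmk k (Multiset.mem_cons_of_mem hk)
    have a2 := Multiset.count_pos.2 hk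
    by_contra hlt
    obtain rfl | rfl | rfl : k = m ∨ k = m + 1 ∨ k = m + 2 := by omega
    all_goals omega
  rw [Multiset.map_cons, Multiset.prod_cons, prod_fC_two h2 hw ks' hk', fC_two h2] at h
  have key : tw (ZMod 2) (2 * (m+3)) ^ (2 * m + 2) + tw (ZMod 2) (2 * (m+3)) ^ (2 * r + 4)
      + tw (ZMod 2) (2 * (m+3)) ^ (2 * m + 4) + tw (ZMod 2) (2 * (m+3)) ^ (2 * c + 2) = 0 := by
    have z1 := hw (2 * m + 2 + (2 * r + 4)) (by omega)
    have z2 := hw (2 * m + 4 + (2 * c + 2)) (by omega)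
    have e1 : tw (ZMod 2) (2 * (m+3)) ^ (2 * (a + a)) = tw (ZMod 2) (2 * (m+3)) ^ (2 * m) := by congr 1; omega
    have e2 : tw (ZMod 2) (2 * (m+3)) ^ (2 * (a + a + c) + 2) = tw (ZMod 2) (2 * (m+3)) ^ (2 * m) * tw (ZMod 2) (2 * (m+3)) ^ (2 * c + 2) := by
      rw [← pow_add]; congr 1; omega
    rw [e1, e2, hq, show 2 * (m + 1) = 2 * m + 2 by ring, show 2 * (m + 2) = 2 * m + 4 by ring] at h
    rw [pow_add] at z1 z2
    have u : IsUnit (1 + tw (ZMod 2) (2 * (m+3)) ^ (2 * m)) := by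
      have := tw_unit (k := ZMod 2) (N := 2 * (m+3)) (tw (ZMod 2) (2 * (m+3)) ^ (2 * m - 1))
      rwa [← pow_succ', show 2 * m - 1 + 1 = 2 * m by omega] at this
    apply u.mul_left_cancel
    generalize tw (ZMod 2) (2 * (m+3)) ^ (2 * m) = x0 at *
    generalize tw (ZMod 2) (2 * (m+3)) ^ (2 * m + 2) = x2 at *
    generalize tw (ZMod 2) (2 * (m+3)) ^ (2 * m + 4) = x4 at *
    generalize tw (ZMod 2) (2 * (m+3)) ^ (2 * r + 4) = y at *
    generalize tw (ZMod 2) (2 * (m+3)) ^ (2 * c + 2) = z at *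
    generalize tw (ZMod 2) (2 * (m+3)) ^ (2 * a + 2) = t at *
    generalize tw (ZMod 2) (2 * (m+3)) ^ (2 * (a + c)) = s at *
    linear_combination h - (1 + x0) * (z1 - z2) + (x4 * (t + s + 1 + x0) + t + s + z + z * x0) * h2
  have hh := tw2 key
  rw [Multiset.sum_cons] at hsum
  have A : (c = m ∧ r = m) ∨ (r + 1 = m ∧ c = m + 1) := by
    have h1 := hh (2 * m + 2) (by omega)
    have h2 := hh (2 * m + 4) (by omega)
    rw [if_pos rfl, if_neg (show ¬ (2 * m + 2 = 2 * m + 4) by omega)] at h1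
    rw [if_neg (show ¬ (2 * m + 4 = 2 * m + 2) by omega), if_pos rfl] at h2
    split_ifs at h1 h2 <;> omega
  rcases A with ⟨g1, g2⟩ | ⟨h1, h2⟩
  · have hs : ks'.sum = 0 := by omega
    have hc3 : ks'.count (m+3) = 0 := by
      rw [Multiset.count_eq_zero]
      intro hm
      have := sum_ge_of_mem hm
      omega
    obtain ⟨d, hd⟩ := hev
    omega
  · omega

lemma theta_case1_fTh {S : Type*} [CommRing S] (w : S) {a : ℕ} (hev : Even a) (c : ℕ) :
    fTh w a a c = ((1 - w + 2 * w ^ 2) + (1 + w) * w ^ (2 * a)) ^ 2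
      - (-1) ^ c * w ^ (2 * c) * (- w * (1 - w) + (2 + w + w ^ 2) * w ^ (2 * a)) ^ 2
      + 4 * (1 + w ^ 2) ^ 2 * w ^ (a + c) * (1 - w ^ (2 * a)) := by
  unfold fTh
  have e1 : (-1 : S) ^ a = 1 := hev.neg_one_pow
  have e2 : (-1 : S) ^ (a + a + c) = (-1) ^ c := by rw [pow_add, pow_add, e1]; ring
  have e3 : (-1 : S) ^ (a + c) = (-1) ^ c := by rw [pow_add, e1]; ring
  have e4 : (-1 : S) ^ (a + a) = 1 := by rw [pow_add, e1]; ring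
  rw [e2, e3, e4, e1]
  ring

lemma theta_case1 {r : ℕ} {ks : Multiset ℕ} {a c m : ℕ}
    (h : ThId (X : ℤ[X]) m m r ks a a c) (hr : 1 ≤ r)
    (ha : 2 ≤ a) (hbc : a ≤ c) (hev : Even a) (hma : m = 2 * a)
    (hmk : ∀ k ∈ ks, m ≤ k) (hsum : a + a + c + ks.sum = m + m + r + 1)
    (k0 : ks.count m = 1) : False := by
  obtain ⟨ks', rfl⟩ := Multiset.exists_cons_of_mem (Multiset.count_pos.1 (show 0 < ks.count m by omega))
  rw [Multiset.count_cons, if_pos rfl] at k0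
  have hk' : ∀ k ∈ ks', m + 1 ≤ k := by
    intro k hk
    have a1 := hmk k (Multiset.mem_cons_of_mem hk)
    have a2 := Multiset.count_pos.2 hk
    by_contra hlt
    obtain rfl : k = m := by omega
    omega
  rw [Multiset.sum_cons] at hsum
  unfold ThId at h
  rw [Multiset.map_cons, Multiset.prod_cons, theta_case1_fTh _ hev] at h
  have e1 : (-1 : ℤ[X]) ^ m = 1 := by rw [hma]; simp
  have hU : fU (X : ℤ[X]) m = (1 + X ^ (2 * a)) * ((1 - X + 2 * X ^ 2) + (1 + X) * X ^ (2 * a)) := by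
    unfold fU; rw [e1, hma]; ring
  have hT : fT (X : ℤ[X]) m = (1 + X ^ (2 * a)) * (- X * (1 - X) + (2 + X + X ^ 2) * X ^ (2 * a)) := by
    unfold fT; rw [e1, hma]; ring
  have hC : fC (X : ℤ[X]) m = (1 + X ^ (2 * a)) ^ 2 := by
    unfold fC; rw [e1, hma]; ring
  have hne : ((1 + X ^ (2 * a)) ^ 2 : ℤ[X]) ≠ 0 := by
    apply pow_ne_zero
    intro h0
    have := congrArg (Polynomial.eval 1) h0
    simp at this
  have hid : ((1 - X + 2 * X ^ 2) + (1 + X) * X ^ (2 * a)) ^ 2 + (-1) ^ r * X ^ (2 * r + 2) * (- X * (1 - X) + (2 + X + X ^ 2) * X ^ (2 * a)) ^ 2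
     = (ks'.map (fC (X : ℤ[X]))).prod * (((1 - X + 2 * X ^ 2) + (1 + X) * X ^ (2 * a)) ^ 2
      - (-1) ^ c * X ^ (2 * c) * (- X * (1 - X) + (2 + X + X ^ 2) * X ^ (2 * a)) ^ 2
      + 4 * (1 + X ^ 2) ^ 2 * X ^ (a + c) * (1 - X ^ (2 * a))) := by
    apply mul_left_cancel₀ hne
    rw [hU, hT, hC] at h
    linear_combination h
  by_cases hks : ks' = 0
  · subst hks
    simp only [Multiset.sum_zero] at hsum
    obtain rfl : c = r + 1 := by omega
    rw [Multiset.map_zero, Multiset.prod_zero, one_mul] at hid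
    have h0 : (4 * (1 + X ^ 2) ^ 2 * X ^ (a + (r+1)) * (1 - X ^ (2 * a)) : ℤ[X]) = 0 := by
      linear_combination -hid
    have := congrArg (Polynomial.eval 2) h0
    simp at this
    have h1 : (1 : ℤ) < 2 ^ (2 * a) := one_lt_pow₀ (by norm_num) (by omega)
    omega
  · have hex : ∃ k, k ∈ ks' := Multiset.exists_mem_of_ne_zero hks
    obtain ⟨k, hk⟩ : ∃ k, k = Nat.find hex := ⟨_, rfl⟩
    have hkm : k ∈ ks' := by rw [hk]; exact Nat.find_spec hex
    have hkmin : ∀ x ∈ ks', k ≤ x := fun x hx => by rw [hk]; exact Nat.find_min' hex hx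
    clear hk
    have hk1 := hk' k hkm
    have hks := sum_ge_of_mem hkm
    have hpar : 2 * c + 2 = 2 * r + 4 ∨ (2 * k ≤ 2 * c + 2 ∧ 2 * k ≤ 2 * r + 4) := by
      have h := congrArg (toTR (ZMod 2) (2 * k)) hid
      have h2 := two_TR (2 * k)
      have hC := map_prod_f (toTR (ZMod 2) (2 * k)) _ _ (map_fC (toTR (ZMod 2) (2 * k)) X) ks'
      have m2 : toTR (ZMod 2) (2 * k) 2 = 2 := map_ofNat _ 2
      have m4 : toTR (ZMod 2) (2 * k) 4 = 4 := map_ofNat _ 4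
      simp only [map_add, map_mul, map_pow, map_neg, map_one, map_sub, hC, toTR_X, m2, m4] at h
      have hw : ∀ a, 2 * k ≤ a → tw (ZMod 2) (2 * k) ^ a = 0 := fun a ha => tw_pow _ _ ha
      rw [prod_fC_two h2 hw ks' hkmin, neg_one_pow_ch2 h2, neg_one_pow_ch2 h2] at h
      apply tw2_two
      have u2 : IsUnit (1 + tw (ZMod 2) (2 * k)) := by simpa using tw_unit (1 : TR (ZMod 2) (2 * k))
      have u : IsUnit (1 + tw (ZMod 2) (2 * k) ^ (2 * a)) := by
        have := tw_unit (k := ZMod 2) (N := 2 * k) (tw (ZMod 2) (2 * k) ^ (2 * a - 1))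
        rwa [← pow_succ', show 2 * a - 1 + 1 = 2 * a by omega] at this
      apply ((u2.pow 2).mul (u.pow 2)).mul_left_cancel
      generalize tw (ZMod 2) (2 * k) = w at *
      have hB : - w * (1 - w) + (2 + w + w ^ 2) * w ^ (2 * a) = w * (1 + w) * (1 + w ^ (2 * a)) := by
        linear_combination (- w + w ^ (2 * a)) * h2
      rw [hB] at h
      generalize w ^ (2 * a) = x at *
      have e4 : w ^ (2 * c + 2) = w ^ (2 * c) * w ^ 2 := by ring
      have e5 : w ^ (2 * r + 4) = w ^ (2 * r + 2) * w ^ 2 := by ring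
      rw [e4, e5]
      linear_combination -h + ((w ^ (2 * c) * w ^ 2) * (1 + w) ^ 2 * (1 + x) ^ 2 - 2 * (1 + w ^ 2) ^ 2 * w ^ (a + c) * (1 - x)) * h2
    rcases hpar with h1 | ⟨h1, h2⟩
    · omega
    · have h := congrArg (toTR ℤ (k + 1)) hid
      have hC := map_prod_f (toTR ℤ (k + 1)) _ _ (map_fC (toTR ℤ (k + 1)) X) ks'
      have m2 : toTR ℤ (k + 1) 2 = 2 := map_ofNat _ 2
      have m4 : toTR ℤ (k + 1) 4 = 4 := map_ofNat _ 4
      simp only [map_add, map_mul, map_pow, map_neg, map_one, map_sub, hC, toTR_X, m2, m4] at h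
      have hw : ∀ a, k + 1 ≤ a → tw ℤ (k + 1) ^ a = 0 := fun a ha => tw_pow _ _ ha
      have hP : ∀ L : Multiset ℕ, (∀ x ∈ L, k ≤ x) → (L.map (fC (tw ℤ (k+1)))).prod = 1 + 2 * tw ℤ (k+1) ^ k * (L.count k : ℤ) := by
        intro L
        induction L using Multiset.induction_on with
        | empty => intro _; simp
        | cons x L ih =>
          intro hL
          have hx := hL x (Multiset.mem_cons_self _ _)
          rw [Multiset.map_cons, Multiset.prod_cons, ih (fun b hb => hL b (Multiset.mem_cons_of_mem hb)), Multiset.count_cons]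
          unfold fC
          rw [hw (2 * x) (by omega)]
          have hkk : tw ℤ (k+1) ^ k * tw ℤ (k+1) ^ k = 0 := by rw [← pow_add]; exact hw _ (by omega)
          split_ifs with hkx
          · subst hkx
            push_cast
            linear_combination 4 * (L.count k : TR ℤ (k+1)) * hkk
          · rw [hw x (by omega)]; push_cast; ring
      rw [hP ks' hkmin] at h
      have hB : - tw ℤ (k+1) * (1 - tw ℤ (k+1)) + (2 + tw ℤ (k+1) + tw ℤ (k+1) ^ 2) * tw ℤ (k+1) ^ (2 * a)
        = tw ℤ (k+1) * (-(1 - tw ℤ (k+1)) + (2 + tw ℤ (k+1) + tw ℤ (k+1) ^ 2) * tw ℤ (k+1) ^ (2 * a - 1)) := by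
        obtain ⟨d, rfl⟩ := Nat.exists_eq_add_of_le ha
        rw [show 2 * (2 + d) - 1 = 2 * d + 3 by omega]
        ring
      rw [hB] at h
      have hA : (1 - tw ℤ (k+1) + 2 * tw ℤ (k+1) ^ 2) + (1 + tw ℤ (k+1)) * tw ℤ (k+1) ^ (2 * a)
        = 1 + tw ℤ (k+1) * ((- 1 + 2 * tw ℤ (k+1)) + (1 + tw ℤ (k+1)) * tw ℤ (k+1) ^ (2 * a - 1)) := by
        obtain ⟨d, rfl⟩ := Nat.exists_eq_add_of_le ha
        rw [show 2 * (2 + d) - 1 = 2 * d + 3 by omega]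
        ring
      have u := (tw_unit (k := ℤ) (N := k+1) ((- 1 + 2 * tw ℤ (k+1)) + (1 + tw ℤ (k+1)) * tw ℤ (k+1) ^ (2 * a - 1))).pow 2
      rw [← hA] at u
      have hz : tw ℤ (k+1) ^ k * ((2 * (ks'.count k : ℤ) : ℤ) : TR ℤ (k+1)) = 0 := by
        apply u.mul_left_cancel
        generalize hBB : (-(1 - tw ℤ (k+1)) + (2 + tw ℤ (k+1) + tw ℤ (k+1) ^ 2) * tw ℤ (k+1) ^ (2 * a - 1)) = BB at *
        have z1 : tw ℤ (k+1) ^ (2 * r + 2) * tw ℤ (k+1) ^ 2 = 0 := by rw [← pow_add]; exact hw _ (by omega)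
        have z2 : tw ℤ (k+1) ^ (2 * c) * tw ℤ (k+1) ^ 2 = 0 := by rw [← pow_add]; exact hw _ (by omega)
        have z3 : tw ℤ (k+1) ^ (a + c) = 0 := hw _ (by omega)
        rw [z3] at h
        generalize tw ℤ (k+1) ^ (2 * r + 2) = W1 at *
        generalize tw ℤ (k+1) ^ (2 * c) = W2 at *
        push_cast at h ⊢
        linear_combination -h + (-1) ^ r * BB ^ 2 * z1 + (1 + 2 * tw ℤ (k+1) ^ k * (ks'.count k : TR ℤ (k+1))) * (-1) ^ c * BB ^ 2 * z2
      have := tw_indep0 hz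
      have := Multiset.count_pos.2 hkm
      omega

lemma theta_arith {p q r : ℕ} {ks : Multiset ℕ} {a b c : ℕ}
    (h : ThId (X : ℤ[X]) p q r ks a b c) (hp : 3 ≤ p) (hq : 3 ≤ q) (hr : 1 ≤ r) (hk : ∀ k ∈ ks, 3 ≤ k)
    (ha : 1 ≤ a) (hb : 2 ≤ b) (hab : a ≤ b) (hbc : b ≤ c) (hsum : a + b + c + ks.sum = p + q + r + 1) : False := by
  wlog hpq : p ≤ q generalizing p q
  · refine this (p := q) (q := p) ?_ hq hp (by omega) (by omega)
    unfold ThId at *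
    linear_combination h
  have ha2 := theta_a h hp hq hr hk ha hb hab hbc
  obtain ⟨rfl, hev, hpa, hmk, hc⟩ := theta_main h hp hpq hr hk ha2 hab hbc
  rcases hc with ⟨rfl, hc⟩ | ⟨hq1, h0, h1, h2, h3⟩
  · exact theta_case1 h hr ha2 hbc hev hpa hmk hsum hc
  · exact theta_case2 h hr ha2 hbc hev hpa hmk hsum hq1 h0 h1 h2 h3

/-! ### Permanents -/
section Perm
variable {V : Type*} [Fintype V] {R : Type*} [CommRing R]
open Matrix

lemma per_conflict (M : Matrix V V R) {u x : V} (k : V) (hux : u ≠ x)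
    (hu : ∀ j, j ≠ k → M u j = 0) (hx : ∀ j, j ≠ k → M x j = 0) : M.permanent = 0 := by
  unfold Matrix.permanent
  refine Finset.sum_eq_zero fun σ _ => ?_
  by_cases h : σ.symm u = k
  · refine Finset.prod_eq_zero (Finset.mem_univ (σ.symm x)) ?_
    rw [σ.apply_symm_apply]
    apply hx
    rw [← h]
    intro h2
    exact hux (σ.symm.injective h2).symm
  · refine Finset.prod_eq_zero (Finset.mem_univ (σ.symm u)) ?_
    rw [σ.apply_symm_apply]
    exact hu _ h

lemma per_zero_col (M : Matrix V V R) (x : V) (h : ∀ i, M i x = 0) : M.permanent = 0 := by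
  unfold Matrix.permanent
  refine Finset.sum_eq_zero fun σ _ => ?_
  exact Finset.prod_eq_zero (Finset.mem_univ x) (h _)

lemma per_updateRow_add (M : Matrix V V R) (u : V) (a b : V → R) :
    (M.updateRow u (a + b)).permanent
      = (M.updateRow u a).permanent + (M.updateRow u b).permanent := by
  unfold Matrix.permanent
  rw [← Finset.sum_add_distrib]
  refine Finset.sum_congr rfl fun σ _ => ?_
  have key : ∀ c : V → R, ∏ i, (M.updateRow u c) (σ i) i
      = c (σ.symm u) * ∏ i ∈ Finset.univ.erase (σ.symm u), M (σ i) i := by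
    intro c
    rw [← Finset.mul_prod_erase _ _ (Finset.mem_univ (σ.symm u))]
    congr 1
    · simp
    · refine Finset.prod_congr rfl fun i hi => ?_
      rw [Matrix.updateRow_ne]
      intro h
      apply (Finset.mem_erase.1 hi).1
      rw [← h]; simp
  rw [key, key, key, Pi.add_apply, add_mul]

lemma per_swap_rows (M : Matrix V V R) {u x : V} (hux : u ≠ x) (a b : V → R) :
    ((M.updateRow u a).updateRow x b).permanent = ((M.updateRow u b).updateRow x a).permanent := by
  rw [← Matrix.permanent_permute_cols (Equiv.swap u x)]
  congr 1
  ext i j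
  simp only [Matrix.submatrix_apply, id]
  by_cases h1 : i = u
  · subst h1; simp [Matrix.updateRow_apply, hux]
  · by_cases h2 : i = x
    · subst h2; simp [Matrix.updateRow_apply, hux]
    · rw [Equiv.swap_apply_of_ne_of_ne h1 h2]; simp [Matrix.updateRow_apply, h1, h2]

/-- unit row -/
abbrev ev (x : V) : V → R := Pi.single x 1

lemma updateRow_self' (M : Matrix V V R) (u : V) (a : V → R) (h : M u = a) : M.updateRow u a = M := by
  subst h; exact Matrix.updateRow_eq_self M u

lemma per_add_single (N : Matrix V V R) (u w : V) (c : R) :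
    (N + Matrix.single u w c).permanent = N.permanent + c * (N.updateRow u (ev w)).permanent := by
  have : N + Matrix.single u w c = N.updateRow u (N u + c • ev w) := by
    ext i j
    by_cases h : i = u
    · subst h
      by_cases hj : j = w
      · subst hj; simp
      · simp [Matrix.single, Ne.symm hj, hj]
    · simp [Matrix.updateRow_apply, h, Matrix.single, Ne.symm h]
  rw [this, per_updateRow_add, Matrix.updateRow_eq_self, Matrix.permanent_updateRow_smul]

lemma updateRow_add_single_self (N : Matrix V V R) (u w : V) (c : R) (a : V → R) :
    (N + Matrix.single u w c).updateRow u a = N.updateRow u a := by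
  ext i j
  by_cases h : i = u
  · subst h; simp
  · simp [Matrix.updateRow_apply, h, Matrix.single, Ne.symm h]

lemma updateRow_add_single_ne (N : Matrix V V R) {u v : V} (h : v ≠ u) (w : V) (c : R) (a : V → R) :
    (N + Matrix.single u w c).updateRow v a = N.updateRow v a + Matrix.single u w c := by
  ext i j
  by_cases h1 : i = v
  · subst h1; simp [Matrix.single, Ne.symm h]
  · simp [Matrix.updateRow_apply, h1]

/-- `x` is isolated with unit diagonal. -/
def UnitAt (N : Matrix V V R) (x : V) : Prop :=
  ∀ j, N x j = (1 : Matrix V V R) x j ∧ N j x = (1 : Matrix V V R) j x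

lemma UnitAt.row {N : Matrix V V R} {x : V} (h : UnitAt N x) : N x = ev x := by
  ext j; rw [(h j).1, Matrix.one_apply, ev, Pi.single_apply]; simp [eq_comm]

lemma UnitAt.col {N : Matrix V V R} {x : V} (h : UnitAt N x) {j : V} (hj : j ≠ x) : N j x = 0 := by
  rw [(h j).2, Matrix.one_apply_ne hj]

/-- replacing the unit row `x` by `ev w` kills the permanent -/
lemma per_upd_unit {N : Matrix V V R} {x : V} (h : UnitAt N x) {w : V} (hw : w ≠ x) :
    (N.updateRow x (ev w)).permanent = 0 := by
  refine per_zero_col _ x fun i => ?_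
  by_cases hi : i = x
  · subst hi; simp [ev, Pi.single_apply, Ne.symm hw]
  · rw [Matrix.updateRow_ne hi]; exact h.col hi

lemma per_upd_unit' {N : Matrix V V R} {x : V} (h : UnitAt N x) {u : V} (hu : u ≠ x) :
    (N.updateRow u (ev x)).permanent = 0 := by
  refine per_conflict _ (u := u) (x := x) x hu ?_ ?_
  · intro j hj; simp [ev, Pi.single_apply, hj]
  · intro j hj; rw [Matrix.updateRow_ne hu.symm, h.row]; simp [ev, Pi.single_apply, hj]

lemma UnitAt.updateRow {N : Matrix V V R} {x : V} (h : UnitAt N x) {u w : V} (hu : u ≠ x) (hw : w ≠ x) :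
    UnitAt (N.updateRow u (ev w)) x := by
  intro j
  refine ⟨by rw [Matrix.updateRow_ne hu.symm]; exact (h j).1, ?_⟩
  by_cases hj : j = u
  · subst hj; simp [ev, Pi.single_apply, Ne.symm hw, Matrix.one_apply, hu]
  · rw [Matrix.updateRow_ne hj]; exact (h j).2

lemma UnitAt.add_single {N : Matrix V V R} {x : V} (h : UnitAt N x) {u w : V} (hu : u ≠ x) (hw : w ≠ x)
    (c : R) : UnitAt (N + Matrix.single u w c) x := by
  intro j
  simp only [Matrix.add_apply, Matrix.single_apply]
  rw [if_neg (by tauto), if_neg (by tauto), add_zero, add_zero]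
  exact h j

/-- swap rule -/
lemma per_upd_swap {N : Matrix V V R} {x : V} (h : UnitAt N x) {u w : V} (hu : u ≠ x) :
    ((N.updateRow u (ev x)).updateRow x (ev w)).permanent = (N.updateRow u (ev w)).permanent := by
  rw [per_swap_rows _ hu]
  rw [updateRow_self' (N.updateRow u (ev w)) x (ev x)]
  rw [Matrix.updateRow_ne hu.symm]; exact h.row

lemma per_upd_swap' {N : Matrix V V R} {x : V} (h : UnitAt N x) {u w : V} (hu : u ≠ x) :
    ((N.updateRow x (ev w)).updateRow u (ev x)).permanent = (N.updateRow u (ev w)).permanent := by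
  rw [Matrix.updateRow_comm _ hu.symm, per_upd_swap h hu]

/-- attaching a pendant vertex -/
def pend (N : Matrix V V R) (y : R) (u x : V) : Matrix V V R :=
  N + Matrix.single x x (y - 1) + Matrix.single u x 1 + Matrix.single x u 1

variable {N : Matrix V V R} {x : V} {y : R}

lemma per_pend (h : UnitAt N x) {u : V} (hu : u ≠ x) :
    (pend N y u x).permanent = y * N.permanent + (N.updateRow u (ev u)).permanent := by
  unfold pend
  rw [per_add_single, per_add_single, updateRow_add_single_ne _ hu.symm, per_add_single,
    updateRow_add_single_self, per_add_single, updateRow_add_single_ne _ hu, per_add_single]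
  rw [updateRow_self' N x _ h.row, per_upd_unit' h hu, per_upd_unit h hu, per_upd_swap' h hu]
  rw [per_conflict ((N.updateRow u (ev x)).updateRow x (ev x)) (u := u) (x := x) x hu]
  · ring
  · intro j hj; rw [Matrix.updateRow_ne hu]; simp [ev, Pi.single_apply, hj]
  · intro j hj; simp [ev, Pi.single_apply, hj]

lemma pend_upd_x (N : Matrix V V R) (y : R) {u : V} (hu : u ≠ x) (a : V → R) :
    (pend N y u x).updateRow x a = N.updateRow x a + Matrix.single u x 1 := by
  unfold pend
  rw [updateRow_add_single_self, updateRow_add_single_ne _ hu.symm, updateRow_add_single_self]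

lemma per_pend_xx (h : UnitAt N x) {u : V} (hu : u ≠ x) :
    ((pend N y u x).updateRow x (ev x)).permanent = N.permanent := by
  rw [pend_upd_x _ _ hu, updateRow_self' N x _ h.row, per_add_single, per_upd_unit' h hu]; ring

lemma per_pend_xw (h : UnitAt N x) {u w : V} (hu : u ≠ x) (hw : w ≠ x) :
    ((pend N y u x).updateRow x (ev w)).permanent = (N.updateRow u (ev w)).permanent := by
  rw [pend_upd_x _ _ hu, per_add_single, per_upd_unit h hw, per_upd_swap' h hu]; ring

lemma pend_upd_w (N : Matrix V V R) (y : R) {u w : V} (hw : w ≠ x) (hwu : w ≠ u) (a : V → R) :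
    (pend N y u x).updateRow w a = pend (N.updateRow w a) y u x := by
  unfold pend
  rw [updateRow_add_single_ne _ hw, updateRow_add_single_ne _ hwu, updateRow_add_single_ne _ hw]

lemma per_pend_ux (h : UnitAt N x) {u : V} (hu : u ≠ x) :
    ((pend N y u x).updateRow u (ev x)).permanent = (N.updateRow u (ev u)).permanent := by
  unfold pend
  rw [updateRow_add_single_ne _ hu, updateRow_add_single_self, updateRow_add_single_ne _ hu,
    per_add_single, updateRow_add_single_self, per_upd_swap h hu, per_add_single, per_upd_unit' h hu,
    per_conflict ((N.updateRow u (ev x)).updateRow x (ev x)) (u := u) (x := x) x hu]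
  · ring
  · intro j hj; rw [Matrix.updateRow_ne hu]; simp [ev, Pi.single_apply, hj]
  · intro j hj; simp [ev, Pi.single_apply, hj]

lemma per_pend_uu (h : UnitAt N x) {u : V} (hu : u ≠ x) :
    ((pend N y u x).updateRow u (ev u)).permanent = y * (N.updateRow u (ev u)).permanent := by
  have h' := h.updateRow (w := u) hu hu
  unfold pend
  rw [updateRow_add_single_ne _ hu, updateRow_add_single_self, updateRow_add_single_ne _ hu,
    per_add_single, updateRow_add_single_self, per_upd_unit h' hu, per_add_single,
    updateRow_self' _ x _ h'.row]
  ring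

lemma per_pend_wx (h : UnitAt N x) {u w : V} (hu : u ≠ x) (hw : w ≠ x) (hwu : w ≠ u) :
    ((pend N y u x).updateRow w (ev x)).permanent = (N.updateRow w (ev u)).permanent := by
  rw [pend_upd_w _ _ hw hwu]
  unfold pend
  have c1 : ∀ (M : Matrix V V R), ((M.updateRow w (ev x)).updateRow x (ev x)).permanent = 0 := by
    intro M
    refine per_conflict _ (u := w) (x := x) x hw ?_ ?_
    · intro j hj; rw [Matrix.updateRow_ne hw]; simp [ev, Pi.single_apply, hj]
    · intro j hj; simp [ev, Pi.single_apply, hj]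
  have c2 : ∀ (M : Matrix V V R), ((M.updateRow w (ev x)).updateRow u (ev x)).permanent = 0 := by
    intro M
    refine per_conflict _ (u := w) (x := u) x hwu ?_ ?_
    · intro j hj; rw [Matrix.updateRow_ne hwu]; simp [ev, Pi.single_apply, hj]
    · intro j hj; simp [ev, Pi.single_apply, hj]
  have c3 : (((N.updateRow w (ev x)).updateRow x (ev u)).updateRow u (ev x)).permanent = 0 := by
    refine per_conflict _ (u := w) (x := u) x hwu ?_ ?_
    · intro j hj; rw [Matrix.updateRow_ne hwu, Matrix.updateRow_ne hw]; simp [ev, Pi.single_apply, hj]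
    · intro j hj; simp [ev, Pi.single_apply, hj]
  have c4 : (((N.updateRow w (ev x)).updateRow u (ev x)).updateRow x (ev x)).permanent = 0 := by
    rw [Matrix.updateRow_comm _ hwu]
    refine per_conflict _ (u := w) (x := x) x hw ?_ ?_
    · intro j hj; rw [Matrix.updateRow_ne hw]; simp [ev, Pi.single_apply, hj]
    · intro j hj; simp [ev, Pi.single_apply, hj]
  rw [per_add_single, per_add_single, updateRow_add_single_ne _ hu.symm, per_add_single,
    updateRow_add_single_self, per_add_single, updateRow_add_single_ne _ hu, per_add_single]
  rw [c1, c2, c3, c4, per_upd_unit' h hw, per_upd_swap h hw]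
  ring

end Perm

section Chain
variable {V : Type*} [Fintype V] {R : Type*} [CommRing R]
open Matrix

def chainM {V : Type*} (R : Type*) [Semiring R] (u : V) : List V → V → Matrix V V R
  | [], v => Matrix.single u v 1 + Matrix.single v u 1
  | x :: l, v => Matrix.single u x 1 + Matrix.single x u 1 + chainM R x l v

def dgl {V : Type*} {R : Type*} [CommRing R] (y : R) (l : List V) : Matrix V V R :=
  (l.map fun x => Matrix.single x x (y - 1)).sum

def FF {R : Type*} [CommRing R] (y : R) : ℕ → R
  | 0 => 1
  | 1 => 0
  | k + 2 => y * FF y (k + 1) + FF y k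

lemma UnitAt.pend {N : Matrix V V R} {z : V} (h : UnitAt N z) {u x : V} (hu : u ≠ z) (hx : x ≠ z) (y : R) :
    UnitAt (pend N y u x) z := by
  unfold _root_.pend
  exact ((h.add_single hx hx _).add_single hu hx _).add_single hx hu _

lemma chain_per (y : R) (w : V) : ∀ (l : List V) (u : V) (N : Matrix V V R), l.Nodup → u ∉ l → w ∉ l →
    u ≠ w → (∀ x ∈ l, UnitAt N x) →
    (N + dgl y l + chainM R u l w).permanent
      = FF y (l.length + 2) * N.permanent
        + FF y (l.length + 1) * ((N.updateRow u (ev u)).permanent + (N.updateRow w (ev w)).permanent)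
        + FF y l.length * ((N.updateRow u (ev u)).updateRow w (ev w)).permanent
        + (N.updateRow u (ev w)).permanent + (N.updateRow w (ev u)).permanent := by
  intro l
  induction l with
  | nil =>
    intro u N _ _ _ huw _
    simp only [dgl, chainM, List.map_nil, List.sum_nil, add_zero, List.length_nil, FF]
    rw [← add_assoc, per_add_single, per_add_single, updateRow_add_single_ne _ huw.symm, per_add_single]
    rw [per_swap_rows _ huw.symm, Matrix.updateRow_comm N huw]
    ring
  | cons x l ih =>
    intro u N hnd hu hw huw hN
    rw [List.nodup_cons] at hnd
    simp only [List.mem_cons, not_or] at hu hw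
    have e : N + dgl y (x :: l) + chainM R u (x :: l) w = pend N y u x + dgl y l + chainM R x l w := by
      simp only [dgl, chainM, List.map_cons, List.sum_cons, pend]
      abel
    have hx := hN x (by simp)
    rw [e, ih x _ hnd.2 hnd.1 hw.2 (Ne.symm hw.1) ?_]
    · rw [per_pend hx hu.1, per_pend_xx hx hu.1, per_pend_xw hx hu.1 hw.1, per_pend_wx hx hu.1 hw.1 huw.symm]
      have hx' := hx.updateRow (u := w) (w := w) hw.1 hw.1
      rw [Matrix.updateRow_comm _ (Ne.symm hw.1), pend_upd_w _ _ hw.1 huw.symm, per_pend hx' hu.1,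
        per_pend_xx hx' hu.1, Matrix.updateRow_comm N huw]
      simp only [List.length_cons, FF]
      ring
    · intro z hz
      refine (hN z (List.mem_cons_of_mem _ hz)).pend ?_ ?_ y
      · rintro rfl; exact hu.2 hz
      · rintro rfl; exact hnd.1 hz

lemma loop_per (y : R) (l : List V) (u : V) (N : Matrix V V R) (hl : l ≠ []) (hnd : l.Nodup) (hu : u ∉ l)
    (hN : ∀ x ∈ l, UnitAt N x) :
    (N + dgl y l + chainM R u l u).permanent
      = FF y (l.length + 2) * N.permanent
        + (2 * FF y (l.length + 1) + 2) * (N.updateRow u (ev u)).permanent := by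
  obtain ⟨x, l, rfl⟩ := List.exists_cons_of_ne_nil hl
  rw [List.nodup_cons] at hnd
  simp only [List.mem_cons, not_or] at hu
  have e : N + dgl y (x :: l) + chainM R u (x :: l) u = pend N y u x + dgl y l + chainM R x l u := by
    simp only [dgl, chainM, List.map_cons, List.sum_cons, pend]
    abel
  have hx := hN x (by simp)
  rw [e, chain_per y u l x _ hnd.2 hnd.1 hu.2 (Ne.symm hu.1)]
  · rw [per_pend hx hu.1, per_pend_xx hx hu.1, per_pend_xw hx hu.1 hu.1, per_pend_ux hx hu.1, per_pend_uu hx hu.1]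
    have : (((pend N y u x).updateRow x (ev x)).updateRow u (ev u)).permanent = (N.updateRow u (ev u)).permanent := by
      rw [pend_upd_x _ _ hu.1, updateRow_self' N x _ hx.row, updateRow_add_single_self]
    rw [this]
    simp only [List.length_cons, FF]
    ring
  · intro z hz
    refine (hN z (List.mem_cons_of_mem _ hz)).pend ?_ ?_ y
    · rintro rfl; exact hu.2 hz
    · rintro rfl; exact hnd.1 hz

def fcy (y : R) (k : ℕ) : R := FF y (k + 2) + FF y k + 2

lemma cycle_per (y : R) (l : List V) (u : V) (N : Matrix V V R) (hl : l ≠ []) (hnd : l.Nodup) (hu : u ∉ l)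
    (hN : ∀ x ∈ u :: l, UnitAt N x) :
    (N + dgl y (u :: l) + chainM R u l u).permanent = fcy y (l.length + 1) * N.permanent := by
  have e : N + dgl y (u :: l) + chainM R u l u = (N + Matrix.single u u (y - 1)) + dgl y l + chainM R u l u := by
    simp only [dgl, List.map_cons, List.sum_cons]
    abel
  rw [e, loop_per y l u _ hl hnd hu, updateRow_add_single_self, per_add_single,
    updateRow_self' N u _ (hN u (by simp)).row]
  · simp only [FF, fcy]; ring
  · intro z hz
    have : u ≠ z := by rintro rfl; exact hu hz
    exact (hN z (List.mem_cons_of_mem _ hz)).add_single this this _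

end Chain

section Core
variable {V : Type*} [Fintype V] {R : Type*} [CommRing R]
open Matrix

def cycA {V : Type*} (R : Type*) [Semiring R] (cs : List (V × List V)) : Matrix V V R :=
  (cs.map fun c => chainM R c.1 c.2 c.1).sum

def cycV {V : Type*} (cs : List (V × List V)) : List V := cs.flatMap fun c => c.1 :: c.2

def ZeroAt {V : Type*} {R : Type*} [Semiring R] (S : Matrix V V R) (x : V) : Prop := ∀ j, S x j = 0 ∧ S j x = 0

lemma ZeroAt.add {V : Type*} {R : Type*} [Semiring R] {S T : Matrix V V R} {x : V} (h : ZeroAt S x) (h' : ZeroAt T x) : ZeroAt (S + T) x := by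
  intro j; simp [(h j).1, (h j).2, (h' j).1, (h' j).2]

lemma ZeroAt.zero {V : Type*} {R : Type*} [Semiring R] (x : V) : ZeroAt (0 : Matrix V V R) x := fun _ => ⟨rfl, rfl⟩

lemma ZeroAt.single {V : Type*} {R : Type*} [Semiring R] {u v x : V} (hu : u ≠ x) (hv : v ≠ x) (c : R) :
    ZeroAt (Matrix.single u v c) x := by
  intro j; simp [Matrix.single_apply, hu, hv]

lemma ZeroAt.chainM {V : Type*} {R : Type*} [Semiring R] {v x : V} (hv : v ≠ x) : ∀ (l : List V) (u : V), u ≠ x → x ∉ l →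
    ZeroAt (chainM R u l v) x := by
  intro l
  induction l with
  | nil => intro u hu _; exact (ZeroAt.single hu hv _).add (ZeroAt.single hv hu _)
  | cons z l ih =>
    intro u hu hx
    simp only [List.mem_cons, not_or] at hx
    exact ((ZeroAt.single hu (Ne.symm hx.1) _).add (ZeroAt.single (Ne.symm hx.1) hu _)).add
      (ih z (Ne.symm hx.1) hx.2)

lemma ZeroAt.dgl {x : V} (y : R) (l : List V) (hx : x ∉ l) : ZeroAt (dgl y l) x := by
  induction l with
  | nil => exact ZeroAt.zero x
  | cons z l ih =>
    simp only [List.mem_cons, not_or] at hx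
    exact (ZeroAt.single (Ne.symm hx.1) (Ne.symm hx.1) _).add (ih hx.2)

lemma UnitAt.add {N S : Matrix V V R} {x : V} (h : UnitAt N x) (h' : ZeroAt S x) : UnitAt (N + S) x := by
  intro j; simp [(h j).1, (h j).2, (h' j).1, (h' j).2]

lemma unitAt_one (x : V) : UnitAt (1 : Matrix V V R) x := fun _ => ⟨rfl, rfl⟩

lemma dgl_append (y : R) (l l' : List V) : dgl y (l ++ l') = dgl y l + dgl y l' := by
  simp [dgl]

lemma cycles_per (y : R) : ∀ (cs : List (V × List V)) (N : Matrix V V R), (cycV cs).Nodup →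
    (∀ c ∈ cs, c.2 ≠ []) → (∀ x ∈ cycV cs, UnitAt N x) →
    (N + dgl y (cycV cs) + cycA R cs).permanent
      = (cs.map fun c => fcy y (c.2.length + 1)).prod * N.permanent := by
  intro cs
  induction cs with
  | nil => intro N _ _ _; simp [cycV, cycA, dgl]
  | cons c cs ih =>
    intro N hnd hne hN
    have e0 : cycV (c :: cs) = (c.1 :: c.2) ++ cycV cs := by simp [cycV]
    rw [e0] at hnd hN
    have hd := List.nodup_append.1 hnd
    have e : N + dgl y (cycV (c :: cs)) + cycA R (c :: cs)
        = (N + dgl y (c.1 :: c.2) + chainM R c.1 c.2 c.1) + dgl y (cycV cs) + cycA R cs := by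
      rw [e0, dgl_append]
      simp only [cycA, List.map_cons, List.sum_cons]
      abel
    have hc1 := List.nodup_cons.1 hd.1
    rw [e, ih _ hd.2.1 (fun c' h => hne c' (List.mem_cons_of_mem _ h)),
      cycle_per y c.2 c.1 N (hne c (by simp)) hc1.2 hc1.1]
    · simp only [List.map_cons, List.prod_cons]; ring
    · intro x hx; exact hN x (List.mem_append_left _ hx)
    · intro x hx
      have h1 : x ∉ c.1 :: c.2 := fun h => hd.2.2 x h x hx rfl
      have h2 := h1
      simp only [List.mem_cons, not_or] at h2
      exact ((hN x (List.mem_append_right _ hx)).add (ZeroAt.dgl y _ h1)).add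
        (ZeroAt.chainM (Ne.symm h2.1) _ _ (Ne.symm h2.1) h2.2)

def core (u v : V) (a b c d : R) : Matrix V V R :=
  1 + Matrix.single u u (a - 1) + Matrix.single v v (b - 1) + Matrix.single u v c + Matrix.single v u d

def PP (u v : V) (S : Matrix V V R) (a b c d : R) : R := (core u v a b c d + S).permanent

lemma unitAt_core {u v x : V} (hu : u ≠ x) (hv : v ≠ x) (a b c d : R) : UnitAt (core u v a b c d) x :=
  ((((unitAt_one x).add_single hu hu _).add_single hv hv _).add_single hu hv _).add_single hv hu _

variable {u v : V}

lemma core_aa (a b c d : R) (S : Matrix V V R) :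
    core u v (a + 1) b c d + S = core u v a b c d + S + Matrix.single u u 1 := by
  have : a + 1 - 1 = (a - 1) + 1 := by ring
  unfold core; rw [this, Matrix.single_add]; abel
lemma core_bb (a b c d : R) (S : Matrix V V R) :
    core u v a (b + 1) c d + S = core u v a b c d + S + Matrix.single v v 1 := by
  have : b + 1 - 1 = (b - 1) + 1 := by ring
  unfold core; rw [this, Matrix.single_add]; abel
lemma core_cc (a b c d : R) (S : Matrix V V R) :
    core u v a b (c + 1) d + S = core u v a b c d + S + Matrix.single u v 1 := by
  unfold core; rw [Matrix.single_add]; abel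
lemma core_dd (a b c d : R) (S : Matrix V V R) :
    core u v a b c (d + 1) + S = core u v a b c d + S + Matrix.single v u 1 := by
  unfold core; rw [Matrix.single_add]; abel

lemma PP_a (S : Matrix V V R) (a b c d : R) :
    ((core u v a b c d + S).updateRow u (ev u)).permanent = PP u v S (a + 1) b c d - PP u v S a b c d := by
  unfold PP; rw [core_aa, per_add_single]; ring
lemma PP_b (S : Matrix V V R) (a b c d : R) :
    ((core u v a b c d + S).updateRow v (ev v)).permanent = PP u v S a (b + 1) c d - PP u v S a b c d := by
  unfold PP; rw [core_bb, per_add_single]; ring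
lemma PP_c (S : Matrix V V R) (a b c d : R) :
    ((core u v a b c d + S).updateRow u (ev v)).permanent = PP u v S a b (c + 1) d - PP u v S a b c d := by
  unfold PP; rw [core_cc, per_add_single]; ring
lemma PP_d (S : Matrix V V R) (a b c d : R) :
    ((core u v a b c d + S).updateRow v (ev u)).permanent = PP u v S a b c (d + 1) - PP u v S a b c d := by
  unfold PP; rw [core_dd, per_add_single]; ring
lemma PP_ab (huv : u ≠ v) (S : Matrix V V R) (a b c d : R) :
    (((core u v a b c d + S).updateRow u (ev u)).updateRow v (ev v)).permanent
      = PP u v S (a + 1) (b + 1) c d - PP u v S a (b + 1) c d - (PP u v S (a + 1) b c d - PP u v S a b c d) := by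
  rw [← PP_a, ← PP_a, core_bb, updateRow_add_single_ne _ huv, per_add_single]; ring

lemma PP_chain (huv : u ≠ v) (y : R) {S : Matrix V V R} {l : List V} (hnd : l.Nodup) (hu : u ∉ l) (hv : v ∉ l)
    (hS : ∀ x ∈ l, ZeroAt S x) (a b c d : R) :
    PP u v (S + dgl y l + chainM R u l v) a b c d = FF y (l.length + 2) * PP u v S a b c d
      + FF y (l.length + 1) * (PP u v S (a + 1) b c d + PP u v S a (b + 1) c d - 2 * PP u v S a b c d)
      + FF y l.length * (PP u v S (a + 1) (b + 1) c d - PP u v S a (b + 1) c d - (PP u v S (a + 1) b c d - PP u v S a b c d))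
      + (PP u v S a b (c + 1) d - PP u v S a b c d) + (PP u v S a b c (d + 1) - PP u v S a b c d) := by
  have := chain_per y v l u (core u v a b c d + S) hnd hu hv huv ?_
  · rw [PP_a, PP_b, PP_c, PP_d, PP_ab huv] at this
    have e : core u v a b c d + (S + dgl y l + chainM R u l v) = core u v a b c d + S + dgl y l + chainM R u l v := by
      abel
    unfold PP at *
    rw [e, this]; ring
  · intro x hx
    exact (unitAt_core (by rintro rfl; exact hu hx) (by rintro rfl; exact hv hx) _ _ _ _).add (hS x hx)

lemma PP_loopu (y : R) {S : Matrix V V R} {l : List V} (hl : l ≠ []) (hnd : l.Nodup) (hu : u ∉ l) (hv : v ∉ l)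
    (hS : ∀ x ∈ l, ZeroAt S x) (a b c d : R) :
    PP u v (S + dgl y l + chainM R u l u) a b c d = FF y (l.length + 2) * PP u v S a b c d
      + (2 * FF y (l.length + 1) + 2) * (PP u v S (a + 1) b c d - PP u v S a b c d) := by
  have := loop_per y l u (core u v a b c d + S) hl hnd hu ?_
  · rw [PP_a] at this
    have e : core u v a b c d + (S + dgl y l + chainM R u l u) = core u v a b c d + S + dgl y l + chainM R u l u := by
      abel
    unfold PP at *
    rw [e, this]
  · intro x hx
    exact (unitAt_core (by rintro rfl; exact hu hx) (by rintro rfl; exact hv hx) _ _ _ _).add (hS x hx)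

lemma PP_loopv (y : R) {S : Matrix V V R} {l : List V} (hl : l ≠ []) (hnd : l.Nodup) (hu : u ∉ l) (hv : v ∉ l)
    (hS : ∀ x ∈ l, ZeroAt S x) (a b c d : R) :
    PP u v (S + dgl y l + chainM R v l v) a b c d = FF y (l.length + 2) * PP u v S a b c d
      + (2 * FF y (l.length + 1) + 2) * (PP u v S a (b + 1) c d - PP u v S a b c d) := by
  have := loop_per y l v (core u v a b c d + S) hl hnd hv ?_
  · rw [PP_b] at this
    have e : core u v a b c d + (S + dgl y l + chainM R v l v) = core u v a b c d + S + dgl y l + chainM R v l v := by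
      abel
    unfold PP at *
    rw [e, this]
  · intro x hx
    exact (unitAt_core (by rintro rfl; exact hu hx) (by rintro rfl; exact hv hx) _ _ _ _).add (hS x hx)

lemma PP_zero (huv : u ≠ v) (a b c d : R) : PP u v 0 a b c d = a * b + c * d := by
  unfold PP core
  rw [add_zero, per_add_single, per_add_single]
  have hone : ∀ x : V, (1 : Matrix V V R).updateRow x (ev x) = 1 := fun x => updateRow_self' _ _ _ (unitAt_one x).row
  have p1 : (1 + Matrix.single u u (a - 1) + Matrix.single v v (b - 1) : Matrix V V R).permanent = a * b := by
    rw [per_add_single, per_add_single, updateRow_add_single_ne _ huv.symm, per_add_single]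
    simp only [hone, Matrix.permanent_one]; ring
  have p2 : ((1 + Matrix.single u u (a - 1) + Matrix.single v v (b - 1) : Matrix V V R).updateRow u (ev v)).permanent = 0 := by
    rw [updateRow_add_single_ne _ huv, updateRow_add_single_self, per_add_single,
      per_upd_unit (unitAt_one u) huv.symm]
    rw [per_conflict (((1 : Matrix V V R).updateRow u (ev v)).updateRow v (ev v)) (u := u) (x := v) v huv]
    · ring
    · intro j hj; rw [Matrix.updateRow_ne huv]; simp [ev, Pi.single_apply, hj]
    · intro j hj; simp [ev, Pi.single_apply, hj]
  have p3 : ((1 + Matrix.single u u (a - 1) + Matrix.single v v (b - 1) + Matrix.single u v c : Matrix V V R).updateRow v (ev u)).permanent = c := by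
    rw [updateRow_add_single_ne _ huv.symm, updateRow_add_single_self, updateRow_add_single_ne _ huv.symm, 
      per_add_single, per_add_single, per_upd_unit (unitAt_one v) huv, updateRow_add_single_self]
    rw [per_conflict (((1 : Matrix V V R).updateRow v (ev u)).updateRow u (ev u)) (u := u) (x := v) u huv]
    · rw [per_upd_swap' (unitAt_one v) huv, hone, Matrix.permanent_one]; ring
    · intro j hj; simp [ev, Pi.single_apply, hj]
    · intro j hj; rw [Matrix.updateRow_ne huv.symm]; simp [ev, Pi.single_apply, hj]
  rw [p1, p2, p3]; ring

/-- diagonal of the target matrix -/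
def dgv (y : R) (u v : V) : Matrix V V R := Matrix.diagonal fun i => if i = u ∨ i = v then y - 1 else y

lemma dgl_apply (y : R) (l : List V) (hnd : l.Nodup) (i j : V) :
    dgl y l i j = if i = j ∧ i ∈ l then y - 1 else 0 := by
  induction l with
  | nil => simp [dgl]
  | cons x l ih =>
    rw [List.nodup_cons] at hnd
    have : dgl y (x :: l) = Matrix.single x x (y - 1) + dgl y l := by simp [dgl]
    rw [this, Matrix.add_apply, ih hnd.2, Matrix.single_apply]
    by_cases h : x = i
    · subst h; by_cases h2 : x = j <;> simp [h2, hnd.1]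
      subst h2; simp [hnd.1]
    · simp [h, Ne.symm h]

lemma dgv_eq (y : R) (huv : u ≠ v) {l : List V} (hnd : l.Nodup) (hu : u ∉ l) (hv : v ∉ l)
    (hall : ∀ x, x = u ∨ x = v ∨ x ∈ l) : dgv y u v = core u v (y - 1) (y - 1) 0 0 + dgl y l := by
  ext i j
  rw [Matrix.add_apply, dgl_apply y l hnd, dgv, core, Matrix.diagonal_apply]
  simp only [Matrix.add_apply, Matrix.single_zero, Matrix.zero_apply, Matrix.one_apply, Matrix.single_apply, add_zero]
  by_cases hij : i = j
  · subst hij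
    simp only [and_self, true_and, if_true]
    rcases hall i with rfl | rfl | h
    · simp [hu, huv.symm]
    · simp [hv, huv]
    · have h1 : i ≠ u := by rintro rfl; exact hu h
      have h2 : i ≠ v := by rintro rfl; exact hv h
      simp [h, h1, h2, h1.symm, h2.symm]
  · simp only [hij, false_and, if_false]
    rw [if_neg, if_neg] <;> simp
    · rintro rfl; exact hij
    · rintro rfl; exact hij

def WD (y : R) (i j k : ℕ) : R :=
  let f := FF y (i + 2); let g := FF y (j + 2)
  let α := f * (y - 1) + (2 * FF y (i + 1) + 2)
  let β := g * (y - 1) + (2 * FF y (j + 1) + 2)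
  FF y (k + 2) * (α * β) + FF y (k + 1) * (f * β + α * g) + FF y k * (f * g)

def WT (y : R) (i j k : ℕ) : R :=
  (y - 1) ^ 2 * (FF y (i+2) * FF y (j+2) * FF y (k+2))
  + 2 * (y - 1) * (FF y (i+1) * FF y (j+2) * FF y (k+2) + FF y (i+2) * FF y (j+1) * FF y (k+2) + FF y (i+2) * FF y (j+2) * FF y (k+1))
  + (FF y i * FF y (j+2) * FF y (k+2) + FF y (i+2) * FF y j * FF y (k+2) + FF y (i+2) * FF y (j+2) * FF y k)
  + 2 * (FF y (i+1) * FF y (j+1) * FF y (k+2) + FF y (i+1) * FF y (j+2) * FF y (k+1) + FF y (i+2) * FF y (j+1) * FF y (k+1))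
  + 2 * (FF y (i+2) + FF y (j+2) + FF y (k+2))

lemma per_dumb (y : R) (l1 l2 l3 : List V) (cs : List (V × List V))
    (hnd : (u :: v :: (l1 ++ l2 ++ l3 ++ cycV cs)).Nodup) (hall : ∀ x, x ∈ u :: v :: (l1 ++ l2 ++ l3 ++ cycV cs))
    (h1 : l1 ≠ []) (h2 : l2 ≠ []) (hcs : ∀ c ∈ cs, c.2 ≠ []) :
    (dgv y u v + (chainM R u l1 u + chainM R v l2 v + chainM R u l3 v + cycA R cs)).permanent
      = (cs.map fun c => fcy y (c.2.length + 1)).prod * WD y l1.length l2.length l3.length := by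
  simp only [List.nodup_cons, List.mem_cons, not_or, List.mem_append, List.nodup_append] at hnd
  obtain ⟨⟨huv, hu⟩, hv, ⟨⟨n1, n2, n12⟩, n3, n123⟩, nc, n123c⟩ := hnd
  have hall' : ∀ x, x = u ∨ x = v ∨ x ∈ (l1 ++ l2 ++ l3) ++ cycV cs := fun x => by simpa using hall x
  rw [dgv_eq y huv (l := (l1 ++ l2 ++ l3) ++ cycV cs) ?_ (by simp [hu]) (by simp [hv]) hall']
  · have e : core u v (y-1) (y-1) 0 0 + dgl y (l1 ++ l2 ++ l3 ++ cycV cs)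
        + (chainM R u l1 u + chainM R v l2 v + chainM R u l3 v + cycA R cs)
        = (core u v (y-1) (y-1) 0 0 + (((0 + dgl y l1 + chainM R u l1 u) + dgl y l2 + chainM R v l2 v)
          + dgl y l3 + chainM R u l3 v)) + dgl y (cycV cs) + cycA R cs := by
      simp only [dgl_append]; abel
    have z1 : ∀ x, x ∉ l1 → x ≠ u → ZeroAt (0 + dgl y l1 + chainM R u l1 u) x := fun x hx hxu =>
      ((ZeroAt.zero x).add (ZeroAt.dgl y _ hx)).add (ZeroAt.chainM hxu.symm _ _ hxu.symm hx)
    have z2 : ∀ x, x ∉ l1 → x ∉ l2 → x ≠ u → x ≠ v → ZeroAt ((0 + dgl y l1 + chainM R u l1 u) + dgl y l2 + chainM R v l2 v) x := fun x hx hx2 hxu hxv =>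
      ((z1 x hx hxu).add (ZeroAt.dgl y _ hx2)).add (ZeroAt.chainM hxv.symm _ _ hxv.symm hx2)
    rw [e, cycles_per y cs _ nc hcs]
    · congr 1
      change PP u v _ _ _ _ _ = _
      rw [PP_chain huv y n3 (by tauto) (by tauto)]
      · simp only [PP_loopv y h2 n2 (u := u) (v := v) (by tauto) (by tauto) (fun x hx => z1 x
          (fun hx1 => n12 x hx1 x hx rfl) (by rintro rfl; tauto)),
          PP_loopu y h1 n1 (u := u) (v := v) (S := 0) (by tauto) (by tauto) (fun x hx => ZeroAt.zero x), PP_zero huv, WD]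
        ring
      · intro x hx
        refine z2 x (fun h => n123 x (Or.inl h) x hx rfl) (fun h => n123 x (Or.inr h) x hx rfl) ?_ ?_
        · rintro rfl; tauto
        · rintro rfl; tauto
    · intro x hx
      have k1 : x ∉ l1 := fun h => n123c x (Or.inl (Or.inl h)) x hx rfl
      have k2 : x ∉ l2 := fun h => n123c x (Or.inl (Or.inr h)) x hx rfl
      have k3 : x ∉ l3 := fun h => n123c x (Or.inr h) x hx rfl
      have k4 : x ≠ u := by rintro rfl; tauto
      have k5 : x ≠ v := by rintro rfl; tauto
      exact (unitAt_core k4.symm k5.symm _ _ _ _).add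
        (((z2 x k1 k2 k4 k5).add (ZeroAt.dgl y _ k3)).add (ZeroAt.chainM k5.symm _ _ k4.symm k3))
  · simp only [List.nodup_append, List.mem_append]
    exact ⟨⟨⟨n1, n2, n12⟩, n3, n123⟩, nc, n123c⟩

lemma per_theta (y : R) (l1 l2 l3 : List V) (cs : List (V × List V))
    (hnd : (u :: v :: (l1 ++ l2 ++ l3 ++ cycV cs)).Nodup) (hall : ∀ x, x ∈ u :: v :: (l1 ++ l2 ++ l3 ++ cycV cs))
    (hcs : ∀ c ∈ cs, c.2 ≠ []) :
    (dgv y u v + (chainM R u l1 v + chainM R u l2 v + chainM R u l3 v + cycA R cs)).permanent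
      = (cs.map fun c => fcy y (c.2.length + 1)).prod * WT y l1.length l2.length l3.length := by
  simp only [List.nodup_cons, List.mem_cons, not_or, List.mem_append, List.nodup_append] at hnd
  obtain ⟨⟨huv, hu⟩, hv, ⟨⟨n1, n2, n12⟩, n3, n123⟩, nc, n123c⟩ := hnd
  have hall' : ∀ x, x = u ∨ x = v ∨ x ∈ (l1 ++ l2 ++ l3) ++ cycV cs := fun x => by simpa using hall x
  rw [dgv_eq y huv (l := (l1 ++ l2 ++ l3) ++ cycV cs) ?_ (by simp [hu]) (by simp [hv]) hall']
  · have e : core u v (y-1) (y-1) 0 0 + dgl y (l1 ++ l2 ++ l3 ++ cycV cs)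
        + (chainM R u l1 v + chainM R u l2 v + chainM R u l3 v + cycA R cs)
        = (core u v (y-1) (y-1) 0 0 + (((0 + dgl y l1 + chainM R u l1 v) + dgl y l2 + chainM R u l2 v)
          + dgl y l3 + chainM R u l3 v)) + dgl y (cycV cs) + cycA R cs := by
      simp only [dgl_append]; abel
    have z1 : ∀ x, x ∉ l1 → x ≠ u → x ≠ v → ZeroAt (0 + dgl y l1 + chainM R u l1 v) x := fun x hx hxu hxv =>
      ((ZeroAt.zero x).add (ZeroAt.dgl y _ hx)).add (ZeroAt.chainM hxv.symm _ _ hxu.symm hx)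
    have z2 : ∀ x, x ∉ l1 → x ∉ l2 → x ≠ u → x ≠ v → ZeroAt ((0 + dgl y l1 + chainM R u l1 v) + dgl y l2 + chainM R u l2 v) x := fun x hx hx2 hxu hxv =>
      ((z1 x hx hxu hxv).add (ZeroAt.dgl y _ hx2)).add (ZeroAt.chainM hxv.symm _ _ hxu.symm hx2)
    rw [e, cycles_per y cs _ nc hcs]
    · congr 1
      change PP u v _ _ _ _ _ = _
      rw [PP_chain huv y n3 (by tauto) (by tauto)]
      · have s1 := PP_chain huv y n1 (S := 0) (by tauto) (by tauto) (fun x hx => ZeroAt.zero x)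
        have s2 := PP_chain huv y n2 (by tauto) (by tauto) (fun x hx => z1 x
          (fun hx1 => n12 x hx1 x hx rfl) (by rintro rfl; tauto) (by rintro rfl; tauto))
        simp only [s2, s1, PP_zero huv, WT]
        ring
      · intro x hx
        refine z2 x (fun h => n123 x (Or.inl h) x hx rfl) (fun h => n123 x (Or.inr h) x hx rfl) ?_ ?_
        · rintro rfl; tauto
        · rintro rfl; tauto
    · intro x hx
      have k1 : x ∉ l1 := fun h => n123c x (Or.inl (Or.inl h)) x hx rfl
      have k2 : x ∉ l2 := fun h => n123c x (Or.inl (Or.inr h)) x hx rfl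
      have k3 : x ∉ l3 := fun h => n123c x (Or.inr h) x hx rfl
      have k4 : x ≠ u := by rintro rfl; tauto
      have k5 : x ≠ v := by rintro rfl; tauto
      exact (unitAt_core k4.symm k5.symm _ _ _ _).add
        (((z2 x k1 k2 k4 k5).add (ZeroAt.dgl y _ k3)).add (ZeroAt.chainM k5.symm _ _ k4.symm k3))
  · simp only [List.nodup_append, List.mem_append]
    exact ⟨⟨⟨n1, n2, n12⟩, n3, n123⟩, nc, n123c⟩

end Core

section Subst
variable {K : Type*} [Field K] {w : K}

lemma FF_closed (hw : w ≠ 0) (m : ℕ) :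
    w ^ m * (1 + w ^ 2) * FF (w⁻¹ - w) m = w ^ 2 + (-1) ^ m * w ^ (2 * m)
    ∧ w ^ (m + 1) * (1 + w ^ 2) * FF (w⁻¹ - w) (m + 1) = w ^ 2 + (-1) ^ (m + 1) * w ^ (2 * (m + 1)) := by
  induction m with
  | zero => simp [FF]; ring
  | succ m ih =>
    refine ⟨ih.2, ?_⟩
    have e : w ^ (m + 1 + 1) * (1 + w ^ 2) * FF (w⁻¹ - w) (m + 1 + 1)
      = (1 - w ^ 2) * (w ^ (m + 1) * (1 + w ^ 2) * FF (w⁻¹ - w) (m + 1))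
        + w ^ 2 * (w ^ m * (1 + w ^ 2) * FF (w⁻¹ - w) m) := by
      have : w * (w⁻¹ - w) = 1 - w ^ 2 := by field_simp
      rw [← this]
      simp only [FF]; ring
    rw [e, ih.1, ih.2]; ring

lemma FF_val (hw : w ≠ 0) (hw2 : 1 + w ^ 2 ≠ 0) (m : ℕ) :
    FF (w⁻¹ - w) m = (w ^ 2 + (-1) ^ m * w ^ (2 * m)) / (w ^ m * (1 + w ^ 2)) := by
  rw [eq_div_iff (mul_ne_zero (pow_ne_zero _ hw) hw2), ← (FF_closed hw m).1]; ring

lemma fcy_val (hw : w ≠ 0) (hw2 : 1 + w ^ 2 ≠ 0) (k : ℕ) : w ^ k * fcy (w⁻¹ - w) k = fC w k := by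
  unfold fcy fC
  rw [FF_val hw hw2, FF_val hw hw2]
  simp only [pow_add, pow_mul', mul_add]
  generalize (-1 : K) ^ k = s
  have hA : w ^ k ≠ 0 := pow_ne_zero _ hw
  generalize w ^ k = A at *
  field_simp
  ring

lemma WD_val (hw : w ≠ 0) (hw2 : 1 + w ^ 2 ≠ 0) (i j k : ℕ) :
    w ^ (i + j + k + 2) * (1 + w ^ 2) ^ 3 * WD (w⁻¹ - w) i j k
      = fU w (i + 1) * fU w (j + 1) + (-1) ^ k * w ^ (2 * k + 2) * (fT w (i + 1) * fT w (j + 1)) := by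
  unfold WD fU fT
  simp only [FF_val hw hw2]
  simp only [pow_add, pow_mul', mul_add]
  generalize (-1 : K) ^ k = s
  generalize (-1 : K) ^ i = s1
  generalize (-1 : K) ^ j = s2
  have hA : w ^ k ≠ 0 := pow_ne_zero _ hw
  have hB : w ^ i ≠ 0 := pow_ne_zero _ hw
  have hC : w ^ j ≠ 0 := pow_ne_zero _ hw
  generalize w ^ k = A at *
  generalize w ^ i = B at *
  generalize w ^ j = C at *
  field_simp
  ring

lemma WT_val (hw : w ≠ 0) (hw2 : 1 + w ^ 2 ≠ 0) (i j k : ℕ) :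
    w ^ (i + j + k + 2) * (1 + w ^ 2) ^ 3 * WT (w⁻¹ - w) i j k
      = fTh w (i + 1) (j + 1) (k + 1) := by
  unfold WT fTh
  simp only [FF_val hw hw2]
  simp only [pow_add, pow_mul', mul_add]
  generalize (-1 : K) ^ k = s
  generalize (-1 : K) ^ i = s1
  generalize (-1 : K) ^ j = s2
  have hA : w ^ k ≠ 0 := pow_ne_zero _ hw
  have hB : w ^ i ≠ 0 := pow_ne_zero _ hw
  have hC : w ^ j ≠ 0 := pow_ne_zero _ hw
  generalize w ^ k = A at *
  generalize w ^ i = B at *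
  generalize w ^ j = C at *
  field_simp
  ring

end Subst

lemma map_FF {R S : Type*} [CommRing R] [CommRing S] (f : R →+* S) (y : R) (k : ℕ) :
    f (FF y k) = FF (f y) k ∧ f (FF y (k + 1)) = FF (f y) (k + 1) := by
  induction k with
  | zero => simp [FF]
  | succ k ih => exact ⟨ih.2, by simp [FF, ih.1, ih.2]⟩

lemma map_fcy {R S : Type*} [CommRing R] [CommRing S] (f : R →+* S) (y : R) (k : ℕ) :
    f (fcy y k) = fcy (f y) k := by
  have h2 : f 2 = 2 := map_ofNat f 2
  simp [fcy, (map_FF f y _).1, h2]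

lemma map_WD {R S : Type*} [CommRing R] [CommRing S] (f : R →+* S) (y : R) (i j k : ℕ) :
    f (WD y i j k) = WD (f y) i j k := by
  have h2 : f 2 = 2 := map_ofNat f 2
  simp [WD, (map_FF f y _).1, h2]

lemma map_WT {R S : Type*} [CommRing R] [CommRing S] (f : R →+* S) (y : R) (i j k : ℕ) :
    f (WT y i j k) = WT (f y) i j k := by
  have h2 : f 2 = 2 := map_ofNat f 2
  simp [WT, (map_FF f y _).1, h2]

abbrev KK := FractionRing ℤ[X]

abbrev wK : KK := algebraMap ℤ[X] KK X

lemma wK_ne : wK ≠ 0 := by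
  intro h
  exact X_ne_zero (IsFractionRing.injective ℤ[X] KK (h.trans (map_zero _).symm))

lemma wK2_ne : 1 + wK ^ 2 ≠ 0 := by
  intro h
  have h2 : algebraMap ℤ[X] KK (1 + X ^ 2) = algebraMap ℤ[X] KK 0 := by
    simpa using h
  have h3 := IsFractionRing.injective ℤ[X] KK h2
  have h4 := congrArg (Polynomial.eval 0) h3
  simp at h4

def phiK : ℚ[X] →+* KK := Polynomial.eval₂RingHom (algebraMap ℚ KK) (wK⁻¹ - wK + 2)

lemma phiK_y : phiK (X - 2) = wK⁻¹ - wK := by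
  rw [map_sub, map_ofNat]
  simp [phiK]

lemma prod_fcy {K : Type*} [Field K] {w : K} (hw : w ≠ 0) (hw2 : 1 + w ^ 2 ≠ 0) (ks : Multiset ℕ) :
    w ^ ks.sum * (ks.map (fcy (w⁻¹ - w))).prod = (ks.map (fC w)).prod := by
  induction ks using Multiset.induction with
  | empty => simp
  | cons k ks ih =>
    simp only [Multiset.map_cons, Multiset.prod_cons, Multiset.sum_cons, ← ih]
    rw [pow_add, ← fcy_val hw hw2]; ring

lemma subst_dumb {i j k i' j' k' : ℕ} {ks : Multiset ℕ}
    (h : WD (X - 2 : ℚ[X]) i j k = (ks.map (fcy (X - 2))).prod * WD (X - 2) i' j' k')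
    (hn : i + j + k = i' + j' + k' + ks.sum) :
    DumbId (X : ℤ[X]) {i + 1, j + 1} {i' + 1, j' + 1} 0 ks k k' := by
  have h1 := congrArg phiK h
  rw [map_mul, map_multiset_prod, Multiset.map_map, map_WD, map_WD, phiK_y] at h1
  have e : (phiK ∘ fcy (X - 2)) = fcy (wK⁻¹ - wK) := by
    ext k; rw [Function.comp, map_fcy, phiK_y]
  rw [e] at h1
  have h2 : fU wK (i + 1) * fU wK (j + 1) + (-1) ^ k * wK ^ (2 * k + 2) * (fT wK (i + 1) * fT wK (j + 1))
      = (ks.map (fC wK)).prod * (fU wK (i' + 1) * fU wK (j' + 1) + (-1) ^ k' * wK ^ (2 * k' + 2) * (fT wK (i' + 1) * fT wK (j' + 1))) := by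
    rw [← WD_val wK_ne wK2_ne, ← WD_val wK_ne wK2_ne, ← prod_fcy wK_ne wK2_ne, h1, hn,
      show i' + j' + k' + ks.sum + 2 = ks.sum + (i' + j' + k' + 2) by ring, pow_add]
    ring
  apply IsFractionRing.injective ℤ[X] KK
  have e2 : (algebraMap ℤ[X] KK ∘ fC X) = fC wK := by ext k; rw [Function.comp, map_fC]
  simp only [Multiset.insert_eq_cons, Multiset.map_cons, Multiset.map_singleton, Multiset.prod_cons,
    Multiset.prod_singleton, Multiset.map_zero, Multiset.prod_zero, mul_one]
  rw [map_mul, map_add, map_add, map_multiset_prod, Multiset.map_map, e2]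
  simp only [map_mul, map_fU, map_fT, map_pow, map_neg, map_one]
  exact h2

lemma subst_theta {i j k a b c : ℕ} {ks : Multiset ℕ}
    (h : WD (X - 2 : ℚ[X]) i j k = (ks.map (fcy (X - 2))).prod * WT (X - 2) a b c)
    (hn : i + j + k = a + b + c + ks.sum) :
    ThId (X : ℤ[X]) (i + 1) (j + 1) k ks (a + 1) (b + 1) (c + 1) := by
  have h1 := congrArg phiK h
  rw [map_mul, map_multiset_prod, Multiset.map_map, map_WD, map_WT, phiK_y] at h1
  have e : (phiK ∘ fcy (X - 2)) = fcy (wK⁻¹ - wK) := by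
    ext k; rw [Function.comp, map_fcy, phiK_y]
  rw [e] at h1
  have h2 : fU wK (i + 1) * fU wK (j + 1) + (-1) ^ k * wK ^ (2 * k + 2) * (fT wK (i + 1) * fT wK (j + 1))
      = (ks.map (fC wK)).prod * fTh wK (a + 1) (b + 1) (c + 1) := by
    rw [← WD_val wK_ne wK2_ne, ← WT_val wK_ne wK2_ne, ← prod_fcy wK_ne wK2_ne, h1, hn,
      show a + b + c + ks.sum + 2 = ks.sum + (a + b + c + 2) by ring, pow_add]
    ring
  apply IsFractionRing.injective ℤ[X] KK
  have e2 : (algebraMap ℤ[X] KK ∘ fC X) = fC wK := by ext k; rw [Function.comp, map_fC]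
  rw [map_mul, map_add, map_multiset_prod, Multiset.map_map, e2]
  simp only [map_mul, map_fU, map_fT, map_pow, map_neg, map_one, map_fTh]
  exact h2

section Peel
variable {V : Type*} [Fintype V]

def GM (A : Matrix V V ℕ) : Prop := (∀ i j, A i j = A j i) ∧ ∀ i, A i i = 0

def dg (A : Matrix V V ℕ) (i : V) : ℕ := ∑ j, A i j

lemma dg_add (A B : Matrix V V ℕ) (i : V) : dg (A + B) i = dg A i + dg B i := by
  simp [dg, Finset.sum_add_distrib]

lemma dg_single (u v i : V) : dg (Matrix.single u v 1) i = if i = u then 1 else 0 := by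
  unfold dg
  by_cases h : i = u
  · subst h; simp [Matrix.single_apply]
  · simp [Matrix.single_apply, h, Ne.symm h]

lemma dg_chain (v : V) : ∀ (l : List V) (u x : V), dg (chainM ℕ u l v) x
    = (if x = u then 1 else 0) + (if x = v then 1 else 0) + 2 * l.count x := by
  intro l
  induction l with
  | nil => intro u x; simp [chainM, dg_add, dg_single]
  | cons z l ih =>
    intro u x
    simp only [chainM, dg_add, dg_single, ih, List.count_cons]
    by_cases h : x = z
    · subst h; simp; omega
    · simp [h, Ne.symm h]; omega

lemma dg_cycA (cs : List (V × List V)) (x : V) : dg (cycA ℕ cs) x = 2 * (cycV cs).count x := by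
  induction cs with
  | nil => simp [cycA, cycV, dg]
  | cons c cs ih =>
    have e1 : cycA ℕ (c :: cs) = chainM ℕ c.1 c.2 c.1 + cycA ℕ cs := by simp [cycA]
    have e2 : cycV (c :: cs) = (c.1 :: c.2) ++ cycV cs := by simp [cycV]
    rw [e1, e2, dg_add, ih, dg_chain, List.count_append, List.count_cons]
    by_cases h : x = c.1
    · subst h; simp; omega
    · simp [h, Ne.symm h]; omega

lemma chain_symm (v : V) : ∀ (l : List V) (u : V) (i j : V), chainM ℕ u l v i j = chainM ℕ u l v j i := by
  intro l
  induction l with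
  | nil => intro u i j; simp [chainM, Matrix.single_apply]; rw [add_comm]; simp [and_comm]
  | cons z l ih =>
    intro u i j
    simp only [chainM, Matrix.add_apply, ih z i j, Matrix.single_apply]
    congr 1
    rw [add_comm]; simp [and_comm]

lemma GM.sub {C A : Matrix V V ℕ} (h : GM (C + A)) (hC : ∀ i j, C i j = C j i) : GM A := by
  refine ⟨fun i j => ?_, fun i => ?_⟩
  · have := h.1 i j
    simp only [Matrix.add_apply, hC i j] at this
    omega
  · have := h.2 i
    simp only [Matrix.add_apply] at this
    omega

lemma peel_edge {A : Matrix V V ℕ} (h : GM A) {a : V} (ha : dg A a ≠ 0) :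
    ∃ b A1, b ≠ a ∧ A = chainM ℕ a [] b + A1 := by
  obtain ⟨b, -, hb⟩ := Finset.exists_ne_zero_of_sum_ne_zero ha
  have hba : b ≠ a := by rintro rfl; exact hb (h.2 _)
  refine ⟨b, A - chainM ℕ a [] b, hba, ?_⟩
  ext i j
  have hs := h.1 a b
  simp only [chainM, Matrix.add_apply, Matrix.sub_apply, Matrix.single_apply]
  by_cases h1 : a = i ∧ b = j
  · obtain ⟨rfl, rfl⟩ := h1
    simp [hba]; omega
  · by_cases h2 : b = i ∧ a = j
    · obtain ⟨rfl, rfl⟩ := h2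
      simp [hba]; omega
    · simp [h1, h2]

lemma peel_one (S : Set V) (n : ℕ) : ∀ (A : Matrix V V ℕ) (a : V), GM A → ∑ i, dg A i = n → a ∉ S → dg A a = 1 →
    (∀ x, x ∉ S → x ≠ a → dg A x = 0 ∨ dg A x = 2) →
    ∃ l w A', w ∈ S ∧ A = chainM ℕ a l w + A' ∧ ∀ x ∈ l, x ∉ S := by
  induction n using Nat.strong_induction_on with
  | _ n ih =>
    intro A a hA hn haS ha hx
    obtain ⟨b, A1, hba, e⟩ := peel_edge hA (by omega : dg A a ≠ 0)
    by_cases hb : b ∈ S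
    · exact ⟨[], b, A1, hb, e, by simp⟩
    · have hd : ∀ x, dg A x = (if x = a then 1 else 0) + (if x = b then 1 else 0) + dg A1 x := by
        intro x; rw [e, dg_add, dg_chain]; simp
      have hA1 : GM A1 := GM.sub (e ▸ hA) (chain_symm _ _ _)
      have hdb := hd b
      have hb2 := hx b hb hba
      rw [if_neg hba, if_pos rfl] at hdb
      obtain ⟨l, w, A', hw, e', hl⟩ := ih (∑ i, dg A1 i) (by
        rw [← hn]
        refine Finset.sum_lt_sum (fun i _ => ?_) ⟨b, Finset.mem_univ _, ?_⟩
        · have := hd i; omega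
        · omega) A1 b hA1 rfl hb (by omega) (by
          intro x hxS hxb
          have := hd x
          rw [if_neg hxb] at this
          by_cases hxa : x = a
          · subst hxa
            rw [if_pos rfl] at this
            left; omega
          · rw [if_neg hxa] at this
            have := hx x hxS hxa
            omega)
      refine ⟨b :: l, w, A', hw, ?_, ?_⟩
      · rw [e, e']; simp only [chainM]; abel
      · simpa [hb] using hl

lemma peel_start (S : Set V) {A : Matrix V V ℕ} {u : V} (hA : GM A) (hu : u ∈ S) (hd0 : dg A u ≠ 0)
    (hx : ∀ x, x ∉ S → dg A x = 0 ∨ dg A x = 2) :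
    ∃ l w A', w ∈ S ∧ A = chainM ℕ u l w + A' ∧ (∀ x ∈ l, x ∉ S) ∧ GM A' ∧
      (∀ x, x ∉ S → dg A' x = 0 ∨ dg A' x = 2) := by
  suffices h : ∃ l w A', w ∈ S ∧ A = chainM ℕ u l w + A' ∧ (∀ x ∈ l, x ∉ S) by
    obtain ⟨l, w, A', hw, e, hl⟩ := h
    refine ⟨l, w, A', hw, e, hl, GM.sub (e ▸ hA) (chain_symm _ _ _), ?_⟩
    intro x hxS
    have h1 := hx x hxS
    have h2 := congrArg (fun M => dg M x) e
    simp only [dg_add, dg_chain] at h2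
    rw [if_neg (by rintro rfl; exact hxS hu), if_neg (by rintro rfl; exact hxS hw)] at h2
    omega
  obtain ⟨b, A1, hba, e⟩ := peel_edge hA hd0
  by_cases hb : b ∈ S
  · exact ⟨[], b, A1, hb, e, by simp⟩
  · have hd : ∀ x, dg A x = (if x = u then 1 else 0) + (if x = b then 1 else 0) + dg A1 x := by
      intro x; rw [e, dg_add, dg_chain]; simp
    have hA1 : GM A1 := GM.sub (e ▸ hA) (chain_symm _ _ _)
    have hdb := hd b
    have hb2 := hx b hb
    rw [if_neg hba, if_pos rfl] at hdb
    obtain ⟨l, w, A', hw, e', hl⟩ := peel_one S _ A1 b hA1 rfl hb (by omega) (by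
      intro x hxS hxb
      have := hd x
      rw [if_neg hxb, if_neg (by rintro rfl; exact hxS hu)] at this
      have := hx x hxS
      omega)
    refine ⟨b :: l, w, A', hw, ?_, ?_⟩
    · rw [e, e']; simp only [chainM]; abel
    · simpa [hb] using hl

lemma peel_cycles (n : ℕ) : ∀ (A : Matrix V V ℕ), GM A → ∑ i, dg A i = n → (∀ x, dg A x = 0 ∨ dg A x = 2) →
    ∃ cs, A = cycA ℕ cs := by
  induction n using Nat.strong_induction_on with
  | _ n ih =>
    intro A hA hn hx
    by_cases h0 : ∀ x, dg A x = 0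
    · refine ⟨[], ?_⟩
      ext i j
      have := h0 i
      simp only [dg, Finset.sum_eq_zero_iff, Finset.mem_univ, true_implies] at this
      simp [cycA, this j]
    · push Not at h0
      obtain ⟨u, hu⟩ := h0
      obtain ⟨l, w, A', hw, e, hl, hA', -⟩ := peel_start {u} hA rfl hu (fun x _ => hx x)
      obtain rfl : w = u := hw
      have hd : ∀ x, dg A x = (if x = w then 1 else 0) + (if x = w then 1 else 0) + 2 * l.count x + dg A' x := by
        intro x; rw [e, dg_add, dg_chain]
      obtain ⟨cs, hcs⟩ := ih (∑ i, dg A' i) (by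
        rw [← hn]
        refine Finset.sum_lt_sum (fun i _ => ?_) ⟨w, Finset.mem_univ _, ?_⟩
        · have := hd i; omega
        · have := hd w; simp at this; omega) A' hA' rfl (by
          intro x
          have h1 := hd x
          have h2 := hx x
          split_ifs at h1 <;> omega)
      refine ⟨(w, l) :: cs, ?_⟩
      rw [e, hcs]; simp [cycA]

lemma loop_len {u : V} {l : List V} (h0 : ∀ i, chainM ℕ u l u i i = 0) (h1 : ∀ i j, chainM ℕ u l u i j ≤ 1) :
    2 ≤ l.length := by
  match l with
  | [] => have := h0 u; simp [chainM] at this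
  | [x] => have := h1 u x; have := h0 u; simp [chainM, Matrix.single_apply] at *
           by_cases hx : x = u <;> simp_all
  | x :: y :: l => simp

lemma peel_main {A : Matrix V V ℕ} {u v : V} (hA : GM A) (h1 : ∀ i j, A i j ≤ 1) (huv : u ≠ v)
    (hu : dg A u = 3) (hv : dg A v = 3) (hx : ∀ x, x ≠ u → x ≠ v → dg A x = 2) :
    ∃ l1 l2 l3 cs, (u :: v :: (l1 ++ l2 ++ l3 ++ cycV cs)).Nodup ∧ (∀ x, x ∈ u :: v :: (l1 ++ l2 ++ l3 ++ cycV cs)) ∧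
      (∀ c ∈ cs, 2 ≤ c.2.length) ∧
      ((A = chainM ℕ u l1 u + chainM ℕ v l2 v + chainM ℕ u l3 v + cycA ℕ cs ∧ 2 ≤ l1.length ∧ 2 ≤ l2.length)
      ∨ (A = chainM ℕ u l1 v + chainM ℕ u l2 v + chainM ℕ u l3 v + cycA ℕ cs ∧
          (l1 ≠ [] ∨ l2 ≠ []) ∧ (l1 ≠ [] ∨ l3 ≠ []) ∧ (l2 ≠ [] ∨ l3 ≠ []))) := by
  have key : ∃ l1 l2 l3 cs,
      (A = chainM ℕ u l1 u + chainM ℕ v l2 v + chainM ℕ u l3 v + cycA ℕ cs)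
      ∨ (A = chainM ℕ u l1 v + chainM ℕ u l2 v + chainM ℕ u l3 v + cycA ℕ cs) := by
    have cyc : ∀ B : Matrix V V ℕ, GM B → dg B u = 0 → dg B v = 0 →
        (∀ x, x ∉ ({u, v} : Set V) → dg B x = 0 ∨ dg B x = 2) → ∃ cs, B = cycA ℕ cs := by
      intro B hB h1 h2 h3
      refine peel_cycles _ B hB rfl fun x => ?_
      by_cases hxu : x = u
      · subst hxu; exact Or.inl h1
      · by_cases hxv : x = v
        · subst hxv; exact Or.inl h2
        · exact h3 x (by simp [hxu, hxv])
    have cnt : ∀ {x : V} {l : List V}, x ∈ ({u, v} : Set V) → (∀ x ∈ l, x ∉ ({u, v} : Set V)) → l.count x = 0 := by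
      intro x l hx hl
      rw [List.count_eq_zero]; exact fun h => hl x h hx
    have mu : u ∈ ({u, v} : Set V) := by simp
    have mv : v ∈ ({u, v} : Set V) := by simp
    obtain ⟨l, w, A1, hw, e1, hl, hA1, hx1⟩ := peel_start {u, v} hA (by simp : u ∈ _) (by omega) (by
      intro x hxS; right; simp at hxS; exact hx x hxS.1 hxS.2)
    have du := congrArg (fun M => dg M u) e1
    have dv := congrArg (fun M => dg M v) e1
    simp only [dg_add, dg_chain, cnt mu hl, cnt mv hl, hu, hv, huv, huv.symm, if_true, if_false] at du dv
    rcases hw with rfl | rfl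
    · simp only [huv, huv.symm, if_true, if_false] at du dv
      obtain ⟨l', w', A2, hw', e2, hl', hA2, hx2⟩ := peel_start _ hA1 mu (by omega) hx1
      have du2 := congrArg (fun M => dg M w) e2
      have dv2 := congrArg (fun M => dg M v) e2
      simp only [dg_add, dg_chain, cnt mu hl', cnt mv hl', huv, huv.symm, if_true, if_false] at du2 dv2
      rcases hw' with rfl | rfl
      · simp at du2; omega
      simp only [huv, huv.symm, if_true, if_false] at du2 dv2
      obtain ⟨l'', w'', A3, hw'', e3, hl'', hA3, hx3⟩ := peel_start _ hA2 mv (by omega) hx2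
      have du3 := congrArg (fun M => dg M w) e3
      have dv3 := congrArg (fun M => dg M w') e3
      simp only [dg_add, dg_chain, cnt mu hl'', cnt mv hl'', huv, huv.symm, if_true, if_false] at du3 dv3
      rcases hw'' with rfl | rfl
      · simp at du3; omega
      simp only [huv, huv.symm, if_true, if_false] at du3 dv3
      obtain ⟨cs, e4⟩ := cyc A3 hA3 (by omega) (by omega) hx3
      refine ⟨l, l'', l', cs, Or.inl ?_⟩
      rw [e1, e2, e3, e4]; abel
    · simp only [huv, huv.symm, if_true, if_false] at du dv
      obtain ⟨l', w', A2, hw', e2, hl', hA2, hx2⟩ := peel_start _ hA1 mu (by omega) hx1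
      have du2 := congrArg (fun M => dg M u) e2
      have dv2 := congrArg (fun M => dg M w) e2
      simp only [dg_add, dg_chain, cnt mu hl', cnt mv hl', huv, huv.symm, if_true, if_false] at du2 dv2
      rcases hw' with rfl | rfl
      · simp only [huv, huv.symm, if_true, if_false] at du2 dv2
        obtain ⟨l'', w'', A3, hw'', e3, hl'', hA3, hx3⟩ := peel_start _ hA2 mv (by omega) hx2
        have du3 := congrArg (fun M => dg M w') e3
        have dv3 := congrArg (fun M => dg M w) e3
        simp only [dg_add, dg_chain, cnt mu hl'', cnt mv hl'', huv, huv.symm, if_true, if_false] at du3 dv3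
        rcases hw'' with rfl | rfl
        · simp at du3; omega
        simp only [huv, huv.symm, if_true, if_false] at du3 dv3
        obtain ⟨cs, e4⟩ := cyc A3 hA3 (by omega) (by omega) hx3
        refine ⟨l', l'', l, cs, Or.inl ?_⟩
        rw [e1, e2, e3, e4]; abel
      · simp only [huv, huv.symm, if_true, if_false] at du2 dv2
        obtain ⟨l'', w'', A3, hw'', e3, hl'', hA3, hx3⟩ := peel_start _ hA2 mu (by omega) hx2
        have du3 := congrArg (fun M => dg M u) e3
        have dv3 := congrArg (fun M => dg M w') e3
        simp only [dg_add, dg_chain, cnt mu hl'', cnt mv hl'', huv, huv.symm, if_true, if_false] at du3 dv3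
        rcases hw'' with rfl | rfl
        · simp at du3; omega
        simp only [huv, huv.symm, if_true, if_false] at du3 dv3
        obtain ⟨cs, e4⟩ := cyc A3 hA3 (by omega) (by omega) hx3
        refine ⟨l, l', l'', cs, Or.inr ?_⟩
        rw [e1, e2, e3, e4]; abel
  obtain ⟨l1, l2, l3, cs, hk⟩ := key
  have hcount : ∀ x, (u :: v :: (l1 ++ l2 ++ l3 ++ cycV cs)).count x = 1 := by
    intro x
    have hd : dg A x = 2 * (l1.count x + l2.count x + l3.count x + (cycV cs).count x)
        + (if x = u then 3 else 0) + (if x = v then 3 else 0) := by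
      rcases hk with e | e <;> rw [e] <;> simp only [dg_add, dg_chain, dg_cycA]
      · split_ifs <;> omega
      · split_ifs <;> omega
    simp only [List.count_cons, List.count_append, beq_iff_eq, @eq_comm _ _ x]
    by_cases hxu : x = u
    · subst hxu; simp only [huv, if_true, if_false] at hd ⊢; omega
    · by_cases hxv : x = v
      · subst hxv; simp only [huv.symm, if_true, if_false] at hd ⊢; omega
      · have := hx x hxu hxv
        simp only [hxu, hxv, if_false] at hd ⊢; omega
  have hle : ∀ {C D : Matrix V V ℕ}, A = C + D → (∀ i, C i i = 0) ∧ ∀ i j, C i j ≤ 1 := by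
    intro C D e
    refine ⟨fun i => ?_, fun i j => ?_⟩
    · have h1 := hA.2 i
      have h2 := congrFun (congrFun e i) i
      simp only [Matrix.add_apply] at h2; omega
    · have h1 := h1 i j
      have h2 := congrFun (congrFun e i) j
      simp only [Matrix.add_apply] at h2; omega
  refine ⟨l1, l2, l3, cs, ?_, ?_, ?_, ?_⟩
  · rw [List.nodup_iff_count_le_one]; exact fun x => (hcount x).le
  · intro x; rw [← List.count_pos_iff, hcount x]; exact one_pos
  · intro c hc
    obtain ⟨s, t, rfl⟩ := List.append_of_mem hc
    have e0 : cycA ℕ (s ++ c :: t) = cycA ℕ s + (chainM ℕ c.1 c.2 c.1 + cycA ℕ t) := by simp [cycA]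
    have : ∃ D, A = chainM ℕ c.1 c.2 c.1 + D := by
      rcases hk with e | e
      · exact ⟨chainM ℕ u l1 u + chainM ℕ v l2 v + chainM ℕ u l3 v + cycA ℕ s + cycA ℕ t, by rw [e, e0]; abel⟩
      · exact ⟨chainM ℕ u l1 v + chainM ℕ u l2 v + chainM ℕ u l3 v + cycA ℕ s + cycA ℕ t, by rw [e, e0]; abel⟩
    obtain ⟨D, e⟩ := this
    exact loop_len (hle e).1 (hle e).2
  · rcases hk with e | e
    · left
      have e1 : A = chainM ℕ u l1 u + (chainM ℕ v l2 v + chainM ℕ u l3 v + cycA ℕ cs) := by rw [e]; abel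
      have e2 : A = chainM ℕ v l2 v + (chainM ℕ u l1 u + chainM ℕ u l3 v + cycA ℕ cs) := by rw [e]; abel
      exact ⟨e, loop_len (hle e1).1 (hle e1).2, loop_len (hle e2).1 (hle e2).2⟩
    · right
      have nn : ¬ ∃ D, A = chainM ℕ u [] v + chainM ℕ u [] v + D := by
        rintro ⟨D, e⟩
        have := (hle e).2 u v
        simp [chainM] at this
        omega
      refine ⟨e, ?_, ?_, ?_⟩ <;> by_contra! hc <;> obtain ⟨rfl, rfl⟩ := hc <;> apply nn
      · exact ⟨chainM ℕ u l3 v + cycA ℕ cs, by rw [e]; abel⟩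
      · exact ⟨chainM ℕ u l2 v + cycA ℕ cs, by rw [e]; abel⟩
      · exact ⟨chainM ℕ u l1 v + cycA ℕ cs, by rw [e]; abel⟩

end Peel

section EE

lemma ite_add_or {P Q : Prop} [Decidable P] [Decidable Q] [Decidable (P ∨ Q)] (h : ¬ (P ∧ Q)) :
    (if P then 1 else 0) + (if Q then 1 else 0) = if P ∨ Q then 1 else 0 := by
  by_cases hP : P <;> by_cases hQ : Q <;> simp_all

variable {V : Type*} [Fintype V]

lemma edge_val {g : V → ℕ} (hg : Function.Injective g) {a b : V} (hab : g a ≠ g b) (i j : V) :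
    (Matrix.single a b (1 : ℕ) + Matrix.single b a (1 : ℕ)) i j
      = if (g i = g a ∧ g j = g b) ∨ (g i = g b ∧ g j = g a) then 1 else 0 := by
  rw [← ite_add_or (by omega)]
  simp only [Matrix.add_apply, Matrix.single_apply, hg.eq_iff, @eq_comm _ i, @eq_comm _ j]

lemma chain_val {g : V → ℕ} (hg : Function.Injective g) (w : V) (i j : V) : ∀ (l : List V) (u : V) (a : ℕ),
    l.map g = List.range' (a + 1) l.length → g u = a → g w ≠ a + l.length →
    chainM ℕ u l w i j = (if (g i + 1 = g j ∧ a ≤ g i ∧ g j ≤ a + l.length) ∨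
        (g j + 1 = g i ∧ a ≤ g j ∧ g i ≤ a + l.length) then 1 else 0)
      + (if (g i = a + l.length ∧ g j = g w) ∨ (g i = g w ∧ g j = a + l.length) then 1 else 0) := by
  intro l
  induction l with
  | nil =>
    intro u a _ hu hw
    simp only [List.length_nil, add_zero, chainM] at hw ⊢
    rw [edge_val hg (by omega), hu, ite_add_or (by omega)]
    apply if_congr _ rfl rfl; omega
  | cons x l ih =>
    intro u a hl hu hw
    simp only [List.map_cons, List.length_cons, List.range'_succ, List.cons.injEq] at hl hw ⊢
    rw [chainM, Matrix.add_apply, edge_val hg (by omega), ih x (a + 1) hl.2 hl.1 (by omega), ← add_assoc,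
      ite_add_or (by omega)]
    congr 1
    · apply if_congr _ rfl rfl; omega
    · apply if_congr _ rfl rfl; omega

/-- relation of `dGraph` on naturals -/
def dRel (p q r i j : ℕ) : Prop :=
    (i + 1 = j ∧ j < p) ∨
    (i = p - 1 ∧ j = 0) ∨
    (i + 1 = j ∧ p ≤ i ∧ j < p + q) ∨
    (i = p + q - 1 ∧ j = p) ∨
    (i + 1 = j ∧ p + q ≤ i) ∨
    (i = 0 ∧ j = p + q) ∨
    (i = p + q + r - 1 ∧ j = p)

lemma dGraph_adj (p q r : ℕ) (i j : Fin (p + q + r)) :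
    (dGraph p q r).Adj i j ↔ i.val ≠ j.val ∧ (dRel p q r i.val j.val ∨ dRel p q r j.val i.val) := by
  unfold dGraph
  rw [SimpleGraph.fromRel_adj, Ne, Fin.ext_iff]
  rfl

lemma shuffle7 {Y A1 A2 A3 A4 A5 A6 A7 B1 B2 B3 B4 B5 B6 B7 : Prop}
    (h1 : A1 ∨ B1 → Y) (h2 : A2 ∨ B2 → Y) (h3 : A3 ∨ B3 → Y) (h4 : A4 ∨ B4 → Y) (h5 : A5 ∨ B5 → Y)
    (h6 : A6 ∨ B6 → Y) (h7 : A7 ∨ B7 → Y) :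
    ((((A1 ∨ B1) ∨ (A2 ∨ B2)) ∨ ((A3 ∨ B3) ∨ (A4 ∨ B4))) ∨ ((A6 ∨ B6) ∨ ((A5 ∨ B5) ∨ (A7 ∨ B7)))) ↔
      Y ∧ ((A1 ∨ A2 ∨ A3 ∨ A4 ∨ A5 ∨ A6 ∨ A7) ∨ (B1 ∨ B2 ∨ B3 ∨ B4 ∨ B5 ∨ B6 ∨ B7)) := by
  constructor
  · rintro ((((h | h) | (h | h)) | ((h | h) | (h | h))) | ((h | h) | ((h | h) | (h | h))))
    · exact ⟨h1 (Or.inl h), by simp only [h, true_or, or_true]⟩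
    · exact ⟨h1 (Or.inr h), by simp only [h, true_or, or_true]⟩
    · exact ⟨h2 (Or.inl h), by simp only [h, true_or, or_true]⟩
    · exact ⟨h2 (Or.inr h), by simp only [h, true_or, or_true]⟩
    · exact ⟨h3 (Or.inl h), by simp only [h, true_or, or_true]⟩
    · exact ⟨h3 (Or.inr h), by simp only [h, true_or, or_true]⟩
    · exact ⟨h4 (Or.inl h), by simp only [h, true_or, or_true]⟩
    · exact ⟨h4 (Or.inr h), by simp only [h, true_or, or_true]⟩
    · exact ⟨h6 (Or.inl h), by simp only [h, true_or, or_true]⟩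
    · exact ⟨h6 (Or.inr h), by simp only [h, true_or, or_true]⟩
    · exact ⟨h5 (Or.inl h), by simp only [h, true_or, or_true]⟩
    · exact ⟨h5 (Or.inr h), by simp only [h, true_or, or_true]⟩
    · exact ⟨h7 (Or.inl h), by simp only [h, true_or, or_true]⟩
    · exact ⟨h7 (Or.inr h), by simp only [h, true_or, or_true]⟩
  · rintro ⟨-, ((h | h | h | h | h | h | h) | (h | h | h | h | h | h | h))⟩ <;> simp only [h, true_or, or_true]

set_option maxHeartbeats 3000000 in
lemma dumb_val {g : V → ℕ} (hg : Function.Injective g) {p q r : ℕ} (hp : 3 ≤ p) (hq : 3 ≤ q) (hr : 1 ≤ r)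
    (hlt : ∀ x, g x < p + q + r) {u v : V} {l1 l2 l3 : List V} (e1 : l1.length + 1 = p) (e2 : l2.length + 1 = q)
    (e3 : l3.length = r) (hu : g u = 0) (hv : g v = p) (h1 : l1.map g = List.range' 1 (p - 1))
    (h2 : l2.map g = List.range' (p + 1) (q - 1)) (h3 : l3.map g = List.range' (p + q) r) (i j : V) :
    (chainM ℕ u l1 u + chainM ℕ v l2 v + chainM ℕ u l3 v) i j
      = if g i ≠ g j ∧ (dRel p q r (g i) (g j) ∨ dRel p q r (g j) (g i)) then 1 else 0 := by
  obtain ⟨x, l3, rfl⟩ : ∃ x l, l3 = x :: l := List.exists_cons_of_length_pos (by omega)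
  obtain ⟨r, rfl⟩ : ∃ s, r = s + 1 := ⟨r - 1, by omega⟩
  simp only [List.length_cons, List.map_cons, List.range'_succ, List.cons.injEq] at e3 h3
  have e3' : l3.length = r := by omega
  have e1' : l1.length = p - 1 := by omega
  have e2' : l2.length = q - 1 := by omega
  have c1 := chain_val hg u i j l1 u 0 (by rw [h1, e1']) hu (by omega)
  have c2 := chain_val hg v i j l2 v p (by rw [h2, e2']) hv (by omega)
  have c3 := chain_val hg v i j l3 x (p + q) (by rw [h3.2, e3']) h3.1 (by omega)
  rw [Matrix.add_apply, Matrix.add_apply, c1, c2, chainM, Matrix.add_apply, c3, edge_val hg (by omega)]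
  have bi := hlt i
  have bj := hlt j
  rw [e1', e2', e3', hu, hv, h3.1]
  clear c1 c2 c3 hlt h1 h2 h3 hu hv
  generalize g i = a at *
  generalize g j = b at *
  rw [ite_add_or (by omega), ite_add_or (by omega), ite_add_or (by omega), ite_add_or (by omega),
    ite_add_or (by omega), ite_add_or (by omega)]
  apply if_congr _ rfl rfl
  unfold dRel
  refine Iff.trans ?_ (shuffle7 (by omega) (by omega) (by omega) (by omega) (by omega) (by omega) (by omega))
  refine or_congr (or_congr (or_congr ?_ ?_) (or_congr ?_ ?_)) (or_congr ?_ (or_congr ?_ ?_)) <;> omega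

lemma adj_mat_nat (G : SimpleGraph V) (i j : V) : G.adjMatrix ℕ i j = if G.Adj i j then 1 else 0 :=
  SimpleGraph.adjMatrix_apply ..

/-- decomposition of `dGraph` -/
lemma dGraph_chain {p q r : ℕ} (hp : 3 ≤ p) (hq : 3 ≤ q) (hr : 1 ≤ r) :
    ∃ (u v : Fin (p + q + r)) (l1 l2 l3 : List (Fin (p + q + r))), l1.length + 1 = p ∧ l2.length + 1 = q ∧ l3.length = r ∧
      (dGraph p q r).adjMatrix ℕ = chainM ℕ u l1 u + chainM ℕ v l2 v + chainM ℕ u l3 v ∧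
      (u :: v :: (l1 ++ l2 ++ l3)).Nodup ∧ ∀ x, x ∈ u :: v :: (l1 ++ l2 ++ l3) := by
  have mk : ∀ a k, a + k ≤ p + q + r → ∃ l : List (Fin (p + q + r)), l.map Fin.val = List.range' a k := by
    intro a k hk
    refine ⟨(List.range' a k).pmap Fin.mk (fun x hx => ?_), ?_⟩
    · rw [List.mem_range'_1] at hx; omega
    · rw [List.map_pmap]; simp
  obtain ⟨l1, h1⟩ := mk 1 (p - 1) (by omega)
  obtain ⟨l2, h2⟩ := mk (p + 1) (q - 1) (by omega)
  obtain ⟨l3, h3⟩ := mk (p + q) r (by omega)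
  have e1 : l1.length + 1 = p := by
    have := congrArg List.length h1; simp at this; omega
  have e2 : l2.length + 1 = q := by
    have := congrArg List.length h2; simp at this; omega
  have e3 : l3.length = r := by
    have := congrArg List.length h3; simpa using this
  refine ⟨⟨0, by omega⟩, ⟨p, by omega⟩, l1, l2, l3, e1, e2, e3, ?_, ?_, ?_⟩
  · ext i j
    rw [dumb_val (g := Fin.val) Fin.val_injective hp hq hr (fun x => x.2) e1 e2 e3 rfl rfl h1 h2 h3, adj_mat_nat]
    apply if_congr _ rfl rfl
    exact dGraph_adj p q r i j
  · apply List.Nodup.of_map Fin.val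
    simp only [List.map_cons, List.map_append, h1, h2, h3, List.nodup_cons, List.mem_cons, List.mem_append, List.mem_range'_1,
      List.nodup_append, List.nodup_range', true_and]
    refine ⟨by omega, by omega, ⟨List.nodup_range', List.nodup_range', ?_⟩, List.nodup_range', ?_⟩
    · intro a ha b hb; omega
    · intro a ha b hb; omega
  · intro x
    have hx := x.2
    rw [← List.mem_map_of_injective Fin.val_injective]
    simp only [List.map_cons, List.map_append, h1, h2, h3, List.mem_cons, List.mem_append, List.mem_range'_1]
    omega

lemma map_idx {L : List V} (hnd : L.Nodup) {s l t : List V} (e : L = s ++ l ++ t) :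
    l.map (fun x => L.idxOf x) = List.range' s.length l.length := by
  apply List.ext_getElem
  · simp
  · intro i h1 h2
    simp only [List.length_map] at h1
    have hi : s.length + i < L.length := by rw [e]; simp; omega
    have : l[i] = L[s.length + i] := by
      simp [e, List.getElem_append, h1]
    simp only [List.getElem_map, List.getElem_range', one_mul]
    rw [this, hnd.idxOf_getElem]

/-- chain data gives an isomorphism with `dGraph` -/
lemma dumb_iso (G : SimpleGraph V) {p q r : ℕ} (hp : 3 ≤ p) (hq : 3 ≤ q) (hr : 1 ≤ r)
    {u v : V} {l1 l2 l3 : List V} (e1 : l1.length + 1 = p) (e2 : l2.length + 1 = q)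
    (e3 : l3.length = r) (hA : G.adjMatrix ℕ = chainM ℕ u l1 u + chainM ℕ v l2 v + chainM ℕ u l3 v)
    (hnd : (u :: v :: (l1 ++ l2 ++ l3)).Nodup) (hall : ∀ x, x ∈ u :: v :: (l1 ++ l2 ++ l3)) :
    Nonempty (G ≃g dGraph p q r) := by
  set L := [u] ++ l1 ++ [v] ++ l2 ++ l3 with hL
  have hperm : L.Perm (u :: v :: (l1 ++ l2 ++ l3)) := by
    rw [List.perm_iff_count]
    intro a
    simp [hL, List.count_append, List.count_cons]
    omega
  have hnd' : L.Nodup := hperm.nodup_iff.2 hnd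
  have hall' : ∀ x, x ∈ L := fun x => hperm.mem_iff.2 (hall x)
  have hlen : L.length = p + q + r := by simp [hL]; omega
  let g : V → ℕ := fun x => L.idxOf x
  have hlt : ∀ x, g x < p + q + r := fun x => by rw [← hlen]; exact List.idxOf_lt_length_of_mem (hall' x)
  have hg : Function.Injective g := by
    intro a b hab
    exact (List.idxOf_inj (hall' a)).1 hab
  have mu := map_idx hnd' (s := []) (l := [u]) (t := l1 ++ [v] ++ l2 ++ l3) (by simp [hL])
  have m1 := map_idx hnd' (s := [u]) (l := l1) (t := [v] ++ l2 ++ l3) (by simp [hL])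
  have mv := map_idx hnd' (s := [u] ++ l1) (l := [v]) (t := l2 ++ l3) (by simp [hL])
  have m2 := map_idx hnd' (s := [u] ++ l1 ++ [v]) (l := l2) (t := l3) (by simp [hL])
  have m3 := map_idx hnd' (s := [u] ++ l1 ++ [v] ++ l2) (l := l3) (t := []) (by simp [hL])
  have hB := dumb_val hg hp hq hr hlt e1 e2 e3 (u := u) (v := v)
    (by simpa using mu)
    (by simp at mv; change L.idxOf v = p; omega)
    (by rw [m1, show l1.length = p - 1 by omega]; rfl)
    (by rw [m2, show l2.length = q - 1 by omega]; congr 1; simp; omega)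
    (by rw [m3, e3]; congr 1; simp; omega)
  let φ : V → Fin (p + q + r) := fun x => ⟨g x, hlt x⟩
  have hφ : Function.Bijective φ := by
    refine ⟨fun a b h => hg (congrArg Fin.val h), fun y => ?_⟩
    refine ⟨L[y.val]'(by rw [hlen]; exact y.2), ?_⟩
    apply Fin.ext
    exact hnd'.idxOf_getElem _ _
  refine ⟨⟨Equiv.ofBijective φ hφ, ?_⟩⟩
  intro a b
  rw [dGraph_adj]
  have h := hB a b
  rw [← hA, adj_mat_nat] at h
  change (g a ≠ g b ∧ (dRel p q r (g a) (g b) ∨ dRel p q r (g b) (g a))) ↔ _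
  by_cases h1 : G.Adj a b
  · simp only [h1, if_true, iff_true]
    by_contra hc
    rw [if_neg hc, if_pos h1] at h
    exact one_ne_zero h
  · simp only [h1, iff_false]
    intro hc
    rw [if_pos hc, if_neg h1] at h
    exact zero_ne_one h

lemma chain_snoc (v x : V) : ∀ (l : List V) (u : V), chainM ℕ u (l ++ [x]) v = chainM ℕ u l x + chainM ℕ x [] v := by
  intro l
  induction l with
  | nil => intro u; simp [chainM]
  | cons z l ih => intro u; simp only [List.cons_append, chainM, ih]; abel

lemma chain_reverse (v : V) : ∀ (l : List V) (u : V), chainM ℕ u l v = chainM ℕ v l.reverse u := by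
  intro l
  induction l with
  | nil => intro u; simp [chainM, add_comm]
  | cons z l ih =>
    intro u
    rw [List.reverse_cons, chain_snoc, ← ih z]; simp only [chainM]; abel

end EE

section AA
variable {V : Type*} [Fintype V]

lemma prod_coeffs (b : V → ℚ) (s : Finset V) :
    (∏ i ∈ s, (1 + X * C (b i))).coeff 0 = 1 ∧ (∏ i ∈ s, (1 + X * C (b i))).coeff 1 = ∑ i ∈ s, b i ∧
    2 * (∏ i ∈ s, (1 + X * C (b i))).coeff 2 = (∑ i ∈ s, b i) ^ 2 - ∑ i ∈ s, b i ^ 2 := by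
  induction s using Finset.induction_on with
  | empty => simp [coeff_one]
  | insert a s ha ih =>
    obtain ⟨h0, h1, h2⟩ := ih
    rw [Finset.prod_insert ha, Finset.sum_insert ha, Finset.sum_insert ha]
    have e : ∀ P : ℚ[X], (1 + X * C (b a)) * P = P + X * (C (b a) * P) := fun P => by ring
    rw [e]
    refine ⟨?_, ?_, ?_⟩
    · simp only [coeff_add, h0]; simp
    · rw [coeff_add, coeff_X_mul (n := 0), coeff_C_mul, h0, h1]; ring
    · rw [coeff_add, coeff_X_mul (n := 1), coeff_C_mul, h1]; linear_combination h2

def gterm (B : Matrix V V ℚ) (σ : Equiv.Perm V) : ℚ := ∏ i ∈ σ.support, B (σ i) i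

lemma term_eq (B : Matrix V V ℚ) (σ : Equiv.Perm V) :
    ∏ i, ((1 : Matrix V V ℚ[X]) + (X : ℚ[X]) • B.map C) (σ i) i
      = X ^ σ.support.card * (C (gterm B σ) * ∏ i ∈ σ.supportᶜ, (1 + X * C (B i i))) := by
  rw [← Finset.prod_mul_prod_compl σ.support, ← mul_assoc]
  congr 1
  · rw [gterm, map_prod, ← Finset.prod_const, ← Finset.prod_mul_distrib]
    apply Finset.prod_congr rfl
    intro i hi
    rw [Equiv.Perm.mem_support] at hi
    simp [Matrix.one_apply_ne hi]
  · apply Finset.prod_congr rfl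
    intro i hi
    rw [Finset.mem_compl, Equiv.Perm.notMem_support] at hi
    simp [hi]

lemma swap_sum (B : Matrix V V ℚ) :
    2 * ∑ σ : Equiv.Perm V, (if σ.support.card = 2 then gterm B σ else 0)
      = ∑ i, ∑ j, if i ≠ j then B i j * B j i else 0 := by
  have e : ∀ σ : Equiv.Perm V, 2 * (if σ.support.card = 2 then gterm B σ else 0)
      = ∑ i, if σ.support.card = 2 ∧ i ∈ σ.support then gterm B σ else 0 := by
    intro σ
    by_cases h : σ.support.card = 2
    · simp only [h, if_true, true_and]
      rw [Finset.sum_ite_mem, Finset.univ_inter, Finset.sum_const, h, nsmul_eq_mul]; norm_num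
    · simp [h]
  rw [Finset.mul_sum, Finset.sum_congr rfl (fun σ _ => e σ), Finset.sum_comm]
  apply Finset.sum_congr rfl
  intro i _
  rw [← Finset.sum_filter, ← Finset.sum_filter]
  have key : ∀ σ : Equiv.Perm V, σ.support.card = 2 → i ∈ σ.support → Equiv.swap i (σ i) = σ := by
    intro σ h1 h2
    obtain ⟨a, b, hab, rfl⟩ := Equiv.Perm.card_support_eq_two.1 h1
    rw [Equiv.Perm.support_swap hab] at h2
    simp only [Finset.mem_insert, Finset.mem_singleton] at h2
    rcases h2 with rfl | rfl
    · simp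
    · simp [Equiv.swap_comm]
  refine Finset.sum_bij' (fun σ _ => σ i) (fun j _ => Equiv.swap i j) ?_ ?_ ?_ ?_ ?_
  · intro σ hσ
    simp only [Finset.mem_filter, Finset.mem_univ, true_and] at hσ ⊢
    exact (Equiv.Perm.mem_support.1 hσ.2).symm
  · intro j hj
    simp only [Finset.mem_filter, Finset.mem_univ, true_and] at hj ⊢
    rw [Equiv.Perm.support_swap hj]
    exact ⟨Finset.card_pair hj, by simp⟩
  · intro σ hσ
    simp only [Finset.mem_filter, Finset.mem_univ, true_and] at hσ
    exact key σ hσ.1 hσ.2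
  · intro j hj; simp
  · intro σ hσ
    simp only [Finset.mem_filter, Finset.mem_univ, true_and] at hσ
    have hne := (Equiv.Perm.mem_support.1 hσ.2).symm
    have k := key σ hσ.1 hσ.2
    generalize σ i = j at k hne
    subst k
    rw [gterm, Equiv.Perm.support_swap hne, Finset.prod_pair hne]
    simp [mul_comm]

lemma per_coeffs (B : Matrix V V ℚ) :
    (((1 : Matrix V V ℚ[X]) + (X : ℚ[X]) • B.map C).permanent).coeff 0 = 1 ∧
    (((1 : Matrix V V ℚ[X]) + (X : ℚ[X]) • B.map C).permanent).coeff 1 = ∑ i, B i i ∧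
    2 * (((1 : Matrix V V ℚ[X]) + (X : ℚ[X]) • B.map C).permanent).coeff 2
      = (∑ i, B i i) ^ 2 - ∑ i, B i i ^ 2 + ∑ i, ∑ j, if i ≠ j then B i j * B j i else 0 := by
  have g1 : gterm B 1 = 1 := by simp [gterm]
  obtain ⟨p0, p1, p2⟩ := prod_coeffs (fun i => B i i) (Finset.univ : Finset V)
  rw [Matrix.permanent, Finset.sum_congr rfl (fun σ _ => term_eq B σ)]
  refine ⟨?_, ?_, ?_⟩
  · rw [finset_sum_coeff, Finset.sum_eq_single 1]
    · simp only [Equiv.Perm.support_one, Finset.card_empty, pow_zero, one_mul, g1, Finset.compl_empty, map_one, p0]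
    · intro σ _ h
      have : σ.support.card ≠ 0 := fun hc => h (Equiv.Perm.card_support_eq_zero.1 hc)
      rw [coeff_X_pow_mul', if_neg (by omega)]
    · simp
  · rw [finset_sum_coeff, Finset.sum_eq_single 1]
    · simp only [Equiv.Perm.support_one, Finset.card_empty, pow_zero, one_mul, g1, Finset.compl_empty, map_one, p1]
    · intro σ _ h
      have h0 : σ.support.card ≠ 0 := fun hc => h (Equiv.Perm.card_support_eq_zero.1 hc)
      have h1 := Equiv.Perm.card_support_ne_one σ
      rw [coeff_X_pow_mul', if_neg (by omega)]
    · simp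
  · rw [← swap_sum, ← p2, finset_sum_coeff, ← mul_add]
    congr 1
    have : ∀ σ : Equiv.Perm V, (X ^ σ.support.card * (C (gterm B σ) * ∏ i ∈ σ.supportᶜ, (1 + X * C (B i i)))).coeff 2
        = (if σ = 1 then (∏ i, (1 + X * C (B i i))).coeff 2 else 0) + if σ.support.card = 2 then gterm B σ else 0 := by
      intro σ
      by_cases h : σ = 1
      · subst h
        simp only [Equiv.Perm.support_one, Finset.card_empty, pow_zero, one_mul, g1, Finset.compl_empty, map_one]
        simp
      · have h0 : σ.support.card ≠ 0 := fun hc => h (Equiv.Perm.card_support_eq_zero.1 hc)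
        have h1 := Equiv.Perm.card_support_ne_one σ
        rw [if_neg h, zero_add, coeff_X_pow_mul']
        by_cases h2 : σ.support.card = 2
        · rw [if_pos (by omega), if_pos h2, h2, Nat.sub_self, coeff_C_mul, (prod_coeffs _ _).1, mul_one]
        · rw [if_neg (by omega), if_neg h2]
    rw [Finset.sum_congr rfl (fun σ _ => this σ), Finset.sum_add_distrib, Finset.sum_ite_eq' ]
    simp

end AA

section AB
variable {V : Type*} [Fintype V]

def revPoly (G : SimpleGraph V) : ℚ[X] :=
  ((1 : Matrix V V ℚ[X]) + (X : ℚ[X]) • (-G.lapMatrix ℚ).map C).permanent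

lemma eval_rev (G : SimpleGraph V) {x : ℚ} (hx : x ≠ 0) :
    (revPoly G).eval x = x ^ Fintype.card V * (lapPermPoly G).eval x⁻¹ := by
  have h1 : (revPoly G).eval x = (x • ((x⁻¹ • (1 : Matrix V V ℚ)) - G.lapMatrix ℚ)).permanent := by
    simp only [revPoly, Matrix.permanent, eval_finset_sum, eval_prod]
    refine Finset.sum_congr rfl fun σ _ => Finset.prod_congr rfl fun i _ => ?_
    simp only [Matrix.add_apply, Matrix.smul_apply, Matrix.map_apply, Matrix.neg_apply, Matrix.sub_apply, smul_eq_mul,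
      Matrix.one_apply]
    split_ifs <;> simp <;> field_simp <;> ring
  have h2 : (lapPermPoly G).eval x⁻¹ = ((x⁻¹ • (1 : Matrix V V ℚ)) - G.lapMatrix ℚ).permanent := by
    simp only [lapPermPoly, Matrix.permanent, eval_finset_sum, eval_prod]
    refine Finset.sum_congr rfl fun σ _ => Finset.prod_congr rfl fun i _ => ?_
    simp only [Matrix.smul_apply, Matrix.map_apply, Matrix.sub_apply, smul_eq_mul,
      Matrix.one_apply, Matrix.diagonal_apply]
    split_ifs <;> simp
  rw [h1, h2, Matrix.permanent_smul]

lemma rev_eq {W : Type*} [Fintype W] (G : SimpleGraph V) (H : SimpleGraph W) (h : lapPermPoly G = lapPermPoly H) :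
    X ^ Fintype.card W * revPoly G = X ^ Fintype.card V * revPoly H := by
  apply Polynomial.eq_of_infinite_eval_eq
  refine Set.Infinite.mono (s := {0}ᶜ) ?_ (Set.finite_singleton (0 : ℚ)).infinite_compl
  intro x hx
  have hx : x ≠ 0 := hx
  simp only [Set.mem_setOf_eq, eval_mul, eval_pow, eval_X]
  rw [eval_rev G hx, eval_rev H hx, h]; ring

lemma card_le_aux {W : Type*} [Fintype W] (G : SimpleGraph V) (H : SimpleGraph W) (h : lapPermPoly G = lapPermPoly H) :
    Fintype.card W ≤ Fintype.card V := by
  by_contra hc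
  have h1 := congrArg (fun P => P.coeff (Fintype.card V)) (rev_eq G H h)
  simp only [coeff_X_pow_mul', le_refl, if_true, Nat.sub_self] at h1
  rw [if_neg (by omega), revPoly, (per_coeffs _).1] at h1
  exact zero_ne_one h1

lemma same_inv {W : Type*} [Fintype W] (G : SimpleGraph V) (H : SimpleGraph W) (h : lapPermPoly G = lapPermPoly H) :
    Fintype.card V = Fintype.card W ∧ revPoly G = revPoly H := by
  have hc : Fintype.card V = Fintype.card W := le_antisymm (card_le_aux H G h.symm) (card_le_aux G H h)
  refine ⟨hc, ?_⟩
  have h1 := rev_eq G H h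
  rw [hc] at h1
  exact mul_left_cancel₀ (pow_ne_zero _ X_ne_zero) h1

lemma lap_ne (G : SimpleGraph V) {i j : V} (hij : i ≠ j) : G.lapMatrix ℚ i j = -(G.adjMatrix ℚ i j) := by
  simp [SimpleGraph.lapMatrix, SimpleGraph.degMatrix, Matrix.diagonal_apply_ne _ hij]

lemma lap_diag (G : SimpleGraph V) (i : V) : G.lapMatrix ℚ i i = (dg (G.adjMatrix ℕ) i : ℚ) := by
  simp [SimpleGraph.lapMatrix, SimpleGraph.degMatrix, dg, SimpleGraph.adjMatrix_apply, ← SimpleGraph.card_neighborFinset_eq_degree,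
    SimpleGraph.neighborFinset_eq_filter]

lemma rev_coeffs (G : SimpleGraph V) :
    (revPoly G).coeff 1 = - ∑ i, (dg (G.adjMatrix ℕ) i : ℚ) ∧
    2 * (revPoly G).coeff 2 = (∑ i, (dg (G.adjMatrix ℕ) i : ℚ)) ^ 2 - ∑ i, (dg (G.adjMatrix ℕ) i : ℚ) ^ 2
      + ∑ i, (dg (G.adjMatrix ℕ) i : ℚ) := by
  obtain ⟨-, h1, h2⟩ := per_coeffs (-G.lapMatrix ℚ)
  rw [revPoly, h1, h2]
  simp only [Matrix.neg_apply, lap_diag, Finset.sum_neg_distrib, neg_sq, true_and]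
  congr 1
  refine Finset.sum_congr rfl fun i _ => ?_
  rw [dg, Nat.cast_sum]
  refine Finset.sum_congr rfl fun j _ => ?_
  by_cases hij : i = j
  · subst hij; simp
  · rw [if_pos hij, lap_ne G hij, lap_ne G (Ne.symm hij)]
    simp only [SimpleGraph.adjMatrix_apply, G.adj_comm j i]
    split_ifs <;> simp

/-- degrees of `G` from coefficients -/
lemma degree_struct {W : Type*} [Fintype W] (G : SimpleGraph V) (H : SimpleGraph W) (h : lapPermPoly G = lapPermPoly H)
    {u' v' : W} (huv' : u' ≠ v') (hH : ∀ x, dg (H.adjMatrix ℕ) x = if x = u' ∨ x = v' then 3 else 2) :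
    ∃ u v : V, u ≠ v ∧ ∀ x, dg (G.adjMatrix ℕ) x = if x = u ∨ x = v then 3 else 2 := by
  obtain ⟨hc, hr⟩ := same_inv G H h
  obtain ⟨a1, a2⟩ := rev_coeffs G
  obtain ⟨b1, b2⟩ := rev_coeffs H
  rw [hr] at a1 a2
  have s1 : ∑ i, (dg (G.adjMatrix ℕ) i : ℚ) = ∑ i, (dg (H.adjMatrix ℕ) i : ℚ) := by linarith
  have s2 : ∑ i, (dg (G.adjMatrix ℕ) i : ℚ) ^ 2 = ∑ i, (dg (H.adjMatrix ℕ) i : ℚ) ^ 2 := by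
    rw [s1] at a2; linarith
  have t1 : ∑ i, (dg (G.adjMatrix ℕ) i : ℤ) = ∑ i, (dg (H.adjMatrix ℕ) i : ℤ) := by exact_mod_cast s1
  have t2 : ∑ i, (dg (G.adjMatrix ℕ) i : ℤ) ^ 2 = ∑ i, (dg (H.adjMatrix ℕ) i : ℤ) ^ 2 := by exact_mod_cast s2
  have pairsum : ∀ f : W → ℤ, (∀ x, f x = if x = u' ∨ x = v' then 1 else 0) → ∑ x, f x = 2 := by
    intro f hf
    have : Finset.univ.filter (fun x => x = u' ∨ x = v') = {u', v'} := by ext; simp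
    rw [Finset.sum_congr rfl (fun x _ => hf x), ← Finset.sum_filter, this, Finset.sum_pair huv']
    simp [huv']
  have p1 := pairsum (fun x => (dg (H.adjMatrix ℕ) x : ℤ) - 2) (fun x => by
    simp only [hH]; split_ifs <;> simp)
  have p2 := pairsum (fun x => ((dg (H.adjMatrix ℕ) x : ℤ) - 2) ^ 2) (fun x => by
    simp only [hH]; split_ifs <;> simp)
  have q1 : ∑ x, ((dg (G.adjMatrix ℕ) x : ℤ) - 2) = 2 := by
    refine Eq.trans ?_ p1; simp only [Finset.sum_sub_distrib, t1]; simp [hc]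
  have q2 : ∑ x, ((dg (G.adjMatrix ℕ) x : ℤ) - 2) ^ 2 = 2 := by
    refine Eq.trans ?_ p2; simp only [sub_sq, Finset.sum_sub_distrib, Finset.sum_add_distrib, t2, mul_assoc, ← Finset.mul_sum, ← Finset.sum_mul, t1]
    simp [hc]
  have hx : ∀ x, (dg (G.adjMatrix ℕ) x : ℤ) - 2 = 0 ∨ (dg (G.adjMatrix ℕ) x : ℤ) - 2 = 1 := by
    have hnn : ∀ z : ℤ, 0 ≤ z ^ 2 - z := fun z => by
      rcases le_or_gt z 0 with h | h <;> nlinarith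
    have hs : ∑ x, (((dg (G.adjMatrix ℕ) x : ℤ) - 2) ^ 2 - ((dg (G.adjMatrix ℕ) x : ℤ) - 2)) = 0 := by
      rw [Finset.sum_sub_distrib, q1, q2]; rfl
    rw [Finset.sum_eq_zero_iff_of_nonneg (fun x _ => hnn _)] at hs
    intro x
    have := hs x (Finset.mem_univ x)
    have h3 : ((dg (G.adjMatrix ℕ) x : ℤ) - 2) * ((dg (G.adjMatrix ℕ) x : ℤ) - 2 - 1) = 0 := by linarith
    rcases mul_eq_zero.1 h3 with h | h
    · exact Or.inl h
    · exact Or.inr (by linarith)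
  have hcard : (Finset.univ.filter fun x => dg (G.adjMatrix ℕ) x = 3).card = 2 := by
    have : (((Finset.univ.filter fun x => dg (G.adjMatrix ℕ) x = 3).card : ℕ) : ℤ) = 2 := by
      refine Eq.trans ?_ q1; rw [Finset.card_filter, Nat.cast_sum]
      refine Finset.sum_congr rfl fun x _ => ?_
      rcases hx x with h | h
      · rw [h, if_neg (by omega)]; rfl
      · rw [h, if_pos (by omega)]; rfl
    exact_mod_cast this
  obtain ⟨u, v, huv, he⟩ := Finset.card_eq_two.1 hcard
  refine ⟨u, v, huv, fun x => ?_⟩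
  have hm : dg (G.adjMatrix ℕ) x = 3 ↔ x = u ∨ x = v := by
    have := Finset.ext_iff.1 he x
    simpa using this
  split_ifs with h
  · exact hm.2 h
  · have := hx x
    have h3 : ¬ dg (G.adjMatrix ℕ) x = 3 := fun h' => h (hm.1 h')
    omega

lemma map_chain {R : Type*} [CommRing R] (v : V) : ∀ (l : List V) (u : V),
    (chainM ℕ u l v).map (Nat.castRingHom R) = chainM R u l v := by
  intro l
  induction l with
  | nil => intro u; ext i j; simp [chainM, Matrix.single_apply]
  | cons x l ih =>
    intro u
    rw [chainM, chainM, ← ih x]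
    ext i j; simp [Matrix.single_apply]

lemma map_cycA {R : Type*} [CommRing R] (cs : List (V × List V)) :
    (cycA ℕ cs).map (Nat.castRingHom R) = cycA R cs := by
  induction cs with
  | nil => ext i j; simp [cycA]
  | cons c cs ih =>
    have e1 : cycA ℕ (c :: cs) = chainM ℕ c.1 c.2 c.1 + cycA ℕ cs := by simp [cycA]
    have e2 : cycA R (c :: cs) = chainM R c.1 c.2 c.1 + cycA R cs := by simp [cycA]
    rw [e1, e2, ← ih, ← map_chain]
    ext i j; simp

lemma lap_eq (G : SimpleGraph V) {u v : V} (h : ∀ x, dg (G.adjMatrix ℕ) x = if x = u ∨ x = v then 3 else 2) :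
    lapPermPoly G = (dgv (X - 2 : ℚ[X]) u v + (G.adjMatrix ℕ).map (Nat.castRingHom ℚ[X])).permanent := by
  unfold lapPermPoly
  congr 1
  ext1 i j
  by_cases hij : i = j
  · subst hij
    simp only [Matrix.sub_apply, Matrix.add_apply, Matrix.diagonal_apply_eq, Matrix.map_apply, lap_diag, dgv, h]
    split_ifs
    · simp [map_ofNat C 3]; ring
    · simp [map_ofNat C 2]
  · simp only [Matrix.sub_apply, Matrix.add_apply, Matrix.diagonal_apply_ne _ hij, Matrix.map_apply, lap_ne G hij, dgv]
    simp [SimpleGraph.adjMatrix_apply]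

end AB

section ZZ
variable {V : Type*} [Fintype V]

lemma cover_card {L : List V} (hnd : L.Nodup) (hall : ∀ x, x ∈ L) : L.length = Fintype.card V := by
  rw [← List.toFinset_card_of_nodup hnd, Finset.card_eq_iff_eq_univ]
  ext x; simp [hall x]

lemma chain_info (G : SimpleGraph V) {p q r : ℕ} (hp : 3 ≤ p) (hq : 3 ≤ q)
    {u v : V} {l1 l2 l3 : List V} (e1 : l1.length + 1 = p) (e2 : l2.length + 1 = q)
    (e3 : l3.length = r) (hA : G.adjMatrix ℕ = chainM ℕ u l1 u + chainM ℕ v l2 v + chainM ℕ u l3 v)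
    (hnd : (u :: v :: (l1 ++ l2 ++ l3)).Nodup) (hall : ∀ x, x ∈ u :: v :: (l1 ++ l2 ++ l3)) :
    (∃ u v : V, u ≠ v ∧ ∀ x, dg (G.adjMatrix ℕ) x = if x = u ∨ x = v then 3 else 2) ∧
    lapPermPoly G = WD (X - 2) (p - 1) (q - 1) r := by
  have hd : ∀ x, dg (G.adjMatrix ℕ) x = if x = u ∨ x = v then 3 else 2 := by
    intro x
    have hc : (u :: v :: (l1 ++ l2 ++ l3)).count x = 1 := List.count_eq_one_of_mem hnd (hall x)
    simp only [List.count_cons, List.count_append, beq_iff_eq, @eq_comm _ _ x] at hc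
    rw [hA, dg_add, dg_add, dg_chain, dg_chain, dg_chain]
    by_cases h1 : x = u
    · by_cases h2 : x = v
      · rw [if_pos h1, if_pos h2] at hc; omega
      · simp only [h1, h2, if_true, if_false, true_or] at hc ⊢
        rw [← h1] at hc ⊢
        simp only [h2, if_false] at hc ⊢
        omega
    · by_cases h2 : x = v
      · simp only [h1, if_pos h2, if_false, false_or] at hc ⊢
        omega
      · simp only [h1, h2, if_false, false_or] at hc ⊢
        omega
  have huv : u ≠ v := by
    intro h; subst h; simp at hnd
  refine ⟨⟨u, v, huv, hd⟩, ?_⟩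
  rw [lap_eq _ hd]
  have h := per_dumb (X - 2 : ℚ[X]) (u := u) (v := v) l1 l2 l3 [] (by simpa [cycV] using hnd) (by simpa [cycV] using hall)
    (by rintro rfl; simp at e1; omega) (by rintro rfl; simp at e2; omega) (by simp)
  rw [List.map_nil, List.prod_nil, one_mul, show l1.length = p - 1 by omega, show l2.length = q - 1 by omega, e3] at h
  rw [← h, ← map_chain, ← map_chain, ← map_chain, ← map_cycA, hA]
  congr 2
  ext i j; simp [cycA]

lemma cs_multiset (cs : List (V × List V)) (y : ℚ[X]) :
    (cs.map fun c => fcy y (c.2.length + 1)).prod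
      = (((cs.map fun c => c.2.length + 1 : List ℕ) : Multiset ℕ).map (fcy y)).prod := by
  rw [Multiset.map_coe, Multiset.prod_coe, List.map_map]; rfl

lemma cycV_length (cs : List (V × List V)) :
    (cycV cs).length = ((cs.map fun c => c.2.length + 1 : List ℕ) : Multiset ℕ).sum := by
  induction cs with
  | nil => rfl
  | cons c cs ih => 
    have e2 : cycV (c :: cs) = (c.1 :: c.2) ++ cycV cs := by simp [cycV]
    rw [e2, List.length_append, ih]; simp

lemma WT_swap12 (y : ℚ[X]) (a b c : ℕ) : WT y a b c = WT y b a c := by unfold WT; ring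
lemma WT_swap23 (y : ℚ[X]) (a b c : ℕ) : WT y a b c = WT y a c b := by unfold WT; ring

lemma theta_final {p q r : ℕ} (hp : 3 ≤ p) (hq : 3 ≤ q) (hr : 1 ≤ r) {ks : Multiset ℕ} (hk : ∀ k ∈ ks, 3 ≤ k) {a b c : ℕ}
    (h : WD (X - 2 : ℚ[X]) (p - 1) (q - 1) r = (ks.map (fcy (X - 2))).prod * WT (X - 2) a b c)
    (hn : a + b + c + ks.sum + 2 = p + q + r) (hab : a ≤ b) (hbc : b ≤ c) (hb : 1 ≤ b) : False := by
  have h1 := subst_theta h (by omega)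
  rw [show p - 1 + 1 = p by omega, show q - 1 + 1 = q by omega] at h1
  exact theta_arith h1 hp hq hr hk (by omega) (by omega) (by omega) (by omega) (by omega)

lemma theta_final' {p q r : ℕ} (hp : 3 ≤ p) (hq : 3 ≤ q) (hr : 1 ≤ r) {ks : Multiset ℕ} (hk : ∀ k ∈ ks, 3 ≤ k) {a b c : ℕ}
    (h : WD (X - 2 : ℚ[X]) (p - 1) (q - 1) r = (ks.map (fcy (X - 2))).prod * WT (X - 2) a b c)
    (hn : a + b + c + ks.sum + 2 = p + q + r) (hab : 1 ≤ a ∨ 1 ≤ b) (hac : 1 ≤ a ∨ 1 ≤ c) (hbc : 1 ≤ b ∨ 1 ≤ c) :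
    False := by
  wlog h1 : a ≤ b generalizing a b
  · exact this (by rw [WT_swap12]; exact h) (by omega) (by omega) (by omega) (by omega) (by omega)
  rcases le_total b c with h2 | h2
  · exact theta_final hp hq hr hk h hn h1 h2 (by omega)
  · rw [WT_swap23] at h
    rcases le_total a c with h3 | h3
    · exact theta_final hp hq hr hk h (by omega) h3 h2 (by omega)
    · rw [WT_swap12] at h
      exact theta_final hp hq hr hk h (by omega) h3 h1 (by omega)

end ZZ

/-- **Theorem 1.1.** The graph `d(p,q,r)` is determined by its Laplacian permanental
polynomial: any simple graph with the same Laplacian permanental polynomial as `d(p,q,r)`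
is isomorphic to `d(p,q,r)`. -/
theorem dGraph_determined_by_lapPermPoly
    (p q r : ℕ) (hp : 3 ≤ p) (hq : 3 ≤ q) (hr : 1 ≤ r)
    {V : Type*} [Fintype V] (G : SimpleGraph V)
    (h : lapPermPoly G = lapPermPoly (dGraph p q r)) :
    Nonempty (G ≃g dGraph p q r) := by
  obtain ⟨_, _, _, _, _, f1, f2, f3, f4, f5, f6⟩ := dGraph_chain hp hq hr
  obtain ⟨⟨u', v', huv', hd'⟩, hW⟩ := chain_info (dGraph p q r) hp hq f1 f2 f3 f4 f5 f6
  have hcard := (same_inv G _ h).1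
  rw [Fintype.card_fin] at hcard
  obtain ⟨u, v, huv, hd⟩ := degree_struct G _ h huv' hd'
  have hGM : GM (G.adjMatrix ℕ) := by
    refine ⟨fun i j => ?_, fun i => ?_⟩
    · simp only [adj_mat_nat, G.adj_comm i j]
    · simp [adj_mat_nat]
  have hle : ∀ i j, G.adjMatrix ℕ i j ≤ 1 := by
    intro i j; rw [adj_mat_nat]; split_ifs <;> omega
  obtain ⟨l1, l2, l3, cs, hnd, hall, hcs, hA⟩ := peel_main hGM hle huv (by rw [hd]; simp) (by rw [hd]; simp)
    (fun x h1 h2 => by rw [hd]; simp [h1, h2])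
  rw [hW, lap_eq G hd] at h
  have hlen := cover_card hnd hall
  rw [hcard] at hlen
  simp only [List.length_cons, List.length_append, cycV_length] at hlen
  have hcs' : ∀ c ∈ cs, c.2 ≠ [] := by
    intro c hc e
    have := hcs c hc
    rw [e] at this; simp at this
  have hk : ∀ k ∈ ((cs.map fun c => c.2.length + 1 : List ℕ) : Multiset ℕ), 3 ≤ k := by
    intro k hk
    rw [Multiset.mem_coe, List.mem_map] at hk
    obtain ⟨c, hc, rfl⟩ := hk
    have := hcs c hc
    omega
  rcases hA with ⟨hA, hl1, hl2⟩ | ⟨hA, h12, h13, h23⟩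
  · have hper := per_dumb (X - 2 : ℚ[X]) (u := u) (v := v) l1 l2 l3 cs hnd hall
      (by rintro rfl; simp at hl1) (by rintro rfl; simp at hl2) hcs'
    have hmap : (G.adjMatrix ℕ).map (Nat.castRingHom ℚ[X]) = chainM ℚ[X] u l1 u + chainM ℚ[X] v l2 v + chainM ℚ[X] u l3 v
        + cycA ℚ[X] cs := by
      rw [← map_chain, ← map_chain, ← map_chain, ← map_cycA, hA]
      ext i j; simp
    rw [hmap, hper, cs_multiset] at h
    have hD := subst_dumb h.symm (by omega)
    rw [show p - 1 + 1 = p by omega, show q - 1 + 1 = q by omega] at hD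
    obtain ⟨hm, hks⟩ := dumb_arith 2 (by simp) hD (by simp) (by simp) (by simp [hp, hq])
      (by simp; omega) hk (by simp) hr
    have hcs0 : cs = [] := by simpa using hks
    subst hcs0
    simp only [List.map_nil, Multiset.coe_nil, Multiset.sum_zero] at hlen
    simp only [cycV, List.flatMap_nil, List.append_nil] at hnd hall
    have hA' : G.adjMatrix ℕ = chainM ℕ u l1 u + chainM ℕ v l2 v + chainM ℕ u l3 v := by
      rw [hA]; simp [cycA]
    have hpq : (l1.length + 1 = p ∧ l2.length + 1 = q) ∨ (l2.length + 1 = p ∧ l1.length + 1 = q) := by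
      have hp' : p ∈ ({l1.length + 1, l2.length + 1} : Multiset ℕ) := by rw [← hm]; simp
      have hs := congrArg Multiset.sum hm
      simp at hp' hs
      omega
    rcases hpq with ⟨e1, e2⟩ | ⟨e1, e2⟩
    · exact dumb_iso G hp hq hr e1 e2 (by omega) hA' hnd hall
    · have hperm : (v :: u :: (l2 ++ l1 ++ l3.reverse)).Perm (u :: v :: (l1 ++ l2 ++ l3)) := by
        rw [List.perm_iff_count]
        intro a
        simp only [List.count_cons, List.count_append, List.count_reverse]
        omega
      refine dumb_iso G hp hq hr (u := v) (v := u) (l3 := l3.reverse) e1 e2 (by rw [List.length_reverse]; omega) ?_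
        (hperm.nodup_iff.2 hnd) (fun x => hperm.mem_iff.2 (hall x))
      rw [hA', ← chain_reverse v l3 u, add_comm (chainM ℕ u l1 u)]
  · exfalso
    have hper := per_theta (X - 2 : ℚ[X]) (u := u) (v := v) l1 l2 l3 cs hnd hall hcs'
    have hmap : (G.adjMatrix ℕ).map (Nat.castRingHom ℚ[X]) = chainM ℚ[X] u l1 v + chainM ℚ[X] u l2 v + chainM ℚ[X] u l3 v
        + cycA ℚ[X] cs := by
      rw [← map_chain, ← map_chain, ← map_chain, ← map_cycA, hA]
      ext i j; simp
    rw [hmap, hper, cs_multiset] at h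
    simp only [← List.length_pos_iff_ne_nil] at h12 h13 h23
    exact theta_final' hp hq hr hk h.symm (by omega) h12 h13 h23
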